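/- Let π ∈ ℤ[ρ] be a primary prime with p = π·π̄. Then: G_π(χ_π, φ)³ ≡ 1 (mod √−3) if p ≡ 7 (mod 18); G_π(χ_π, φ^{−1})³ ≡ −1 (mod √−3) if p ≡ 13 (mod 18); and G_π(χ_π, ψ)³ ≡ 0 (mod √−3) if p ≡ 1 (mod 18). -/

import Mathlib

open Complex BigOperators

noncomputable section

/-- `ρ = e^{2πi/3}`, a primitive cube root of unity. -/
def ρ3 : ℂ := Complex.exp (2 * Real.pi * Complex.I / 3)

/-- The ring of Eisenstein integers `ℤ[ρ]`, realized as a subring of `ℂ`. -/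
def O3 : Subring ℂ := Subring.closure {ρ3}

/-- `√−3 = i·√3`. -/
def sqrtm3 : ℂ := Complex.I * (Real.sqrt 3 : ℝ)

/-- The congruence `a ≡ b (mod c)` in `ℤ[ρ]`. -/
def ECong (a b c : ℂ) : Prop := ∃ d ∈ O3, a - b = c * d

/-- `a` and `b` are coprime in `ℤ[ρ]`. -/
def ECoprime (a b : ℂ) : Prop := ∃ u ∈ O3, ∃ v ∈ O3, u * a + v * b = 1

/-- The real period `ϖ₁ = ∫₀¹ (1−x³)^{−2/3} dx`. -/
def varpi1 : ℝ := ∫ x in (0:ℝ)..(1:ℝ), (1 - x ^ 3) ^ (-(2:ℝ)/3)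

/-- The points of the period lattice `ϖ₁·ℤ[ρ]`. -/
def ω3 (m : ℤ × ℤ) : ℂ := (varpi1 : ℂ) * ((m.1 : ℂ) + (m.2 : ℂ) * ρ3)

/-- The Weierstrass `℘`-function of the period lattice `ϖ₁·ℤ[ρ]`
(so that `℘′² = 4℘³ − 27`). -/
def wp3 (u : ℂ) : ℂ :=
  (u ^ 2)⁻¹ + ∑' m : ℤ × ℤ, if m = 0 then 0 else (((u - ω3 m) ^ 2)⁻¹ - ((ω3 m) ^ 2)⁻¹)

/-- The derivative `℘′` of the Weierstrass `℘`-function of `ϖ₁·ℤ[ρ]`. -/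
def wp3' (u : ℂ) : ℂ := ∑' m : ℤ × ℤ, (-2) * ((u - ω3 m) ^ 3)⁻¹

/-- The Weierstrass `ζ`-function of the period lattice `ϖ₁·ℤ[ρ]`. -/
def wzeta3 (u : ℂ) : ℂ :=
  u⁻¹ + ∑' m : ℤ × ℤ, if m = 0 then 0 else ((u - ω3 m)⁻¹ + (ω3 m)⁻¹ + u * ((ω3 m) ^ 2)⁻¹)

/-- The non-analytic doubly periodic function `Z(u) = ζ(ϖ₁u) − (2π/(√3·ϖ₁))·ū`. -/
def Z3 (u : ℂ) : ℂ :=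
  wzeta3 ((varpi1 : ℂ) * u) -
    ((2 * Real.pi / (Real.sqrt 3 * varpi1) : ℝ) : ℂ) * (starRingEnd ℂ) u

/-- The elliptic function `φ(u) = 6℘(ϖ₁u)/(9+℘′(ϖ₁u))` of period lattice `ℤ[ρ]`. -/
def phi3 (u : ℂ) : ℂ := 6 * wp3 ((varpi1 : ℂ) * u) / (9 + wp3' ((varpi1 : ℂ) * u))

/-- The elliptic function `ψ(u) = (9−℘′(ϖ₁u))/(9+℘′(ϖ₁u))` of period lattice `ℤ[ρ]`. -/
def psi3 (u : ℂ) : ℂ := (9 - wp3' ((varpi1 : ℂ) * u)) / (9 + wp3' ((varpi1 : ℂ) * u))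

/-- A residue class character modulo `β` on `ℤ[ρ]`. -/
structure IsResChar3 (β : ℂ) (χ : ℂ → ℂ) : Prop where
  periodic : ∀ a ∈ O3, ∀ b ∈ O3, ECong a b β → χ a = χ b
  map_mul : ∀ a ∈ O3, ∀ b ∈ O3, χ (a * b) = χ a * χ b
  map_one : χ 1 = 1
  vanish : ∀ a ∈ O3, ¬ ECoprime a β → χ a = 0

/-- The cubic residue character `χ_π = (·/π)₃` modulo a prime `π` with `p = π·π̄`:
`χ_π(ν)³ = 1` and `χ_π(ν) ≡ ν^{(p−1)/3} (mod π)`. -/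
structure IsCubicChar (π : ℂ) (p : ℕ) (χ : ℂ → ℂ) : Prop where
  resChar : IsResChar3 π χ
  cube : ∀ ν ∈ O3, ECoprime ν π → χ ν ^ 3 = 1
  euler : ∀ ν ∈ O3, ECoprime ν π → ECong (χ ν) (ν ^ ((p - 1) / 3)) π

/-- The elliptic Gauss sum `G_π(χ, f) = (1/3)·Σ_{ν ∈ (ℤ[ρ]/(π))^×} χ(ν)·f(ν/π)`,
computed via the integer representatives `1, …, p−1` of `(ℤ[ρ]/(π))^× ≅ (ℤ/p)^×`. -/
def EGS3 (p : ℕ) (χ f : ℂ → ℂ) (π : ℂ) : ℂ :=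
  (1/3 : ℂ) * ∑ r ∈ Finset.Icc 1 (p - 1), χ (r : ℂ) * f ((r : ℂ) / π)

/-- `S` is a third set of `(ℤ[ρ]/(π))^×`, i.e. `(ℤ[ρ]/(π))^× = S ∪ ρS ∪ ρ̄S`. -/
def IsThirdSet (π : ℂ) (S : Finset ℂ) : Prop :=
  (∀ ν ∈ S, ν ∈ O3 ∧ ECoprime ν π) ∧
  (∀ a ∈ O3, ECoprime a π →
    ∃ ν ∈ S, ∃ ε ∈ ({1, ρ3, ρ3 ^ 2} : Set ℂ), ECong a (ε * ν) π) ∧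
  (∀ ν ∈ S, ∀ μ ∈ S, ∀ ε ∈ ({1, ρ3, ρ3 ^ 2} : Set ℂ), ∀ ε' ∈ ({1, ρ3, ρ3 ^ 2} : Set ℂ),
    ECong (ε * ν) (ε' * μ) π → ν = μ ∧ ε = ε')

/-- `γ(S)` is the cube root of unity with `γ(S) ≡ −∏_{ν∈S} ν (mod π)`. -/
def IsGamma3 (π : ℂ) (S : Finset ℂ) (γ : ℂ) : Prop :=
  γ ^ 3 = 1 ∧ ECong γ (-(∏ ν ∈ S, ν)) π

/-- `L` is the value at `s = 1` of the analytic continuation of the Hecke `L`-series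
`L(s, χ̃) = Σ_𝔞 χ̃(𝔞)·N𝔞^{−s} = (1/6)·Σ_{ν ∈ ℤ[ρ]} χ₁(ν)·ν̄·|ν|^{−2s}` attached to the
weight-one Hecke character `χ̃((ν)) = χ₁(ν)·ν̄` of `ℚ(ρ)`. -/
def IsLValue3 (χ₁ : ℂ → ℂ) (L : ℂ) : Prop :=
  ∃ F : ℂ → ℂ, DifferentiableOn ℂ F {s : ℂ | 0 < s.re} ∧
    (∀ s : ℂ, 3/2 < s.re →
      F s = (1/6 : ℂ) *
        ∑' ν : O3, χ₁ (ν : ℂ) * (starRingEnd ℂ) (ν : ℂ) *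
          ((Complex.normSq (ν : ℂ) : ℂ) ^ (-s))) ∧
    F 1 = L

/-- `T` is a complete residue system modulo `β` in `ℤ[ρ]`. -/
def IsCRS3 (β : ℂ) (T : Finset ℂ) : Prop :=
  (∀ a ∈ T, a ∈ O3) ∧ (∀ a ∈ T, ∀ b ∈ T, ECong a b β → a = b) ∧
  (∀ z ∈ O3, ∃ a ∈ T, ECong z a β)

/-- `e^{2πi·S(z)}` where `S(a + b·ρ̄) = a`, i.e. `2πi·S(z) = (2π/√3)·(zρ − z̄ρ̄)`. -/
def eS3 (z : ℂ) : ℂ :=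
  Complex.exp (((2 * Real.pi / Real.sqrt 3 : ℝ) : ℂ) *
    (z * ρ3 - (starRingEnd ℂ) z * (starRingEnd ℂ) ρ3))

/-- `χ₀`: the character mod `3` giving the natural isomorphism `(ℤ[ρ]/(3))^× ≅ W`,
i.e. `χ₀(ν) = ε` for `ν ≡ ε (mod 3)`, `ε ∈ W = {±1, ±ρ, ±ρ̄}`. -/
def IsChi0₃ (χ₀ : ℂ → ℂ) : Prop :=
  IsResChar3 3 χ₀ ∧ ∀ ε ∈ ({1, -1, ρ3, -ρ3, ρ3 ^ 2, -ρ3 ^ 2} : Set ℂ), χ₀ ε = ε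

/-- `χ₀′`: the character mod `√−3` giving `(ℤ[ρ]/(√−3))^× ≅ {±1}`,
i.e. `χ₀′(ν) = δ` for `ν ≡ δ (mod √−3)`, `δ ∈ {±1}`. -/
def IsChi0'₃ (χ₀' : ℂ → ℂ) : Prop :=
  IsResChar3 sqrtm3 χ₀' ∧ χ₀' (-1) = -1

/-- The classical cubic (Kummer) Gauss sum `G₃(π) = Σ_{r=1}^{p−1} (r/π)₃·e^{2πir/p}`. -/
def G3sum (p : ℕ) (χ : ℂ → ℂ) : ℂ :=
  ∑ r ∈ Finset.Icc 1 (p - 1), χ (r : ℂ) * Complex.exp (2 * Real.pi * Complex.I * (r : ℂ) / (p : ℂ))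

noncomputable section
open Filter Topology

namespace PeriodPair

lemma isPreconnected_compl_of_countable {S : Set ℂ} (hS : S.Countable) : IsPreconnected Sᶜ :=
  (hS.isPathConnected_compl_of_one_lt_rank (by simp)).isConnected.isPreconnected

lemma countable_lattice (L : PeriodPair) : (L.lattice : Set ℂ).Countable := by
  have : Countable L.lattice := L.latticeEquivProd.toEquiv.countable_iff.mpr inferInstance
  exact Set.to_countable _

variable {L : PeriodPair}

lemma hasDerivAt_weierstrassP {z : ℂ} (hz : z ∉ L.lattice) :
    HasDerivAt L.weierstrassP (L.derivWeierstrassP z) z := by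
  rw [← L.deriv_weierstrassP]
  exact (L.analyticOnNhd_weierstrassP z hz).differentiableAt.hasDerivAt

lemma weierstrassP_eq_except (z : ℂ) :
    L.weierstrassP z = L.weierstrassPExcept 0 z + 1 / z ^ 2 := by
  simpa using (L.weierstrassPExcept_add 0 z).symm

lemma derivWeierstrassP_eq_except (z : ℂ) :
    L.derivWeierstrassP z = L.derivWeierstrassPExcept 0 z - 2 / z ^ 3 := by
  simpa using (L.derivWeierstrassPExcept_sub 0 z).symm

lemma eventually_notMem_lattice (L : PeriodPair) (x : ℂ) : ∀ᶠ z in 𝓝[≠] x, z ∉ L.lattice := by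
  filter_upwards [nhdsWithin_le_nhds (L.compl_lattice_sdiff_singleton_mem_nhds x),
    self_mem_nhdsWithin] with z hz hz' h
  exact hz ⟨h, hz'⟩

lemma tendsto_sq_mul_weierstrassP (L : PeriodPair) :
    Tendsto (fun z => z ^ 2 * L.weierstrassP z) (𝓝[≠] 0) (𝓝 1) := by
  have h : ContinuousAt (fun z => z ^ 2 * L.weierstrassPExcept 0 z + 1) 0 := by
    have := (L.analyticAt_weierstrassPExcept 0).continuousAt
    fun_prop
  have h' := h.tendsto.mono_left (nhdsWithin_le_nhds (s := {0}ᶜ))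
  simp only [ne_eq, OfNat.ofNat_ne_zero, not_false_eq_true, zero_pow, zero_mul, zero_add] at h'
  refine h'.congr' ?_
  filter_upwards [self_mem_nhdsWithin] with z hz
  have hz : z ≠ 0 := hz
  rw [weierstrassP_eq_except]
  field_simp

lemma tendsto_cube_mul_derivWeierstrassP (L : PeriodPair) :
    Tendsto (fun z => z ^ 3 * L.derivWeierstrassP z) (𝓝[≠] 0) (𝓝 (-2)) := by
  have h : ContinuousAt (fun z => z ^ 3 * L.derivWeierstrassPExcept 0 z - 2) 0 := by
    have := (L.analyticAt_derivWeierstrassPExcept 0).continuousAt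
    fun_prop
  have h' := h.tendsto.mono_left (nhdsWithin_le_nhds (s := {0}ᶜ))
  simp only [ne_eq, OfNat.ofNat_ne_zero, not_false_eq_true, zero_pow, zero_mul, zero_sub] at h'
  refine h'.congr' ?_
  filter_upwards [self_mem_nhdsWithin] with z hz
  have hz : z ≠ 0 := hz
  rw [derivWeierstrassP_eq_except]
  field_simp

/-- A lattice whose Weierstrass equation is `℘'² = 4℘³ - 27`. -/
structure IsEisenstein (L : PeriodPair) : Prop where
  g₂_eq : L.g₂ = 0
  g₃_eq : L.g₃ = 27

namespace IsEisenstein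
variable (hL : L.IsEisenstein)
include hL

lemma derivWeierstrassP_sq {z : ℂ} (hz : z ∉ L.lattice) :
    L.derivWeierstrassP z ^ 2 = 4 * L.weierstrassP z ^ 3 - 27 := by
  rw [L.derivWeierstrassP_sq z hz, hL.g₂_eq, hL.g₃_eq]; ring

end IsEisenstein
end PeriodPair
end

noncomputable section
open Filter Topology

namespace PeriodPair
variable {L : PeriodPair}

lemma analyticAt_weierstrassP {z : ℂ} (hz : z ∉ L.lattice) : AnalyticAt ℂ L.weierstrassP z :=
  L.analyticOnNhd_weierstrassP z hz

lemma analyticAt_derivWeierstrassP {z : ℂ} (hz : z ∉ L.lattice) :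
    AnalyticAt ℂ L.derivWeierstrassP z :=
  L.analyticOnNhd_derivWeierstrassP z hz

lemma eventually_notMem_lattice_nhds {z : ℂ} (hz : z ∉ L.lattice) : ∀ᶠ y in 𝓝 z, y ∉ L.lattice :=
  L.isClosed_lattice.isOpen_compl.mem_nhds hz

lemma eventually_derivWeierstrassP_ne_zero (L : PeriodPair) :
    ∀ᶠ z in 𝓝[≠] 0, L.derivWeierstrassP z ≠ 0 := by
  filter_upwards [L.tendsto_cube_mul_derivWeierstrassP.eventually_ne
    (show (-2 : ℂ) ≠ 0 by norm_num)] with z hz h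
  simp [h] at hz

lemma eventually_eq_zero_of_eventually_nhdsNE {f : ℂ → ℂ} {x : ℂ} {S : Set ℂ} (hS : S.Countable)
    (hf : AnalyticOnNhd ℂ f Sᶜ) (h : ∀ᶠ z in 𝓝[≠] x, f z = 0) (hSx : ∀ᶠ z in 𝓝[≠] x, z ∉ S) :
    ∀ z ∉ S, f z = 0 := by
  obtain ⟨z, h1, h2⟩ := (hSx.and (eventually_nhdsNE_eventually_nhds_iff.mpr h)).exists
  exact hf.eqOn_zero_of_preconnected_of_eventuallyEq_zero
    (isPreconnected_compl_of_countable hS) h1 h2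

namespace IsEisenstein
variable (hL : L.IsEisenstein)
include hL

lemma hasDerivAt_derivWeierstrassP {z : ℂ} (hz : z ∉ L.lattice) :
    HasDerivAt L.derivWeierstrassP (6 * L.weierstrassP z ^ 2) z := by
  have han : AnalyticOnNhd ℂ (fun z => deriv L.derivWeierstrassP z - 6 * L.weierstrassP z ^ 2)
      L.latticeᶜ := fun z hz => by
    have h1 := analyticAt_derivWeierstrassP (L := L) hz
    have h2 := analyticAt_weierstrassP (L := L) hz
    have h3 := h1.deriv
    fun_prop
  have key : ∀ z ∉ L.lattice, L.derivWeierstrassP z ≠ 0 →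
      deriv L.derivWeierstrassP z - 6 * L.weierstrassP z ^ 2 = 0 := by
    intro z hz hne
    have h1 := (analyticAt_derivWeierstrassP (L := L) hz).differentiableAt.hasDerivAt
    have h2 := hasDerivAt_weierstrassP (L := L) hz
    have h3 := (h1.pow 2)
    have h4 := ((h2.pow 3).const_mul 4).sub_const 27
    have h5 : (fun z => L.derivWeierstrassP z ^ 2) =ᶠ[𝓝 z]
        fun z => 4 * L.weierstrassP z ^ 3 - 27 := by
      filter_upwards [eventually_notMem_lattice_nhds hz] with y hy
      exact hL.derivWeierstrassP_sq hy
    have h6 := h3.unique (h4.congr_of_eventuallyEq h5)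
    apply mul_left_cancel₀ hne
    simp at h6
    linear_combination h6 / 2
  have := eventually_eq_zero_of_eventually_nhdsNE (x := 0) L.countable_lattice han ?_
    (L.eventually_notMem_lattice 0) z hz
  · rw [← sub_eq_zero.mp this]
    exact (analyticAt_derivWeierstrassP (L := L) hz).differentiableAt.hasDerivAt
  · filter_upwards [L.eventually_notMem_lattice 0, L.eventually_derivWeierstrassP_ne_zero]
      with y h1 h2 using key y h1 h2

/-- The polynomial form of the addition theorem, with fixed sum `c`. -/
lemma addition_aux {c : ℂ} (hc : c ∉ L.lattice) {u : ℂ} (hu : u ∉ L.lattice)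
    (hcu : c - u ∉ L.lattice) :
    (L.derivWeierstrassP u - L.derivWeierstrassP (c - u)) ^ 2 / 4 -
      (L.weierstrassP u + L.weierstrassP (c - u) + L.weierstrassP c) *
        (L.weierstrassP u - L.weierstrassP (c - u)) ^ 2 = 0 := by
  set C := L.weierstrassP c with hC
  set E : ℂ → ℂ := fun u => (L.derivWeierstrassP u - L.derivWeierstrassP (c - u)) ^ 2 / 4 -
      (L.weierstrassP u + L.weierstrassP (c - u) + C) *
        (L.weierstrassP u - L.weierstrassP (c - u)) ^ 2 with hE
  let h : ℂ → ℂ := L.weierstrassPExcept 0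
  let h' : ℂ → ℂ := L.derivWeierstrassPExcept 0
  let b : ℂ → ℂ := fun z => L.weierstrassP (c - z)
  let b' : ℂ → ℂ := fun z => L.derivWeierstrassP (c - z)
  have hc0 : c - 0 ∉ L.lattice := by simpa using hc
  have anb {u : ℂ} (hu : c - u ∉ L.lattice) : AnalyticAt ℂ b u :=
    (analyticAt_weierstrassP hu).fun_comp (by fun_prop)
  have anb' {u : ℂ} (hu : c - u ∉ L.lattice) : AnalyticAt ℂ b' u :=
    (analyticAt_derivWeierstrassP hu).fun_comp (by fun_prop)
  have anh : AnalyticAt ℂ h 0 := L.analyticAt_weierstrassPExcept 0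
  have anh' : AnalyticAt ℂ h' 0 := L.analyticAt_derivWeierstrassPExcept 0
  have anb0 := anb hc0
  have anb'0 := anb' hc0
  let t : ℂ → ℂ := fun z => h z - b z
  let s : ℂ → ℂ := fun z => h' z - b' z
  -- `R` is the analytic extension of `E / T ^ 2` to the origin
  let R : ℂ → ℂ := fun z => (- z * s z + z ^ 4 * s z ^ 2 / 4 - 2 * t z - z ^ 2 * t z ^ 2
    - (h z + b z + C) * (1 + z ^ 2 * t z) ^ 2) / (1 + z ^ 2 * t z) ^ 2
  have anR : AnalyticAt ℂ R 0 := by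
    refine AnalyticAt.div ?_ ?_ ?_
    · simp only [t, s]; fun_prop
    · simp only [t]; fun_prop
    · simp
  have hR0 : R 0 = 0 := by
    have : h 0 = 0 := L.weierstrassPExcept_zero 0
    simp [R, t, b, this, ← hC]
    ring
  have hT : ∀ᶠ z in 𝓝[≠] (0 : ℂ), 1 + z ^ 2 * t z ≠ 0 := by
    have : ContinuousAt (fun z => 1 + z ^ 2 * t z) 0 := by
      have := anh.continuousAt
      have := anb0.continuousAt
      simp only [t]; fun_prop
    exact nhdsWithin_le_nhds (this.eventually_ne (by simp))
  have hcz : ∀ᶠ z in 𝓝[≠] (0 : ℂ), c - z ∉ L.lattice :=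
    nhdsWithin_le_nhds (((continuous_const.sub continuous_id).tendsto' (0 : ℂ) c
      (by simp)).eventually (eventually_notMem_lattice_nhds hc))
  have hz0 : ∀ᶠ z in 𝓝[≠] (0 : ℂ), z ≠ 0 := self_mem_nhdsWithin
  have hTf : ∀ z, z ≠ 0 → L.weierstrassP z - L.weierstrassP (c - z) = (1 + z ^ 2 * t z) / z ^ 2 := by
    intro z hz
    rw [weierstrassP_eq_except z]
    simp only [t, h, b]
    field_simp
    ring
  have hRE : ∀ z, z ≠ 0 → 1 + z ^ 2 * t z ≠ 0 →
      R z = E z / (L.weierstrassP z - L.weierstrassP (c - z)) ^ 2 := by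
    intro z hz ht
    have e1 := hTf z hz
    have e2 : L.derivWeierstrassP z - L.derivWeierstrassP (c - z) = (-2 + z ^ 3 * s z) / z ^ 3 := by
      rw [derivWeierstrassP_eq_except z]
      simp only [s, h', b']
      field_simp
      ring
    have e3 : L.weierstrassP z + L.weierstrassP (c - z) + C = (1 + z ^ 2 * (h z + b z + C)) / z ^ 2 := by
      rw [weierstrassP_eq_except z]
      simp only [h, b]
      field_simp
      ring
    simp only [hE, e1, e2, e3, R]
    field_simp
    ring
  have hRderiv : ∀ᶠ z in 𝓝[≠] (0 : ℂ), deriv R z = 0 := by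
    have hev : ∀ᶠ z in 𝓝[≠] (0 : ℂ),
        R z = E z / (L.weierstrassP z - L.weierstrassP (c - z)) ^ 2 := by
      filter_upwards [hz0, hT] with z h1 h2 using hRE z h1 h2
    filter_upwards [hz0, hT, hcz, L.eventually_notMem_lattice 0,
      eventually_nhdsNE_eventually_nhds_iff.mpr hev] with z h1 h2 h3 h4 h5
    have hT0 : L.weierstrassP z - L.weierstrassP (c - z) ≠ 0 := by
      rw [hTf z h1]; exact div_ne_zero h2 (pow_ne_zero _ h1)
    refine (HasDerivAt.congr_of_eventuallyEq ?_ h5).deriv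
    have d0 : HasDerivAt (fun z : ℂ => c - z) (-1) z := by
      simpa using (hasDerivAt_id z).const_sub c
    have d1 := hasDerivAt_weierstrassP h4
    have d2 := hL.hasDerivAt_derivWeierstrassP h4
    have d3 := (hasDerivAt_weierstrassP h3).comp z d0
    have d4 := (hL.hasDerivAt_derivWeierstrassP h3).comp z d0
    have q1 := hL.derivWeierstrassP_sq h4
    have q2 := hL.derivWeierstrassP_sq h3
    have dE := ((((d2.sub d4).pow 2).div_const 4).sub
      (((d1.add d3).add_const C).mul ((d1.sub d3).pow 2))).div ((d1.sub d3).pow 2)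
        (by simpa using hT0)
    convert! dE using 1
    simp
    symm
    rw [div_eq_zero_iff]
    left
    generalize L.derivWeierstrassP z = w at *
    generalize L.derivWeierstrassP (c - z) = w' at *
    generalize L.weierstrassP z = x at *
    generalize L.weierstrassP (c - z) = x' at *
    linear_combination (-(w - w') * (x - x') / 2) * (q1 - q2)
  have hRzero : ∀ᶠ z in 𝓝 (0 : ℂ), R z = 0 := by
    have h1 : ∀ᶠ z in 𝓝 (0 : ℂ), deriv R z = 0 :=
      anR.deriv.frequently_zero_iff_eventually_zero.mp hRderiv.frequently
    obtain ⟨ε, hε, hb⟩ := Metric.eventually_nhds_iff_ball.mp (h1.and anR.eventually_analyticAt)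
    refine Metric.eventually_nhds_iff_ball.mpr ⟨ε, hε, fun y hy => ?_⟩
    rw [← hR0]
    refine Metric.isOpen_ball.is_const_of_deriv_eq_zero (convex_ball _ _).isPreconnected
      (fun z hz => (hb z hz).2.differentiableAt.differentiableWithinAt)
      (fun z hz => (hb z hz).1) hy (Metric.mem_ball_self hε)
  have hEzero : ∀ᶠ z in 𝓝[≠] (0 : ℂ), E z = 0 := by
    filter_upwards [hz0, hT, nhdsWithin_le_nhds hRzero] with z h1 h2 h3
    rw [hRE z h1 h2, div_eq_zero_iff] at h3
    refine h3.resolve_right (pow_ne_zero _ ?_)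
    rw [hTf z h1]; exact div_ne_zero h2 (pow_ne_zero _ h1)
  have := eventually_eq_zero_of_eventually_nhdsNE (f := E) (x := 0)
    (S := (L.lattice : Set ℂ) ∪ (fun z => c - z) '' (L.lattice : Set ℂ))
    (L.countable_lattice.union (L.countable_lattice.image _)) ?_ hEzero ?_ u ?_
  · exact this
  · intro z hz
    have h1 : z ∉ L.lattice := fun h => hz (Or.inl h)
    have h2 : c - z ∉ L.lattice := fun h => hz (Or.inr ⟨c - z, h, by simp⟩)
    have := analyticAt_weierstrassP h1
    have := analyticAt_derivWeierstrassP h1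
    have := anb h2
    have := anb' h2
    simp only [b, b'] at *
    simp only [hE]
    fun_prop
  · filter_upwards [L.eventually_notMem_lattice 0, hcz] with z h1 h2
    rintro (h | ⟨y, hy, rfl⟩)
    · exact h1 h
    · simp at h2; exact h2 hy
  · rintro (h | ⟨y, hy, rfl⟩)
    · exact hu h
    · simp at hcu; exact hcu hy

end IsEisenstein
end PeriodPair
end

noncomputable section
open Filter Topology

/-- The curve `y² = x³ - 27/4`. -/
def eisCurve : WeierstrassCurve ℚ := ⟨0, 0, 0, 0, -27 / 4⟩

/-- The curve `y² = x³ - 27/4` over a field `K` of characteristic zero. -/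
abbrev eisCurveOver (K : Type*) [Field K] [Algebra ℚ K] : WeierstrassCurve.Affine K :=
  eisCurve.baseChange K

lemma eisCurveOver_nonsingular {K : Type*} [Field K] [Algebra ℚ K] {x w : K}
    (h : w ^ 2 = 4 * x ^ 3 - 27) : (eisCurveOver K).Nonsingular x (w / 2) := by
  have : CharZero K := algebraRat.charZero K
  rw [WeierstrassCurve.Affine.nonsingular_iff']
  simp only [eisCurveOver, WeierstrassCurve.baseChange, WeierstrassCurve.map, eisCurve]
  rw [WeierstrassCurve.Affine.equation_iff]
  simp only [map_zero, map_div₀, map_neg, map_ofNat, zero_mul, mul_zero, add_zero, zero_sub, ne_eq,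
    neg_eq_zero]
  constructor
  · linear_combination h / 4
  · by_contra! hc
    obtain ⟨h1, h2⟩ := hc
    have h1 : x = 0 := by simpa using h1
    have h2 : w = 0 := by linear_combination h2
    simp [h1, h2] at h

namespace PeriodPair
variable {L : PeriodPair}

lemma eventually_weierstrassP_ne (L : PeriodPair) {f : ℂ → ℂ} (hf : ContinuousAt f 0) :
    ∀ᶠ z in 𝓝[≠] 0, L.weierstrassP z ≠ f z := by
  have h1 : ContinuousAt (fun z => z ^ 2 * f z) 0 := by fun_prop
  have h2 := L.tendsto_sq_mul_weierstrassP.sub (h1.tendsto.mono_left (nhdsWithin_le_nhds (s := {0}ᶜ)))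
  filter_upwards [h2.eventually_ne (show (1 - 0 ^ 2 * f 0 : ℂ) ≠ 0 by simp)] with z hz h
  simp [h] at hz

namespace IsEisenstein
variable (hL : L.IsEisenstein)
include hL

/-- The complex uniformization of the curve `y² = x³ - 27/4`. -/
def point (u : ℂ) : (eisCurveOver ℂ).Point :=
  open Classical in
  if h : u ∈ L.lattice then 0 else
    .some (L.weierstrassP u) (L.derivWeierstrassP u / 2)
      (eisCurveOver_nonsingular (hL.derivWeierstrassP_sq h))

lemma point_of_mem {u : ℂ} (hu : u ∈ L.lattice) : hL.point u = 0 := by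
  simp [point, hu]

lemma point_of_notMem {u : ℂ} (hu : u ∉ L.lattice) : hL.point u =
    .some (L.weierstrassP u) (L.derivWeierstrassP u / 2)
      (eisCurveOver_nonsingular (hL.derivWeierstrassP_sq hu)) := by
  simp [point, hu]

lemma point_eq_zero_iff {u : ℂ} : hL.point u = 0 ↔ u ∈ L.lattice := by
  by_cases hu : u ∈ L.lattice
  · simp [hL.point_of_mem hu, hu]
  · simp [hL.point_of_notMem hu, hu]

lemma point_add_of_mem {u l : ℂ} (hl : l ∈ L.lattice) : hL.point (u + l) = hL.point u := by
  by_cases hu : u ∈ L.lattice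
  · rw [hL.point_of_mem hu, hL.point_of_mem (add_mem hu hl)]
  · have h : u + l ∉ L.lattice := fun h => hu (by simpa using sub_mem h hl)
    rw [hL.point_of_notMem hu, hL.point_of_notMem h]
    simp [L.weierstrassP_add_coe u ⟨l, hl⟩, L.derivWeierstrassP_add_coe u ⟨l, hl⟩]

lemma point_neg (u : ℂ) : hL.point (-u) = - hL.point u := by
  by_cases hu : u ∈ L.lattice
  · rw [hL.point_of_mem hu, hL.point_of_mem (neg_mem hu), neg_zero]
  · have h : -u ∉ L.lattice := by simpa using hu
    rw [hL.point_of_notMem hu, hL.point_of_notMem h, WeierstrassCurve.Affine.Point.neg_some]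
    simp [WeierstrassCurve.Affine.negY, eisCurve, neg_div]

lemma weierstrassP_add {u v : ℂ} (hu : u ∉ L.lattice) (hv : v ∉ L.lattice)
    (huv : u + v ∉ L.lattice) (hx : L.weierstrassP u ≠ L.weierstrassP v) :
    L.weierstrassP (u + v) = ((L.derivWeierstrassP u - L.derivWeierstrassP v) / 2 /
      (L.weierstrassP u - L.weierstrassP v)) ^ 2 - L.weierstrassP u - L.weierstrassP v := by
  have := hL.addition_aux huv hu (by simpa using hv)
  rw [add_sub_cancel_left] at this
  have hx' := sub_ne_zero.mpr hx
  field_simp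
  linear_combination -4 * this

lemma derivWeierstrassP_add {u v : ℂ} (hu : u ∉ L.lattice) (hv : v ∉ L.lattice)
    (huv : u + v ∉ L.lattice) (hx : L.weierstrassP u ≠ L.weierstrassP v) :
    L.derivWeierstrassP (u + v) = - 2 * ((L.derivWeierstrassP u - L.derivWeierstrassP v) / 2 /
      (L.weierstrassP u - L.weierstrassP v)) * (L.weierstrassP (u + v) - L.weierstrassP u)
        - L.derivWeierstrassP u := by
  have hx' := sub_ne_zero.mpr hx
  have d1 := hasDerivAt_weierstrassP hu
  have d2 := hL.hasDerivAt_derivWeierstrassP hu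
  have d3 := (hasDerivAt_weierstrassP huv).comp u ((hasDerivAt_id u).add_const v)
  have d4 := ((((d2.sub_const (L.derivWeierstrassP v)).div_const 2).div
    (d1.sub_const (L.weierstrassP v)) hx').pow 2).sub d1 |>.sub_const (L.weierstrassP v)
  have hev : (L.weierstrassP ∘ fun z => id z + v) =ᶠ[𝓝 u] fun u =>
      ((L.derivWeierstrassP u - L.derivWeierstrassP v) / 2 /
      (L.weierstrassP u - L.weierstrassP v)) ^ 2 - L.weierstrassP u - L.weierstrassP v := by
    filter_upwards [eventually_notMem_lattice_nhds hu,
      ((continuous_id.add continuous_const).tendsto' u (u + v) rfl).eventually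
        (eventually_notMem_lattice_nhds huv), d1.continuousAt.eventually_ne hx] with z h1 h2 h3
    exact hL.weierstrassP_add h1 hv h2 h3
  have key := d3.unique (d4.congr_of_eventuallyEq hev)
  simp only [mul_one] at key
  rw [key, hL.weierstrassP_add hu hv huv hx]
  have q1 := hL.derivWeierstrassP_sq hu
  have q2 := hL.derivWeierstrassP_sq hv
  simp only [Nat.cast_ofNat, Nat.add_one_sub_one, pow_one, Pi.div_apply]
  field_simp
  generalize L.derivWeierstrassP u = w at *
  generalize L.derivWeierstrassP v = w' at *
  generalize L.weierstrassP u = x at *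
  generalize L.weierstrassP v = x' at *
  linear_combination (w' - w) * (q1 - q2)

lemma point_add_of_ne {u v : ℂ} (hu : u ∉ L.lattice) (hv : v ∉ L.lattice)
    (huv : u + v ∉ L.lattice) (hx : L.weierstrassP u ≠ L.weierstrassP v) :
    hL.point (u + v) = hL.point u + hL.point v := by
  rw [hL.point_of_notMem hu, hL.point_of_notMem hv, hL.point_of_notMem huv,
    WeierstrassCurve.Affine.Point.add_some (fun h => hx h.1)]
  have e1 := hL.weierstrassP_add hu hv huv hx
  have e2 := hL.derivWeierstrassP_add hu hv huv hx
  have s : (eisCurveOver ℂ).slope (L.weierstrassP u) (L.weierstrassP v)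
      (L.derivWeierstrassP u / 2) (L.derivWeierstrassP v / 2) =
      (L.derivWeierstrassP u - L.derivWeierstrassP v) / 2 /
        (L.weierstrassP u - L.weierstrassP v) := by
    rw [WeierstrassCurve.Affine.slope_of_X_ne hx]; ring
  have a1 : L.weierstrassP (u + v) = (eisCurveOver ℂ).addX (L.weierstrassP u) (L.weierstrassP v)
      ((eisCurveOver ℂ).slope (L.weierstrassP u) (L.weierstrassP v)
      (L.derivWeierstrassP u / 2) (L.derivWeierstrassP v / 2)) := by
    rw [s, e1]
    simp [WeierstrassCurve.Affine.addX, eisCurve]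
  rw [WeierstrassCurve.Affine.Point.some.injEq]
  refine ⟨a1, ?_⟩
  rw [WeierstrassCurve.Affine.addY, WeierstrassCurve.Affine.negAddY, ← a1, s, e2]
  simp [WeierstrassCurve.Affine.negY, eisCurve]
  ring

lemma eventually_point_add (u : ℂ) :
    ∀ᶠ w in 𝓝[≠] 0, hL.point (u + w) = hL.point u + hL.point w := by
  by_cases hu : u ∈ L.lattice
  · filter_upwards with w
    rw [add_comm, hL.point_add_of_mem hu, hL.point_of_mem hu, zero_add]
  · filter_upwards [L.eventually_notMem_lattice 0, L.eventually_weierstrassP_ne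
      (f := fun _ => L.weierstrassP u) continuousAt_const, nhdsWithin_le_nhds
      ((Continuous.tendsto' (f := fun w : ℂ => u + w) (by fun_prop) 0 u (by simp)).eventually
      (eventually_notMem_lattice_nhds hu))] with w h1 h2 h3
    exact hL.point_add_of_ne hu h1 h3 h2.symm

theorem point_add (u v : ℂ) : hL.point (u + v) = hL.point u + hL.point v := by
  by_cases hu : u ∈ L.lattice
  · rw [add_comm, hL.point_add_of_mem hu, hL.point_of_mem hu, zero_add]
  by_cases hv : v ∈ L.lattice
  · rw [hL.point_add_of_mem hv, hL.point_of_mem hv, add_zero]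
  by_cases huv : u + v ∈ L.lattice
  · have : v = -u + (u + v) := by ring
    rw [hL.point_of_mem huv, this, hL.point_add_of_mem huv, hL.point_neg, add_neg_cancel]
  have tu : Tendsto (fun w : ℂ => u + w) (𝓝[≠] 0) (𝓝[≠] u) := by
    refine tendsto_nhdsWithin_iff.mpr ⟨((continuous_const.add continuous_id).tendsto' (0 : ℂ) u
      (by simp)).mono_left nhdsWithin_le_nhds, ?_⟩
    filter_upwards [self_mem_nhdsWithin] with w hw
    simpa using hw
  have tn : Tendsto (fun w : ℂ => -w) (𝓝[≠] 0) (𝓝[≠] 0) := by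
    refine tendsto_nhdsWithin_iff.mpr ⟨(continuous_neg.tendsto' (0 : ℂ) 0
      (by simp)).mono_left nhdsWithin_le_nhds, ?_⟩
    filter_upwards [self_mem_nhdsWithin] with w hw
    simpa using hw
  have tv : Tendsto (fun w : ℂ => v + -w) (𝓝[≠] 0) (𝓝 v) :=
    ((continuous_const.add continuous_neg).tendsto' (0 : ℂ) v (by simp)).mono_left
      nhdsWithin_le_nhds
  set S : Set ℂ := (L.lattice : Set ℂ) ∪ (fun z => (u + v) - z) '' (L.lattice : Set ℂ) with hS
  have memS {z : ℂ} : z ∉ S ↔ z ∉ L.lattice ∧ u + v - z ∉ L.lattice := by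
    simp only [hS, Set.mem_union, not_or, Set.mem_image, SetLike.mem_coe, not_exists, not_and]
    refine and_congr_right fun _ => ⟨fun h h' => h _ h' (by ring), fun h y hy e => h ?_⟩
    rw [← e]; simpa using hy
  have hne : ∀ᶠ z in 𝓝[≠] u, L.weierstrassP z ≠ L.weierstrassP (u + v - z) := by
    have han : AnalyticOnNhd ℂ (fun z => L.weierstrassP z - L.weierstrassP (u + v - z)) Sᶜ := by
      intro z hz
      obtain ⟨h1, h2⟩ := memS.mp hz
      have := analyticAt_weierstrassP h1
      have := (analyticAt_weierstrassP h2).fun_comp (g := L.weierstrassP)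
        (f := fun z => u + v - z) (by fun_prop)
      fun_prop
    have huS : u ∉ S := memS.mpr ⟨hu, by simpa using hv⟩
    by_contra hcon
    rw [not_eventually] at hcon
    simp only [not_not] at hcon
    have h0 := han.eqOn_zero_of_preconnected_of_frequently_eq_zero
      (isPreconnected_compl_of_countable (L.countable_lattice.union (L.countable_lattice.image _)))
      huS (hcon.mono fun z hz => sub_eq_zero.mpr hz)
    have hc0 : u + v - 0 ∉ L.lattice := by simpa using huv
    have hcont : ContinuousAt (fun z => L.weierstrassP (u + v - z)) 0 :=
      ((analyticAt_weierstrassP hc0).fun_comp (g := L.weierstrassP)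
        (f := fun z => u + v - z) (by fun_prop)).continuousAt
    have hcz : ∀ᶠ z in 𝓝[≠] (0 : ℂ), u + v - z ∉ L.lattice :=
      nhdsWithin_le_nhds (((continuous_const.sub continuous_id).tendsto' (0 : ℂ) (u + v)
        (by simp)).eventually (eventually_notMem_lattice_nhds huv))
    obtain ⟨z, h1, h2, h3⟩ := (L.eventually_weierstrassP_ne hcont |>.and
      ((L.eventually_notMem_lattice 0).and hcz)).exists
    exact h1 (sub_eq_zero.mp (h0 (memS.mpr ⟨h2, h3⟩)))
  obtain ⟨w, h1, h2, h3, h4, h5⟩ := ((hL.eventually_point_add u).and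
    ((tn.eventually (hL.eventually_point_add v)).and
    ((tu.eventually hne).and ((tu.eventually (L.eventually_notMem_lattice u)).and
      (tv.eventually (eventually_notMem_lattice_nhds hv)))))).exists
  have e : u + v = (u + w) + (v + -w) := by ring
  have e' : u + v - (u + w) = v + -w := by ring
  rw [e'] at h3
  rw [e, hL.point_add_of_ne h4 h5 (by rwa [← e]) h3, h1, h2, hL.point_neg]
  abel

/-- The uniformization as a group homomorphism. -/
def pointHom : ℂ →+ (eisCurveOver ℂ).Point where
  toFun := hL.point
  map_zero' := hL.point_of_mem (zero_mem _)
  map_add' := hL.point_add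

lemma point_zsmul (n : ℤ) (u : ℂ) : hL.point (n * u) = n • hL.point u := by
  rw [← zsmul_eq_mul]; exact map_zsmul hL.pointHom n u

lemma point_sub (u v : ℂ) : hL.point (u - v) = hL.point u - hL.point v :=
  map_sub hL.pointHom u v

lemma point_eq_point_iff {u v : ℂ} : hL.point u = hL.point v ↔ u - v ∈ L.lattice := by
  rw [← hL.point_eq_zero_iff, hL.point_sub, sub_eq_zero]

lemma sub_mem_of_eq {u v : ℂ} (hu : u ∉ L.lattice) (hv : v ∉ L.lattice)
    (h1 : L.weierstrassP u = L.weierstrassP v)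
    (h2 : L.derivWeierstrassP u = L.derivWeierstrassP v) : u - v ∈ L.lattice := by
  rw [← hL.point_eq_point_iff, hL.point_of_notMem hu, hL.point_of_notMem hv]
  simp [h1, h2]

end IsEisenstein
end PeriodPair
end

noncomputable section
open Filter Topology

lemma ρ3_eq : ρ3 = ⟨-1 / 2, Real.sqrt 3 / 2⟩ := by
  have h : (2 * Real.pi * Complex.I / 3 : ℂ) = ((2 * Real.pi / 3 : ℝ) : ℂ) * Complex.I := by
    push_cast; ring
  have h2 : (2 * Real.pi / 3 : ℝ) = Real.pi - Real.pi / 3 := by ring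
  rw [ρ3, h, Complex.exp_mul_I, ← Complex.ofReal_cos, ← Complex.ofReal_sin, h2, Real.cos_pi_sub,
    Real.sin_pi_sub, Real.cos_pi_div_three, Real.sin_pi_div_three]
  apply Complex.ext <;> simp
  norm_num

lemma ρ3_re : ρ3.re = -1 / 2 := by rw [ρ3_eq]

lemma ρ3_im : ρ3.im = Real.sqrt 3 / 2 := by rw [ρ3_eq]

lemma ρ3_sq_add : ρ3 ^ 2 + ρ3 + 1 = 0 := by
  have h3 : Real.sqrt 3 * Real.sqrt 3 = 3 := Real.mul_self_sqrt (by norm_num)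
  rw [ρ3_eq, sq]
  apply Complex.ext
  · simp; linear_combination -h3 / 4
  · simp; ring

lemma ρ3_cube : ρ3 ^ 3 = 1 := by linear_combination (ρ3 - 1) * ρ3_sq_add

lemma ρ3_ne_zero : ρ3 ≠ 0 := fun h => by simpa [h] using ρ3_cube

lemma sqrtm3_eq : sqrtm3 = 1 + 2 * ρ3 := by
  rw [sqrtm3, ρ3_eq]
  apply Complex.ext
  · simp; norm_num
  · simp; ring

lemma sqrtm3_sq : sqrtm3 ^ 2 = -3 := by
  rw [sqrtm3_eq]; linear_combination 4 * ρ3_sq_add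

lemma sqrtm3_ne_zero : sqrtm3 ≠ 0 := fun h => by simpa [h] using sqrtm3_sq

lemma conj_ρ3 : (starRingEnd ℂ) ρ3 = -1 - ρ3 := by
  rw [ρ3_eq]
  apply Complex.ext
  · simp; norm_num
  · simp

lemma mem_O3 {z : ℂ} : z ∈ O3 ↔ ∃ a b : ℤ, z = a + b * ρ3 := by
  constructor
  · intro h
    induction h using Subring.closure_induction with
    | mem x hx => exact ⟨0, 1, by simpa using hx⟩
    | zero => exact ⟨0, 0, by simp⟩
    | one => exact ⟨1, 0, by simp⟩
    | add x y _ _ hx hy =>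
      obtain ⟨a, b, rfl⟩ := hx
      obtain ⟨c, d, rfl⟩ := hy
      exact ⟨a + c, b + d, by push_cast; ring⟩
    | neg x _ hx =>
      obtain ⟨a, b, rfl⟩ := hx
      exact ⟨-a, -b, by push_cast; ring⟩
    | mul x y _ _ hx hy =>
      obtain ⟨a, b, rfl⟩ := hx
      obtain ⟨c, d, rfl⟩ := hy
      refine ⟨a * c - b * d, a * d + b * c - b * d, ?_⟩
      push_cast
      linear_combination (b * d : ℂ) * ρ3_sq_add
  · rintro ⟨a, b, rfl⟩
    have : ρ3 ∈ O3 := Subring.subset_closure rfl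
    exact add_mem (intCast_mem _ _) (mul_mem (intCast_mem _ _) this)

lemma ρ3_mem : ρ3 ∈ O3 := Subring.subset_closure rfl

lemma sqrtm3_mem : sqrtm3 ∈ O3 := by
  rw [sqrtm3_eq]
  exact add_mem (one_mem _) (mul_mem (ofNat_mem _ 2) ρ3_mem)

lemma add_mul_ρ3_eq_zero {a b : ℝ} (h : (a : ℂ) + b * ρ3 = 0) : a = 0 ∧ b = 0 := by
  have h2 := congrArg Complex.im h
  have h1 := congrArg Complex.re h
  simp [ρ3_re, ρ3_im] at h1 h2
  subst h2
  simpa using h1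

lemma normSq_add_mul_ρ3 (a b : ℝ) :
    Complex.normSq ((a : ℂ) + b * ρ3) = a ^ 2 - a * b + b ^ 2 := by
  have h3 : Real.sqrt 3 * Real.sqrt 3 = 3 := Real.mul_self_sqrt (by norm_num)
  rw [Complex.normSq_apply]
  simp [ρ3_re, ρ3_im]
  linear_combination b ^ 2 / 4 * h3

/-- The period pair `(c, cρ)`. -/
def hexPair (c : ℝ) (hc : 0 < c) : PeriodPair where
  ω₁ := c
  ω₂ := c * ρ3
  indep := by
    rw [LinearIndependent.pair_iff]
    intro s t h
    have hc' : (c : ℂ) ≠ 0 := by exact_mod_cast hc.ne'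
    have : (s : ℂ) + t * ρ3 = 0 := by
      apply mul_left_cancel₀ hc'
      simp only [Complex.real_smul] at h
      linear_combination h
    exact add_mul_ρ3_eq_zero this

section
variable {c : ℝ} {hc : 0 < c}

lemma mem_hexPair {z : ℂ} : z ∈ (hexPair c hc).lattice ↔ ∃ a ∈ O3, z = c * a := by
  rw [PeriodPair.mem_lattice]
  constructor
  · rintro ⟨m, n, rfl⟩
    exact ⟨m + n * ρ3, mem_O3.mpr ⟨m, n, rfl⟩, by simp [hexPair]; ring⟩
  · rintro ⟨a, ha, rfl⟩
    obtain ⟨m, n, rfl⟩ := mem_O3.mp ha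
    exact ⟨m, n, by simp [hexPair]; ring⟩

lemma mul_mem_hexPair {a z : ℂ} (ha : a ∈ O3) (hz : z ∈ (hexPair c hc).lattice) :
    a * z ∈ (hexPair c hc).lattice := by
  obtain ⟨b, hb, rfl⟩ := mem_hexPair.mp hz
  exact mem_hexPair.mpr ⟨a * b, mul_mem ha hb, by ring⟩

/-- Multiplication by `ρ` on the hexagonal lattice. -/
def hexRot (c : ℝ) (hc : 0 < c) : (hexPair c hc).lattice ≃ (hexPair c hc).lattice where
  toFun l := ⟨ρ3 * l, mul_mem_hexPair ρ3_mem l.2⟩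
  invFun l := ⟨ρ3 ^ 2 * l, mul_mem_hexPair (pow_mem ρ3_mem 2) l.2⟩
  left_inv l := by ext; simp; linear_combination (l : ℂ) * ρ3_cube
  right_inv l := by ext; simp; linear_combination (l : ℂ) * ρ3_cube

lemma weierstrassP_ρ3_mul (z : ℂ) :
    (hexPair c hc).weierstrassP (ρ3 * z) = ρ3 * (hexPair c hc).weierstrassP z := by
  simp only [PeriodPair.weierstrassP]
  rw [← (hexRot c hc).tsum_eq, ← tsum_mul_left]
  congr 1 with l
  have h1 : (ρ3 ^ 2)⁻¹ = ρ3 := by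
    rw [inv_eq_iff_eq_inv, eq_comm, inv_eq_iff_eq_inv]
    exact (eq_inv_of_mul_eq_one_left (by linear_combination ρ3_cube))
  simp only [hexRot, Equiv.coe_fn_mk, ← mul_sub, mul_pow, one_div, mul_inv, h1]

lemma derivWeierstrassP_ρ3_mul (z : ℂ) :
    (hexPair c hc).derivWeierstrassP (ρ3 * z) = (hexPair c hc).derivWeierstrassP z := by
  simp only [PeriodPair.derivWeierstrassP]
  rw [← (hexRot c hc).tsum_eq]
  congr 2 with l
  simp only [hexRot, Equiv.coe_fn_mk, ← mul_sub, mul_pow, ρ3_cube, one_mul]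

lemma hexPair_g₂ : (hexPair c hc).g₂ = 0 := by
  have : (hexPair c hc).G 4 = ρ3 ^ 2 * (hexPair c hc).G 4 := by
    conv_lhs => rw [PeriodPair.G, ← (hexRot c hc).tsum_eq]
    rw [PeriodPair.G, ← tsum_mul_left]
    congr 1 with l
    have : (ρ3 ^ 4)⁻¹ = ρ3 ^ 2 := by
      rw [inv_eq_iff_eq_inv, eq_comm, inv_eq_iff_eq_inv]
      exact (eq_inv_of_mul_eq_one_left (by linear_combination (ρ3 ^ 3 + 1) * ρ3_cube))
    simp only [hexRot, Equiv.coe_fn_mk, mul_pow, mul_inv, this]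
  have h : (hexPair c hc).G 4 = 0 := by
    have h1 : (1 - ρ3 ^ 2) * (hexPair c hc).G 4 = 0 := by linear_combination this
    rcases mul_eq_zero.mp h1 with h2 | h2
    · have h3 : ρ3 + 2 = 0 := by linear_combination h2 + ρ3_sq_add
      have := congrArg Complex.re h3
      rw [Complex.add_re, ρ3_re] at this
      norm_num at this
    · exact h2
  simp [PeriodPair.g₂, h]

end

/-- The Eisenstein series of weight six of the lattice `ℤ[ρ]`. -/
def hexG6 : ℂ := ∑' m : ℤ × ℤ, (((m.1 : ℂ) + m.2 * ρ3) ^ 6)⁻¹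

lemma hexPair_hasSum_G6 (c : ℝ) (hc : 0 < c) :
    HasSum (fun m : ℤ × ℤ => (((c : ℂ) ^ 6))⁻¹ * (((m.1 : ℂ) + m.2 * ρ3) ^ 6)⁻¹)
      ((hexPair c hc).G 6) := by
  have h := (hexPair c hc).hasSum_sumInvPow 0 (r := 6) (by norm_num)
  rw [PeriodPair.sumInvPow_zero, ← (hexPair c hc).latticeEquivProd.symm.toEquiv.hasSum_iff] at h
  convert! h using 2 with m
  simp only [sub_zero, Function.comp]
  have := (hexPair c hc).latticeEquiv_symm_apply m
  rw [show ((hexPair c hc).latticeEquivProd.symm.toEquiv m : ℂ) = _ from this]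
  simp only [hexPair]
  rw [← mul_inv, ← mul_pow]
  ring

lemma hexPair_G6 (c : ℝ) (hc : 0 < c) : (hexPair c hc).G 6 = ((c : ℂ) ^ 6)⁻¹ * hexG6 := by
  rw [hexG6, ← tsum_mul_left]
  exact (hexPair_hasSum_G6 c hc).tsum_eq.symm

lemma hasSum_hexG6 :
    HasSum (fun m : ℤ × ℤ => (((m.1 : ℂ) + m.2 * ρ3) ^ 6)⁻¹) hexG6 := by
  have h := hexPair_hasSum_G6 1 one_pos
  simp only [ofReal_one, one_pow, inv_one, one_mul] at h
  exact h.summable.hasSum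

lemma hexG6_im : hexG6.im = 0 := by
  rw [← Complex.conj_eq_iff_im, hexG6, Complex.conj_tsum]
  let e : ℤ × ℤ ≃ ℤ × ℤ :=
    { toFun := fun m => (m.1 - m.2, -m.2)
      invFun := fun m => (m.1 - m.2, -m.2)
      left_inv := fun m => by ext <;> simp
      right_inv := fun m => by ext <;> simp }
  rw [← e.tsum_eq]
  congr 1 with m
  simp only [e, Equiv.coe_fn_mk, map_inv₀, map_pow, map_add, map_mul, conj_ρ3, map_intCast]
  congr 2
  push_cast
  ring

end

noncomputable section

lemma sum_range_inv_cube_le (n : ℕ) :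
    ∑ i ∈ Finset.range (n + 2), ((i : ℝ) ^ 3)⁻¹ ≤ 5 / 4 - 1 / (2 * (n + 1) * (n + 2)) := by
  induction n with
  | zero => norm_num [Finset.sum_range_succ]
  | succ n ih =>
    rw [Finset.sum_range_succ]
    have h : (((n + 2 : ℕ) : ℝ) ^ 3)⁻¹ ≤
        1 / (2 * ((n : ℝ) + 1) * (n + 2)) - 1 / (2 * ((n + 1 : ℕ) + 1) * ((n + 1 : ℕ) + 2)) := by
      push_cast
      have hn : (0 : ℝ) ≤ n := n.cast_nonneg
      rw [inv_eq_one_div, div_sub_div _ _ (by positivity) (by positivity),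
        div_le_div_iff₀ (by positivity) (by positivity)]
      have : 0 ≤ (n : ℝ) + 2 := by positivity
      nlinarith [mul_nonneg this (mul_nonneg this this), mul_nonneg this this]
    linarith

lemma exists_hasSum_nat_inv_cube :
    ∃ S ≤ (5 / 4 : ℝ), HasSum (fun n : ℕ => ((n : ℝ) ^ 3)⁻¹) S := by
  have hb : ∀ n, ∑ i ∈ Finset.range n, ((i : ℝ) ^ 3)⁻¹ ≤ 5 / 4 := by
    intro n
    have h1 : ∑ i ∈ Finset.range n, ((i : ℝ) ^ 3)⁻¹ ≤
        ∑ i ∈ Finset.range (n + 2), ((i : ℝ) ^ 3)⁻¹ :=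
      Finset.sum_le_sum_of_subset_of_nonneg (Finset.range_mono (by omega))
        fun i _ _ => by positivity
    have h2 := sum_range_inv_cube_le n
    have h3 : (0 : ℝ) ≤ 1 / (2 * (n + 1) * (n + 2)) := by positivity
    linarith
  exact ⟨_, Real.tsum_le_of_sum_range_le (fun n => by positivity) hb,
    (summable_of_sum_range_le (fun n => by positivity) hb).hasSum⟩

lemma exists_hasSum_int_inv_cube :
    ∃ S, 0 ≤ S ∧ S ≤ (5 / 2 : ℝ) ∧ HasSum (fun n : ℤ => (|(n : ℝ)| ^ 3)⁻¹) S := by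
  obtain ⟨S, hS, h⟩ := exists_hasSum_nat_inv_cube
  refine ⟨S + S, ?_, by linarith, ?_⟩
  · have := h.nonneg fun n => by positivity
    linarith
  · have := HasSum.of_nat_of_neg (f := fun n : ℤ => (|(n : ℝ)| ^ 3)⁻¹) (g := S) (g' := S)
      (by simpa using h) (by simpa using h)
    simpa using this

lemma neg_inv_cube_le_re (a b : ℤ) :
    -(|(a : ℝ)| ^ 3)⁻¹ * (|(b : ℝ)| ^ 3)⁻¹ ≤ ((((a : ℂ) + b * ρ3) ^ 6)⁻¹).re := by
  rcases eq_or_ne a 0 with rfl | ha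
  · have : (((0 : ℤ) : ℂ) + b * ρ3) ^ 6 = (((b : ℝ) ^ 6 : ℝ) : ℂ) := by
      push_cast
      linear_combination (b : ℂ) ^ 6 * (ρ3 ^ 3 + 1) * ρ3_cube
    rw [this, ← ofReal_inv, ofReal_re]
    simp only [Int.cast_zero, abs_zero, ne_eq, OfNat.ofNat_ne_zero, not_false_eq_true,
      zero_pow, inv_zero, neg_zero, zero_mul]
    positivity
  rcases eq_or_ne b 0 with rfl | hb
  · have : ((a : ℂ) + (0 : ℤ) * ρ3) ^ 6 = (((a : ℝ) ^ 6 : ℝ) : ℂ) := by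
      push_cast
      ring
    rw [this, ← ofReal_inv, ofReal_re]
    simp only [Int.cast_zero, abs_zero, ne_eq, OfNat.ofNat_ne_zero, not_false_eq_true,
      zero_pow, inv_zero, mul_zero]
    positivity
  · have h1 := (abs_le.mp (Complex.abs_re_le_norm ((((a : ℂ) + b * ρ3) ^ 6)⁻¹))).1
    refine le_trans ?_ h1
    rw [neg_mul, neg_le_neg_iff, ← mul_inv, norm_inv, norm_pow]
    have ha' : (a : ℝ) ≠ 0 := by exact_mod_cast ha
    have hb' : (b : ℝ) ≠ 0 := by exact_mod_cast hb
    apply inv_anti₀ (by positivity)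
    rw [show ‖(a : ℂ) + b * ρ3‖ ^ 6 = (‖(a : ℂ) + b * ρ3‖ ^ 2) ^ 3 by ring,
      Complex.sq_norm, ← mul_pow, ← abs_mul]
    have := normSq_add_mul_ρ3 a b
    push_cast at this
    rw [this]
    refine pow_le_pow_left₀ (abs_nonneg _) ?_ 3
    rw [abs_le]
    constructor <;> nlinarith [sq_nonneg ((a : ℝ) - b), sq_nonneg ((a : ℝ) + b)]

/-- A finitely supported function whose values dominate the correction terms in the lower bound
for the Eisenstein series of weight six. -/
def hexMain (m : ℤ × ℤ) : ℝ :=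
  if m = (1, 0) ∨ m = (-1, 0) ∨ m = (0, 1) ∨ m = (0, -1) then 1
  else if m = (1, 1) ∨ m = (-1, -1) then 2 else 0

lemma hasSum_hexMain : HasSum hexMain 8 := by
  have h1 : ∀ m ∉ ({(1, 0), (-1, 0), (0, 1), (0, -1), (1, 1), (-1, -1)} : Finset (ℤ × ℤ)),
      hexMain m = 0 := by
    intro m hm
    simp only [Finset.mem_insert, Finset.mem_singleton, not_or] at hm
    simp [hexMain, hm]
  have h2 := hasSum_sum_of_ne_finset_zero (L := SummationFilter.unconditional _) h1
  convert h2 using 1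
  simp [hexMain]
  norm_num

lemma hexMain_sub_le_re (a b : ℤ) :
    hexMain (a, b) - (|(a : ℝ)| ^ 3)⁻¹ * (|(b : ℝ)| ^ 3)⁻¹ ≤ ((((a : ℂ) + b * ρ3) ^ 6)⁻¹).re := by
  have hn := neg_inv_cube_le_re a b
  have h11 : (1 + ρ3) ^ 6 = 1 := by
    linear_combination (ρ3 ^ 4 + 5 * ρ3 ^ 3 + 9 * ρ3 ^ 2 + 6 * ρ3) * ρ3_sq_add
  by_cases h1 : (a, b) = (1, 0) ∨ (a, b) = (-1, 0) ∨ (a, b) = (0, 1) ∨ (a, b) = (0, -1)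
  · simp only [hexMain, if_pos h1]
    have h6 : ρ3 ^ 6 = 1 := by linear_combination (ρ3 ^ 3 + 1) * ρ3_cube
    simp only [Prod.mk.injEq] at h1
    rcases h1 with ⟨rfl, rfl⟩ | ⟨rfl, rfl⟩ | ⟨rfl, rfl⟩ | ⟨rfl, rfl⟩ <;>
      simp [h6, show (-ρ3) ^ 6 = ρ3 ^ 6 by ring]
    rw [Even.neg_one_pow (by decide), one_re]
  · by_cases h2 : (a, b) = (1, 1) ∨ (a, b) = (-1, -1)
    · simp only [hexMain, if_neg h1, if_pos h2]
      simp only [Prod.mk.injEq] at h2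
      rcases h2 with ⟨rfl, rfl⟩ | ⟨rfl, rfl⟩
      · simp [h11]; norm_num
      · have : (-1 + -ρ3) ^ 6 = 1 := by linear_combination h11
        simp [this]; norm_num
    · simp only [hexMain, if_neg h1, if_neg h2]
      linarith

lemma hexG6_re_pos : 0 < hexG6.re := by
  obtain ⟨S, hS0, hS, h⟩ := exists_hasSum_int_inv_cube
  have hs := summable_mul_of_summable_norm h.summable.norm h.summable.norm
  have hprod := h.mul h hs
  have hre := Complex.hasSum_re hasSum_hexG6
  have hle : 8 - S * S ≤ hexG6.re := by
    refine hasSum_le ?_ (hasSum_hexMain.sub hprod) hre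
    rintro ⟨a, b⟩
    exact hexMain_sub_le_re a b
  have : S * S ≤ 5 / 2 * (5 / 2) := mul_le_mul hS hS hS0 (by norm_num)
  linarith

lemma exists_isEisenstein : ∃ (c : ℝ) (hc : 0 < c), (hexPair c hc).IsEisenstein := by
  have h := hexG6_re_pos
  have hpos : 0 < 140 * hexG6.re / 27 := by positivity
  refine ⟨(140 * hexG6.re / 27) ^ ((6 : ℕ) : ℝ)⁻¹, by positivity, hexPair_g₂, ?_⟩
  rw [PeriodPair.g₃, hexPair_G6, ← ofReal_pow, Real.rpow_inv_natCast_pow hpos.le (by norm_num)]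
  have h6 : hexG6 = ((hexG6.re : ℝ) : ℂ) := by
    apply Complex.ext <;> simp [hexG6_im]
  rw [h6]
  have : ((hexG6.re : ℝ) : ℂ) ≠ 0 := by exact_mod_cast h.ne'
  push_cast
  simp only [ofReal_re]
  field_simp
end

noncomputable section
open Filter Topology

section
variable {c : ℝ} {hc : 0 < c}

lemma ρ3_sub_sq : ρ3 - ρ3 ^ 2 = sqrtm3 := by
  rw [sqrtm3_eq]; linear_combination -ρ3_sq_add

lemma weierstrassP_ρ3_sq_mul (z : ℂ) :
    (hexPair c hc).weierstrassP (ρ3 ^ 2 * z) = ρ3 ^ 2 * (hexPair c hc).weierstrassP z := by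
  rw [sq, mul_assoc, weierstrassP_ρ3_mul, weierstrassP_ρ3_mul, mul_assoc]

lemma derivWeierstrassP_ρ3_sq_mul (z : ℂ) :
    (hexPair c hc).derivWeierstrassP (ρ3 ^ 2 * z) = (hexPair c hc).derivWeierstrassP z := by
  rw [sq, mul_assoc, derivWeierstrassP_ρ3_mul, derivWeierstrassP_ρ3_mul]

lemma mul_mem_hexPair_iff {a b z : ℂ} (ha : a ∈ O3) (hb : b ∈ O3) (hab : b * a = 1) :
    a * z ∈ (hexPair c hc).lattice ↔ z ∈ (hexPair c hc).lattice := by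
  refine ⟨fun h => ?_, mul_mem_hexPair ha⟩
  have := mul_mem_hexPair (hc := hc) hb h
  rwa [← mul_assoc, hab, one_mul] at this

lemma ρ3_mul_mem_iff {z : ℂ} :
    ρ3 * z ∈ (hexPair c hc).lattice ↔ z ∈ (hexPair c hc).lattice :=
  mul_mem_hexPair_iff ρ3_mem (pow_mem ρ3_mem 2) (by linear_combination ρ3_cube)

lemma ρ3_sq_mul_mem_iff {z : ℂ} :
    ρ3 ^ 2 * z ∈ (hexPair c hc).lattice ↔ z ∈ (hexPair c hc).lattice :=
  mul_mem_hexPair_iff (pow_mem ρ3_mem 2) ρ3_mem (by linear_combination ρ3_cube)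

/-- The zeros of `℘` are points of order `√-3`. -/
lemma sqrtm3_mul_mem_of_eq_zero (hL : (hexPair c hc).IsEisenstein) {z : ℂ}
    (hz : z ∉ (hexPair c hc).lattice) (h : (hexPair c hc).weierstrassP z = 0) :
    sqrtm3 * z ∈ (hexPair c hc).lattice := by
  rw [← ρ3_sub_sq, sub_mul]
  apply hL.sub_mem_of_eq (mt ρ3_mul_mem_iff.mp hz) (mt ρ3_sq_mul_mem_iff.mp hz)
  · rw [weierstrassP_ρ3_mul, weierstrassP_ρ3_sq_mul, h, mul_zero, mul_zero]
  · rw [derivWeierstrassP_ρ3_mul, derivWeierstrassP_ρ3_sq_mul]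

lemma eq_zero_of_sqrtm3_mul_mem {z : ℂ} (h : sqrtm3 * z ∈ (hexPair c hc).lattice) :
    (hexPair c hc).weierstrassP z = 0 := by
  have h1 := (hexPair c hc).weierstrassP_add_coe (ρ3 ^ 2 * z) ⟨_, h⟩
  simp only [← ρ3_sub_sq] at h1
  rw [show ρ3 ^ 2 * z + (ρ3 - ρ3 ^ 2) * z = ρ3 * z by ring, weierstrassP_ρ3_mul,
    weierstrassP_ρ3_sq_mul] at h1
  have h2 : sqrtm3 * (hexPair c hc).weierstrassP z = 0 := by
    rw [← ρ3_sub_sq]; linear_combination h1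
  exact (mul_eq_zero.mp h2).resolve_left sqrtm3_ne_zero

lemma weierstrassP_sqrtm3_mul (hL : (hexPair c hc).IsEisenstein) {z : ℂ}
    (hz : z ∉ (hexPair c hc).lattice) (h : (hexPair c hc).weierstrassP z ≠ 0) :
    (hexPair c hc).weierstrassP (sqrtm3 * z) =
        -((hexPair c hc).weierstrassP z ^ 3 - 27) / (3 * (hexPair c hc).weierstrassP z ^ 2) ∧
      (hexPair c hc).derivWeierstrassP (sqrtm3 * z) =
        -((hexPair c hc).derivWeierstrassP z * ((hexPair c hc).weierstrassP z ^ 3 + 54)) /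
          (3 * sqrtm3 * (hexPair c hc).weierstrassP z ^ 3) := by
  have hw := hL.derivWeierstrassP_sq hz
  have hv : -(ρ3 ^ 2 * z) ∉ (hexPair c hc).lattice := by
    rw [neg_mem_iff]; exact mt ρ3_sq_mul_mem_iff.mp hz
  have huv : ρ3 * z + -(ρ3 ^ 2 * z) = sqrtm3 * z := by rw [← ρ3_sub_sq]; ring
  have huv' : ρ3 * z + -(ρ3 ^ 2 * z) ∉ (hexPair c hc).lattice := by
    rw [huv]; exact fun h' => h (eq_zero_of_sqrtm3_mul_mem h')
  set x := (hexPair c hc).weierstrassP z with hx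
  set w := (hexPair c hc).derivWeierstrassP z with hw'
  have hx1 : (hexPair c hc).weierstrassP (ρ3 * z) = ρ3 * x := weierstrassP_ρ3_mul z
  have hx2 : (hexPair c hc).weierstrassP (-(ρ3 ^ 2 * z)) = ρ3 ^ 2 * x := by
    rw [PeriodPair.weierstrassP_neg, weierstrassP_ρ3_sq_mul]
  have hw1 : (hexPair c hc).derivWeierstrassP (ρ3 * z) = w := derivWeierstrassP_ρ3_mul z
  have hw2 : (hexPair c hc).derivWeierstrassP (-(ρ3 ^ 2 * z)) = -w := by
    rw [PeriodPair.derivWeierstrassP_neg, derivWeierstrassP_ρ3_sq_mul]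
  have hne : (hexPair c hc).weierstrassP (ρ3 * z) ≠
      (hexPair c hc).weierstrassP (-(ρ3 ^ 2 * z)) := by
    rw [hx1, hx2]
    intro h'
    have : sqrtm3 * x = 0 := by rw [← ρ3_sub_sq]; linear_combination h'
    exact (mul_ne_zero sqrtm3_ne_zero h) this
  have h1 := hL.weierstrassP_add (mt ρ3_mul_mem_iff.mp hz) hv huv' hne
  have h2 := hL.derivWeierstrassP_add (mt ρ3_mul_mem_iff.mp hz) hv huv' hne
  have hs : (w - -w) / 2 / (ρ3 * x - ρ3 ^ 2 * x) = -(w * sqrtm3) / (3 * x) := by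
    rw [← sub_mul, ρ3_sub_sq]
    have := sqrtm3_ne_zero
    field_simp
    linear_combination 2 * w * sqrtm3_sq
  rw [huv, hx1, hx2, hw1, hw2, hs] at h1
  rw [huv, hx1, hx2, hw1, hw2, hs] at h2
  have h3 : (hexPair c hc).weierstrassP (sqrtm3 * z) = -(x ^ 3 - 27) / (3 * x ^ 2) := by
    rw [h1]
    field_simp
    linear_combination w ^ 2 * sqrtm3_sq - 3 * hw - 9 * x ^ 3 * ρ3_sq_add
  refine ⟨h3, ?_⟩
  rw [h2, h3]
  have := sqrtm3_ne_zero
  field_simp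
  linear_combination 2 * w * (-x ^ 3 + 27 - 3 * x ^ 3 * ρ3) * sqrtm3_sq -
    9 * w * x ^ 3 * sqrtm3_eq

lemma weierstrassP_sqrtm3_notMem (hL : (hexPair c hc).IsEisenstein) {z : ℂ}
    (hz : sqrtm3 * z ∉ (hexPair c hc).lattice) : (hexPair c hc).weierstrassP z ≠ 0 :=
  fun h => hz <| sqrtm3_mul_mem_of_eq_zero hL (fun h' => hz (mul_mem_hexPair sqrtm3_mem h')) h

/-! ### Real points -/

lemma ofReal_notMem_hexPair {t : ℝ} (h0 : 0 < t) (h1 : t < c) :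
    (t : ℂ) ∉ (hexPair c hc).lattice := by
  intro h
  obtain ⟨_, ha, h⟩ := mem_hexPair.mp h
  obtain ⟨a, b, rfl⟩ := mem_O3.mp ha
  have h2 : ((t - c * a : ℝ) : ℂ) + ((-(c * b) : ℝ) : ℂ) * ρ3 = 0 := by
    push_cast; linear_combination h
  obtain ⟨h3, -⟩ := add_mul_ρ3_eq_zero h2
  have ha0 : (0 : ℝ) < a := by by_contra! h'; nlinarith
  have ha1 : (a : ℝ) < 1 := by by_contra! h'; nlinarith
  norm_cast at ha0 ha1
  omega

/-- Complex conjugation on the hexagonal lattice. -/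
def hexConj (c : ℝ) (hc : 0 < c) : (hexPair c hc).lattice ≃ (hexPair c hc).lattice :=
  have key : ∀ l : (hexPair c hc).lattice,
      (starRingEnd ℂ) (l : ℂ) ∈ (hexPair c hc).lattice := fun l => by
    obtain ⟨_, ha, h⟩ := mem_hexPair.mp l.2
    obtain ⟨a, b, rfl⟩ := mem_O3.mp ha
    rw [h]
    refine mem_hexPair.mpr ⟨((a - b : ℤ) : ℂ) + ((-b : ℤ) : ℂ) * ρ3, mem_O3.mpr ⟨_, _, rfl⟩, ?_⟩
    simp only [map_mul, map_add, conj_ofReal, map_intCast, conj_ρ3]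
    push_cast
    ring
  { toFun := fun l => ⟨_, key l⟩
    invFun := fun l => ⟨_, key l⟩
    left_inv := fun l => by ext; simp
    right_inv := fun l => by ext; simp }

lemma coe_hexConj (l : (hexPair c hc).lattice) :
    (hexConj c hc l : ℂ) = (starRingEnd ℂ) (l : ℂ) := rfl

lemma conj_weierstrassP (z : ℂ) : (starRingEnd ℂ) ((hexPair c hc).weierstrassP z) =
    (hexPair c hc).weierstrassP ((starRingEnd ℂ) z) := by
  simp only [PeriodPair.weierstrassP]
  rw [← (hexConj c hc).tsum_eq, Complex.conj_tsum]
  congr 1 with l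
  simp [coe_hexConj]

lemma conj_derivWeierstrassP (z : ℂ) : (starRingEnd ℂ) ((hexPair c hc).derivWeierstrassP z) =
    (hexPair c hc).derivWeierstrassP ((starRingEnd ℂ) z) := by
  simp only [PeriodPair.derivWeierstrassP]
  rw [← (hexConj c hc).tsum_eq, map_neg, Complex.conj_tsum]
  congr 2 with l
  simp [coe_hexConj, map_ofNat]

variable (c hc) in
/-- The Weierstrass function of the hexagonal lattice on the real axis. -/
def realP (t : ℝ) : ℝ := ((hexPair c hc).weierstrassP t).re

variable (c hc) in
/-- The derivative of the Weierstrass function of the hexagonal lattice on the real axis. -/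
def realP' (t : ℝ) : ℝ := ((hexPair c hc).derivWeierstrassP t).re

lemma ofReal_realP (t : ℝ) : (realP c hc t : ℂ) = (hexPair c hc).weierstrassP t := by
  rw [realP]
  apply conj_eq_iff_re.mp
  rw [conj_weierstrassP, conj_ofReal]

lemma ofReal_realP' (t : ℝ) : (realP' c hc t : ℂ) = (hexPair c hc).derivWeierstrassP t := by
  rw [realP']
  apply conj_eq_iff_re.mp
  rw [conj_derivWeierstrassP, conj_ofReal]

lemma hasDerivAt_realP {t : ℝ} (h0 : 0 < t) (h1 : t < c) :
    HasDerivAt (realP c hc) (realP' c hc t) t :=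
  ((hexPair c hc).hasDerivAt_weierstrassP (ofReal_notMem_hexPair h0 h1)).real_of_complex

lemma hasDerivAt_realP' (hL : (hexPair c hc).IsEisenstein) {t : ℝ} (h0 : 0 < t) (h1 : t < c) :
    HasDerivAt (realP' c hc) (6 * realP c hc t ^ 2) t := by
  have := (hL.hasDerivAt_derivWeierstrassP (ofReal_notMem_hexPair h0 h1)).real_of_complex
  rw [← ofReal_realP] at this
  convert! this using 1
  norm_cast

lemma realP'_sq (hL : (hexPair c hc).IsEisenstein) {t : ℝ} (h0 : 0 < t) (h1 : t < c) :
    realP' c hc t ^ 2 = 4 * realP c hc t ^ 3 - 27 := by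
  have := hL.derivWeierstrassP_sq (ofReal_notMem_hexPair (hc := hc) h0 h1)
  rw [← ofReal_realP, ← ofReal_realP'] at this
  exact_mod_cast this

lemma realP'_ne_zero (hL : (hexPair c hc).IsEisenstein) {t : ℝ} (h0 : 0 < t) (h1 : t < c / 2) :
    realP' c hc t ≠ 0 := by
  intro h
  have h' : (hexPair c hc).derivWeierstrassP t = 0 := by rw [← ofReal_realP', h, ofReal_zero]
  have hm := ofReal_notMem_hexPair (hc := hc) h0 (by linarith)
  have := hL.sub_mem_of_eq hm (v := -t) (by rwa [neg_mem_iff])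
    (by rw [PeriodPair.weierstrassP_neg])
    (by rw [PeriodPair.derivWeierstrassP_neg, h', neg_zero])
  rw [sub_neg_eq_add] at this
  refine ofReal_notMem_hexPair (c := c) (hc := hc) (t := t + t) (by linarith) (by linarith) ?_
  exact_mod_cast this

lemma tendsto_ofReal_nhdsGT_zero :
    Tendsto (fun t : ℝ => (t : ℂ)) (𝓝[>] 0) (𝓝[≠] 0) := by
  apply tendsto_nhdsWithin_of_tendsto_nhds_of_eventually_within
  · have := Complex.continuous_ofReal.tendsto (0 : ℝ)
    rw [ofReal_zero] at this
    exact this.mono_left nhdsWithin_le_nhds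
  · filter_upwards [self_mem_nhdsWithin] with t ht
    simpa using (ne_of_gt ht)

lemma tendsto_cube_mul_realP' :
    Tendsto (fun t : ℝ => t ^ 3 * realP' c hc t) (𝓝[>] 0) (𝓝 (-2)) := by
  have h := (Complex.continuous_re.tendsto _).comp
    ((hexPair c hc).tendsto_cube_mul_derivWeierstrassP.comp tendsto_ofReal_nhdsGT_zero)
  simp only [Function.comp_def, neg_re, re_ofNat, ← ofReal_realP'] at h
  convert! h using 2 with t
  norm_cast

lemma tendsto_sq_mul_realP :
    Tendsto (fun t : ℝ => t ^ 2 * realP c hc t) (𝓝[>] 0) (𝓝 1) := by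
  have h := (Complex.continuous_re.tendsto _).comp
    ((hexPair c hc).tendsto_sq_mul_weierstrassP.comp tendsto_ofReal_nhdsGT_zero)
  simp only [Function.comp_def, one_re, ← ofReal_realP] at h
  convert! h using 2 with t
  norm_cast

lemma realP'_neg (hL : (hexPair c hc).IsEisenstein) {t : ℝ} (h0 : 0 < t) (h1 : t < c / 2) :
    realP' c hc t < 0 := by
  have hcont : ContinuousOn (realP' c hc) (Set.Ioo 0 (c / 2)) := fun s hs =>
    (hasDerivAt_realP' hL hs.1 (by linarith [hs.2])).continuousAt.continuousWithinAt
  by_contra! h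
  have h2 : ∀ᶠ s : ℝ in 𝓝[>] 0, s ^ 3 * realP' c hc s < 0 :=
    tendsto_cube_mul_realP'.eventually_lt_const (by norm_num)
  have h3 : ∀ᶠ s : ℝ in 𝓝[>] 0, s < c / 2 :=
    (eventually_lt_nhds (by positivity)).filter_mono nhdsWithin_le_nhds
  obtain ⟨s, hs1, hs2, hs3⟩ := (h2.and (h3.and self_mem_nhdsWithin)).exists
  have hs : realP' c hc s < 0 := by
    have : 0 < s ^ 3 := pow_pos hs3 3
    by_contra! h'
    nlinarith [mul_nonneg this.le h']
  obtain ⟨r, hr, hr0⟩ := isPreconnected_Ioo.intermediate_value (a := s) (b := t) ⟨hs3, hs2⟩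
    ⟨h0, h1⟩ hcont ⟨hs.le, h⟩
  exact realP'_ne_zero hL hr.1 hr.2 hr0

lemma realP_third (hL : (hexPair c hc).IsEisenstein) : realP c hc (c / 3) = 3 := by
  have hm := ofReal_notMem_hexPair (c := c) (hc := hc) (t := c / 3) (by linarith) (by linarith)
  have h3 : ((c : ℝ) : ℂ) ∈ (hexPair c hc).lattice :=
    mem_hexPair.mpr ⟨1, one_mem _, by simp⟩
  have hx0 : realP c hc (c / 3) ≠ 0 := by
    intro h
    have := realP'_sq hL (t := c / 3) (by linarith) (by linarith)
    rw [h] at this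
    nlinarith [sq_nonneg (realP' c hc (c / 3))]
  have hx0' : (hexPair c hc).weierstrassP (c / 3 : ℝ) ≠ 0 := by
    rw [← ofReal_realP]; exact_mod_cast hx0
  have h1 : (hexPair c hc).weierstrassP (sqrtm3 * (c / 3 : ℝ)) = 0 := by
    apply eq_zero_of_sqrtm3_mul_mem
    have : sqrtm3 * (sqrtm3 * ((c / 3 : ℝ) : ℂ)) = -((c : ℝ) : ℂ) := by
      push_cast; linear_combination (c / 3 : ℂ) * sqrtm3_sq
    rw [this]
    exact neg_mem h3
  rw [(weierstrassP_sqrtm3_mul hL hm hx0').1, ← ofReal_realP] at h1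
  have hx0'' : (realP c hc (c / 3) : ℂ) ≠ 0 := by exact_mod_cast hx0
  rw [div_eq_zero_iff, neg_eq_zero, or_iff_left (by simpa using hx0)] at h1
  have h4 : realP c hc (c / 3) ^ 3 = 3 ^ 3 := by
    have : realP c hc (c / 3) ^ 3 - 27 = 0 := by exact_mod_cast h1
    linarith
  exact (Odd.strictMono_pow (by decide : Odd 3)).injective h4

end
end

noncomputable section
open Filter Topology

section
variable {c : ℝ} {hc : 0 < c}

lemma three_lt_realP (hL : (hexPair c hc).IsEisenstein) {t : ℝ} (h0 : 0 < t) (h1 : t < c / 3) :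
    3 < realP c hc t := by
  have hanti : StrictAntiOn (realP c hc) (Set.Icc t (c / 3)) := by
    apply strictAntiOn_of_deriv_neg (convex_Icc _ _)
    · intro s hs
      exact (hasDerivAt_realP (by linarith [hs.1])
        (by linarith [hs.2])).continuousAt.continuousWithinAt
    · intro s hs
      rw [interior_Icc] at hs
      rw [(hasDerivAt_realP (by linarith [hs.1]) (by linarith [hs.2])).deriv]
      exact realP'_neg hL (by linarith [hs.1]) (by linarith [hs.2])
  have := hanti ⟨le_rfl, h1.le⟩ ⟨h1.le, le_rfl⟩ h1
  rwa [realP_third hL] at this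

lemma realP'_lt_neg_nine (hL : (hexPair c hc).IsEisenstein) {t : ℝ} (h0 : 0 < t)
    (h1 : t < c / 3) : realP' c hc t < -9 := by
  have h2 := realP'_neg hL h0 (by linarith)
  have h3 := three_lt_realP hL h0 h1
  have h4 := realP'_sq hL h0 (by linarith)
  have h5 : (3 : ℝ) ^ 3 < realP c hc t ^ 3 := pow_lt_pow_left₀ h3 (by norm_num) (by norm_num)
  nlinarith

lemma realP'_third (hL : (hexPair c hc).IsEisenstein) : realP' c hc (c / 3) = -9 := by
  have h2 := realP'_neg hL (t := c / 3) (by linarith) (by linarith)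
  have h4 := realP'_sq hL (t := c / 3) (by linarith) (by linarith)
  rw [realP_third hL] at h4
  nlinarith

variable (c hc) in
/-- The inverse of the incomplete integral `∫ (1 - x³)^(-2/3)`. -/
def cubicSine (t : ℝ) : ℝ := 6 * realP c hc t / (9 - realP' c hc t)

lemma hasDerivAt_cubicSine (hL : (hexPair c hc).IsEisenstein) {t : ℝ} (h0 : 0 < t)
    (h1 : t < c / 2) : HasDerivAt (cubicSine c hc)
      (3 * (-(realP' c hc t + 9) / (9 - realP' c hc t)) ^ 2) t := by
  have h2 := realP'_neg hL h0 h1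
  have h4 := realP'_sq hL h0 (by linarith)
  have hne : 9 - realP' c hc t ≠ 0 := by linarith
  have := ((hasDerivAt_realP (c := c) (hc := hc) h0 (by linarith)).const_mul 6).div
    ((hasDerivAt_realP' hL h0 (by linarith)).const_sub 9) hne
  convert! this using 1
  rw [div_pow, mul_div_assoc']
  congr 1
  linear_combination 9 * h4

lemma one_sub_cubicSine_cube (hL : (hexPair c hc).IsEisenstein) {t : ℝ} (h0 : 0 < t)
    (h1 : t < c / 2) :
    1 - cubicSine c hc t ^ 3 = (-(realP' c hc t + 9) / (9 - realP' c hc t)) ^ 3 := by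
  have h2 := realP'_neg hL h0 h1
  have h4 := realP'_sq hL h0 (by linarith)
  have hne : 9 - realP' c hc t ≠ 0 := by linarith
  rw [cubicSine]
  field_simp
  linear_combination 54 * h4

lemma cubicSine_mem (hL : (hexPair c hc).IsEisenstein) {t : ℝ} (h0 : 0 < t)
    (h1 : t < c / 3) : cubicSine c hc t ∈ Set.Ioo (0 : ℝ) 1 := by
  have h2 := realP'_lt_neg_nine hL h0 h1
  have h3 := three_lt_realP hL h0 h1
  refine ⟨div_pos (by linarith) (by linarith), ?_⟩
  have h4 := one_sub_cubicSine_cube hL h0 (by linarith)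
  have h5 : 0 < -(realP' c hc t + 9) / (9 - realP' c hc t) :=
    div_pos (by linarith) (by linarith)
  have h6 : cubicSine c hc t ^ 3 < 1 ^ 3 := by linarith [pow_pos h5 3]
  exact (Odd.strictMono_pow (by decide : Odd 3)).lt_iff_lt.mp h6

lemma tendsto_cubicSine_zero : Tendsto (cubicSine c hc) (𝓝[>] 0) (𝓝 0) := by
  have ht : Tendsto (fun t : ℝ => t) (𝓝[>] 0) (𝓝 0) := tendsto_id.mono_left nhdsWithin_le_nhds
  have h := (ht.mul ((tendsto_sq_mul_realP (c := c) (hc := hc)).const_mul 6)).div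
    (((ht.pow 3).const_mul 9).sub (tendsto_cube_mul_realP' (c := c) (hc := hc))) (by norm_num)
  simp only [zero_mul, zero_div] at h
  refine h.congr' ?_
  filter_upwards [self_mem_nhdsWithin] with t ht
  have ht' : t ≠ 0 := ne_of_gt ht
  simp only [Pi.div_apply, cubicSine]
  rw [show t * (6 * (t ^ 2 * realP c hc t)) = t ^ 3 * (6 * realP c hc t) by ring,
    show 9 * t ^ 3 - t ^ 3 * realP' c hc t = t ^ 3 * (9 - realP' c hc t) by ring,
    mul_div_mul_left _ _ (pow_ne_zero 3 ht')]

lemma strictMonoOn_cubicSine (hL : (hexPair c hc).IsEisenstein) :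
    StrictMonoOn (cubicSine c hc) (Set.Ioo 0 (c / 3)) := by
  apply strictMonoOn_of_deriv_pos (convex_Ioo _ _)
  · intro s hs
    exact (hasDerivAt_cubicSine hL hs.1 (by linarith [hs.1, hs.2])).continuousAt.continuousWithinAt
  · intro s hs
    rw [interior_Ioo] at hs
    rw [(hasDerivAt_cubicSine hL hs.1 (by linarith [hs.1, hs.2])).deriv]
    have h2 := realP'_lt_neg_nine hL hs.1 hs.2
    have h5 : 0 < -(realP' c hc s + 9) / (9 - realP' c hc s) :=
      div_pos (by linarith) (by linarith)
    positivity

lemma image_cubicSine (hL : (hexPair c hc).IsEisenstein) :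
    cubicSine c hc '' Set.Ioo 0 (c / 3) = Set.Ioo 0 1 := by
  apply Set.Subset.antisymm
  · rintro _ ⟨t, ht, rfl⟩
    exact cubicSine_mem hL ht.1 ht.2
  · rintro y ⟨hy0, hy1⟩
    have hc3 : 0 < c / 3 := by positivity
    obtain ⟨s, hs, hs2, hs3⟩ := ((tendsto_cubicSine_zero (c := c) (hc := hc)).eventually_lt_const
      hy0 |>.and (((eventually_lt_nhds hc3).filter_mono nhdsWithin_le_nhds).and
        self_mem_nhdsWithin)).exists
    have hlim : Tendsto (cubicSine c hc) (𝓝[<] (c / 3)) (𝓝 1) := by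
      have := (hasDerivAt_cubicSine hL hc3 (by linarith)).continuousAt.tendsto
      rw [cubicSine, realP_third hL, realP'_third hL] at this
      norm_num at this
      exact this.mono_left nhdsWithin_le_nhds
    obtain ⟨t, ht, ht2, ht3⟩ := (hlim.eventually_const_lt hy1 |>.and
      (((eventually_gt_nhds hc3).filter_mono nhdsWithin_le_nhds).and self_mem_nhdsWithin)).exists
    have hcont : ContinuousOn (cubicSine c hc) (Set.Ioo 0 (c / 3)) := fun s hs =>
      (hasDerivAt_cubicSine hL hs.1 (by linarith [hs.1, hs.2])).continuousAt.continuousWithinAt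
    exact isPreconnected_Ioo.intermediate_value (a := s) (b := t) ⟨hs3, hs2⟩ ⟨ht2, ht3⟩ hcont
      ⟨hs.le, ht.le⟩

lemma varpi1_eq (hL : (hexPair c hc).IsEisenstein) : varpi1 = c := by
  have hd : ∀ t ∈ Set.Ioo 0 (c / 3), HasDerivWithinAt (cubicSine c hc)
      (3 * (-(realP' c hc t + 9) / (9 - realP' c hc t)) ^ 2) (Set.Ioo 0 (c / 3)) t :=
    fun t ht => (hasDerivAt_cubicSine hL ht.1 (by linarith [ht.1, ht.2])).hasDerivWithinAt
  rw [varpi1, intervalIntegral.integral_of_le zero_le_one,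
    MeasureTheory.integral_Ioc_eq_integral_Ioo, ← image_cubicSine hL,
    MeasureTheory.integral_image_eq_integral_abs_deriv_smul measurableSet_Ioo hd
      (strictMonoOn_cubicSine hL).injOn,
    MeasureTheory.setIntegral_congr_fun (g := fun _ => (3 : ℝ)) measurableSet_Ioo]
  · have h3 : (0 : ℝ) ≤ c / 3 := by positivity
    simp [max_eq_left h3]
  · intro t ht
    have h2 := realP'_lt_neg_nine hL ht.1 ht.2
    have h5 : 0 < -(realP' c hc t + 9) / (9 - realP' c hc t) :=
      div_pos (by linarith) (by linarith)
    simp only [smul_eq_mul]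
    rw [abs_of_pos (by positivity), one_sub_cubicSine_cube hL ht.1 (by linarith [ht.1, ht.2])]
    set q := -(realP' c hc t + 9) / (9 - realP' c hc t)
    rw [← Real.rpow_natCast q 3, ← Real.rpow_mul h5.le, ← Real.rpow_natCast q 2, mul_assoc,
      ← Real.rpow_add h5]
    norm_num

lemma varpi1_pos : 0 < varpi1 := by
  obtain ⟨c, hc, hL⟩ := exists_isEisenstein
  rwa [varpi1_eq hL]

/-- The period lattice `ϖ₁ℤ[ρ]`. -/
def eisPair : PeriodPair := hexPair varpi1 varpi1_pos

lemma eisPair_isEisenstein : eisPair.IsEisenstein := by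
  obtain ⟨c, hc, hL⟩ := exists_isEisenstein
  obtain rfl := varpi1_eq hL
  exact hL

lemma coe_latticeEquivProd_symm (m : ℤ × ℤ) :
    ((eisPair.latticeEquivProd.symm.toEquiv m : eisPair.lattice) : ℂ) = ω3 m := by
  rw [show (eisPair.latticeEquivProd.symm.toEquiv m : ℂ) = _ from
    eisPair.latticeEquiv_symm_apply m]
  simp only [eisPair, hexPair, ω3]
  ring

lemma wp3'_eq : wp3' = eisPair.derivWeierstrassP := by
  ext u
  rw [wp3', PeriodPair.derivWeierstrassP, ← eisPair.latticeEquivProd.symm.toEquiv.tsum_eq,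
    ← tsum_neg]
  congr 1 with m
  rw [coe_latticeEquivProd_symm]
  ring

lemma wp3_eq : wp3 = eisPair.weierstrassP := by
  ext u
  have h := (eisPair.hasSum_weierstrassP u)
  rw [← eisPair.latticeEquivProd.symm.toEquiv.hasSum_iff] at h
  have h2 := h.update (0 : ℤ × ℤ) 0
  rw [wp3]
  convert! congrArg (fun s => (u ^ 2)⁻¹ + s) (h2.tsum_eq) using 1
  · congr 2 with m
    by_cases hm : m = 0
    · simp [hm]
    · rw [if_neg hm, Function.update_of_ne hm, Function.comp, coe_latticeEquivProd_symm]
      simp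
  · rw [Function.comp, coe_latticeEquivProd_symm]
    simp [ω3]

lemma phi3_eq (u : ℂ) : phi3 u = 6 * eisPair.weierstrassP (varpi1 * u) /
    (9 + eisPair.derivWeierstrassP (varpi1 * u)) := by
  rw [phi3, wp3_eq, wp3'_eq]

lemma psi3_eq (u : ℂ) : psi3 u = (9 - eisPair.derivWeierstrassP (varpi1 * u)) /
    (9 + eisPair.derivWeierstrassP (varpi1 * u)) := by
  rw [psi3, wp3'_eq]

end
end

noncomputable section
open Filter Topology

namespace PeriodPair
variable {L : PeriodPair}

/-- Liouville's theorem for elliptic functions, allowing removable singularities. -/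
lemma exists_eventually_eq_const {f : ℂ → ℂ} (hper : ∀ z, ∀ l ∈ L.lattice, f (z + l) = f z)
    (hloc : ∀ x, ∃ g, AnalyticAt ℂ g x ∧ f =ᶠ[𝓝[≠] x] g) :
    ∃ C, ∀ x, ∀ᶠ z in 𝓝[≠] x, f z = C := by
  choose g hg hfg using hloc
  set F : ℂ → ℂ := fun x => g x x with hF
  have hlim : ∀ x, Tendsto f (𝓝[≠] x) (𝓝 (F x)) := fun x =>
    ((hg x).continuousAt.tendsto.mono_left nhdsWithin_le_nhds).congr' (hfg x).symm
  have hFg : ∀ x, F =ᶠ[𝓝 x] g x := by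
    intro x
    have h1 : ∀ᶠ z in 𝓝[≠] x, F z = g x z := by
      have h2 := eventually_eventually_nhdsWithin.mpr (hfg x)
      filter_upwards [h2, self_mem_nhdsWithin,
        (hg x).eventually_analyticAt.filter_mono nhdsWithin_le_nhds] with z hz hzx hgz
      have h3 : f =ᶠ[𝓝 z] g x := by
        have : 𝓝[≠] x ≤ 𝓝[≠] x := le_rfl
        rw [nhdsWithin_eq_nhds.mpr (isOpen_compl_singleton.mem_nhds hzx)] at hz
        exact hz
      exact tendsto_nhds_unique (hlim z)
        ((hgz.continuousAt.tendsto.mono_left nhdsWithin_le_nhds).congr'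
          (h3.symm.filter_mono nhdsWithin_le_nhds))
    rw [← nhdsNE_sup_pure x]
    exact Filter.eventually_sup.mpr ⟨h1, rfl⟩
  have hdiff : Differentiable ℂ F := fun x =>
    ((hg x).congr (hFg x).symm).differentiableAt
  have hFper : ∀ z, ∀ l ∈ L.lattice, F (z + l) = F z := by
    intro z l hl
    have h1 : Tendsto (fun w : ℂ => w + l) (𝓝[≠] z) (𝓝[≠] (z + l)) := by
      apply tendsto_nhdsWithin_of_tendsto_nhds_of_eventually_within
      · exact (Continuous.tendsto (by fun_prop) z).mono_left nhdsWithin_le_nhds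
      · filter_upwards [self_mem_nhdsWithin] with w hw
        simpa using hw
    have h2 := (hlim (z + l)).comp h1
    simp only [Function.comp_def, hper _ l hl] at h2
    exact tendsto_nhds_unique h2 (hlim z)
  have hconst : ∀ x, F x = F 0 := fun x =>
    hdiff.apply_eq_apply_of_bounded (IsZLattice.isCompact_range_of_periodic L.lattice _
      hdiff.continuous hFper).isBounded x 0
  refine ⟨F 0, fun x => ?_⟩
  filter_upwards [hfg x, (hFg x).filter_mono nhdsWithin_le_nhds] with z h1 h2
  rw [h1, ← h2, hconst]

lemma exists_weierstrassP_eq (L : PeriodPair) (x₀ : ℂ) : ∃ u ∉ L.lattice, ℘[L] u = x₀ := by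
  by_contra! h
  have hloc : ∀ x, x ∈ L.lattice → ∃ g : ℂ → ℂ, AnalyticAt ℂ g x ∧ g x = 0 ∧
      (fun z => (℘[L] z - x₀)⁻¹) =ᶠ[𝓝[≠] x] g := by
    intro x hx
    have ha := L.analyticAt_weierstrassPExcept x
    refine ⟨fun z => (z - x) ^ 2 * ((z - x) ^ 2 * ℘[L - x] z + 1 - (z - x) ^ 2 / x ^ 2 -
      (z - x) ^ 2 * x₀)⁻¹, ?_, by simp, ?_⟩
    · refine AnalyticAt.mul (by fun_prop) (AnalyticAt.inv ?_ (by simp))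
      simp only [div_eq_mul_inv]
      fun_prop
    · filter_upwards [self_mem_nhdsWithin] with z hz
      have hz' : z - x ≠ 0 := sub_ne_zero.mpr hz
      rw [← L.ite_eq_one_sub_sq_mul_weierstrassP x hx z, if_neg (by simpa using hz), ← mul_sub, mul_inv,
        mul_inv_cancel_left₀ (pow_ne_zero 2 hz')]
  obtain ⟨C, hC⟩ := exists_eventually_eq_const (L := L) (f := fun z => (℘[L] z - x₀)⁻¹)
    (fun z l hl => by
      have := L.weierstrassP_add_coe z ⟨l, hl⟩
      simp only at this
      simp only [this])
    (fun x => by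
      by_cases hx : x ∈ L.lattice
      · obtain ⟨g, h1, -, h3⟩ := hloc x hx
        exact ⟨g, h1, h3⟩
      · exact ⟨_, ((L.analyticAt_weierstrassP hx).sub analyticAt_const).inv
          (sub_ne_zero.mpr (h x hx)), EventuallyEq.rfl⟩)
  obtain ⟨g, h1, h2, h3⟩ := hloc 0 (zero_mem _)
  have h4 : Tendsto (fun z => (℘[L] z - x₀)⁻¹) (𝓝[≠] 0) (𝓝 0) := by
    have := h1.continuousAt.tendsto
    rw [h2] at this
    exact (this.mono_left nhdsWithin_le_nhds).congr' h3.symm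
  have h5 : Tendsto (fun z => (℘[L] z - x₀)⁻¹) (𝓝[≠] 0) (𝓝 C) :=
    tendsto_const_nhds.congr' ((hC 0).mono fun z hz => hz.symm)
  obtain rfl := tendsto_nhds_unique h4 h5
  obtain ⟨z, hz1, hz2⟩ := ((hC 0).and (L.eventually_notMem_lattice 0)).exists
  exact inv_ne_zero (sub_ne_zero.mpr (h z hz2)) hz1

lemma IsEisenstein.exists_point_eq (hL : L.IsEisenstein) (P : (eisCurveOver ℂ).Point) :
    ∃ u, hL.point u = P := by
  cases P with
  | zero => exact ⟨0, hL.point_of_mem (zero_mem _)⟩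
  | some x y h =>
    obtain ⟨u, hu, hx⟩ := L.exists_weierstrassP_eq x
    have hw := hL.derivWeierstrassP_sq hu
    have heq := h.1
    rw [WeierstrassCurve.Affine.equation_iff] at heq
    simp [eisCurve] at heq
    have h2 : (2 * y - ℘'[L] u) * (2 * y + ℘'[L] u) = 0 := by
      rw [hx] at hw
      linear_combination 4 * heq - hw
    rcases mul_eq_zero.mp h2 with h3 | h3
    · refine ⟨u, ?_⟩
      rw [hL.point_of_notMem hu]
      congr 1
      linear_combination -h3 / 2
    · refine ⟨-u, ?_⟩
      rw [hL.point_of_notMem (by rwa [neg_mem_iff])]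
      congr 1
      · rw [L.weierstrassP_neg, hx]
      · rw [L.derivWeierstrassP_neg]
        linear_combination -h3 / 2

end PeriodPair
end

noncomputable section
open Filter Topology

/-- `℘` with the period lattice normalised to `ℤ[ρ]`. -/
def eP (u : ℂ) : ℂ := eisPair.weierstrassP (varpi1 * u)

/-- `℘'` with the period lattice normalised to `ℤ[ρ]`. -/
def eW (u : ℂ) : ℂ := eisPair.derivWeierstrassP (varpi1 * u)

lemma varpi1_ne_zero : (varpi1 : ℂ) ≠ 0 := by exact_mod_cast varpi1_pos.ne'

lemma varpi1_mul_mem {u : ℂ} : varpi1 * u ∈ eisPair.lattice ↔ u ∈ O3 := by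
  rw [eisPair, mem_hexPair]
  constructor
  · rintro ⟨a, ha, h⟩
    rwa [mul_left_cancel₀ varpi1_ne_zero h]
  · exact fun h => ⟨u, h, rfl⟩

lemma psi3_eq_eW (u : ℂ) : psi3 u = (9 - eW u) / (9 + eW u) := psi3_eq u

lemma phi3_eq_eP (u : ℂ) : phi3 u = 6 * eP u / (9 + eW u) := phi3_eq u

lemma eP_add (u : ℂ) {a : ℂ} (ha : a ∈ O3) : eP (u + a) = eP u := by
  rw [eP, mul_add]
  exact eisPair.weierstrassP_add_coe _ ⟨_, varpi1_mul_mem.mpr ha⟩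

lemma eW_add (u : ℂ) {a : ℂ} (ha : a ∈ O3) : eW (u + a) = eW u := by
  rw [eW, mul_add]
  exact eisPair.derivWeierstrassP_add_coe _ ⟨_, varpi1_mul_mem.mpr ha⟩

lemma eP_neg (u : ℂ) : eP (-u) = eP u := by
  rw [eP, mul_neg, PeriodPair.weierstrassP_neg, eP]

lemma eW_neg (u : ℂ) : eW (-u) = -eW u := by
  rw [eW, mul_neg, PeriodPair.derivWeierstrassP_neg, eW]

lemma eP_ρ3_mul (u : ℂ) : eP (ρ3 * u) = ρ3 * eP u := by
  rw [eP, mul_left_comm]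
  exact weierstrassP_ρ3_mul _

lemma eW_ρ3_mul (u : ℂ) : eW (ρ3 * u) = eW u := by
  rw [eW, mul_left_comm]
  exact derivWeierstrassP_ρ3_mul _

lemma eW_sq {u : ℂ} (hu : u ∉ O3) : eW u ^ 2 = 4 * eP u ^ 3 - 27 :=
  eisPair_isEisenstein.derivWeierstrassP_sq (mt varpi1_mul_mem.mp hu)

lemma eP_ne_zero {u : ℂ} (hu : sqrtm3 * u ∉ O3) : eP u ≠ 0 := by
  apply weierstrassP_sqrtm3_notMem eisPair_isEisenstein
  rw [mul_left_comm]
  exact mt varpi1_mul_mem.mp hu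

lemma notMem_of_sqrtm3_mul {u : ℂ} (hu : sqrtm3 * u ∉ O3) : u ∉ O3 :=
  fun h => hu (mul_mem sqrtm3_mem h)

lemma eP_sqrtm3_mul {u : ℂ} (hu : sqrtm3 * u ∉ O3) :
    eP (sqrtm3 * u) = -(eP u ^ 3 - 27) / (3 * eP u ^ 2) := by
  rw [eP, mul_left_comm]
  exact (weierstrassP_sqrtm3_mul eisPair_isEisenstein
    (mt varpi1_mul_mem.mp (notMem_of_sqrtm3_mul hu)) (eP_ne_zero hu)).1

lemma eW_sqrtm3_mul {u : ℂ} (hu : sqrtm3 * u ∉ O3) :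
    eW (sqrtm3 * u) = -(eW u * (eP u ^ 3 + 54)) / (3 * sqrtm3 * eP u ^ 3) := by
  rw [eW, mul_left_comm]
  exact (weierstrassP_sqrtm3_mul eisPair_isEisenstein
    (mt varpi1_mul_mem.mp (notMem_of_sqrtm3_mul hu)) (eP_ne_zero hu)).2

lemma eW_sq_ne {u : ℂ} (hu : sqrtm3 * (sqrtm3 * u) ∉ O3) : eW u ^ 2 ≠ 81 := by
  intro h
  have hu1 := notMem_of_sqrtm3_mul hu
  have h1 := eP_sqrtm3_mul hu1
  rw [eW_sq (notMem_of_sqrtm3_mul hu1)] at h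
  rw [show eP u ^ 3 - 27 = 0 by linear_combination h / 4, neg_zero, zero_div] at h1
  exact eP_ne_zero hu h1

lemma nine_add_eW_ne {u : ℂ} (hu : sqrtm3 * (sqrtm3 * u) ∉ O3) : 9 + eW u ≠ 0 :=
  fun h => eW_sq_ne hu (by linear_combination (eW u - 9) * h)

lemma nine_sub_eW_ne {u : ℂ} (hu : sqrtm3 * (sqrtm3 * u) ∉ O3) : 9 - eW u ≠ 0 :=
  fun h => eW_sq_ne hu (by linear_combination -(eW u + 9) * h)

lemma psi3_ne_zero {u : ℂ} (hu : sqrtm3 * (sqrtm3 * u) ∉ O3) : psi3 u ≠ 0 := by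
  rw [psi3_eq_eW]
  exact div_ne_zero (nine_sub_eW_ne hu) (nine_add_eW_ne hu)

lemma phi3_ne_zero {u : ℂ} (hu : sqrtm3 * (sqrtm3 * u) ∉ O3) : phi3 u ≠ 0 := by
  rw [phi3_eq_eP]
  exact div_ne_zero (mul_ne_zero (by norm_num) (eP_ne_zero (notMem_of_sqrtm3_mul hu)))
    (nine_add_eW_ne hu)

lemma one_add_psi3_ne_zero {u : ℂ} (hu : sqrtm3 * (sqrtm3 * u) ∉ O3) : 1 + psi3 u ≠ 0 := by
  have := nine_add_eW_ne hu
  rw [psi3_eq_eW, show 1 + (9 - eW u) / (9 + eW u) = 18 / (9 + eW u) by field_simp; ring]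
  exact div_ne_zero (by norm_num) this

lemma phi3_cube {u : ℂ} (hu : u ∉ O3) (h : 9 + eW u ≠ 0) : phi3 u ^ 3 = 1 + psi3 u ^ 3 := by
  rw [phi3_eq_eP, psi3_eq_eW]
  field_simp
  linear_combination -54 * eW_sq hu

lemma psi3_sqrtm3_mul {u : ℂ} (hu : sqrtm3 * (sqrtm3 * (sqrtm3 * u)) ∉ O3) :
    1 - ρ3 * psi3 u ^ 3 ≠ 0 ∧
      psi3 (sqrtm3 * u) * (1 - ρ3 * psi3 u ^ 3) = psi3 u ^ 3 - ρ3 := by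
  have hu2 := notMem_of_sqrtm3_mul hu
  have hu1 := notMem_of_sqrtm3_mul hu2
  have hu0 := notMem_of_sqrtm3_mul hu1
  have hP := eP_ne_zero hu1
  have hW := nine_add_eW_ne hu2
  have hW' := nine_add_eW_ne hu
  have hs := sqrtm3_ne_zero
  have hsq := eW_sq hu0
  have hmul : 3 * sqrtm3 * (eW u ^ 2 + 27) * eW (sqrtm3 * u) = -(eW u * (eW u ^ 2 + 243)) := by
    rw [eW_sqrtm3_mul hu1, show eW u ^ 2 + 27 = 4 * eP u ^ 3 by rw [hsq]; ring]
    field_simp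
    linear_combination eW u * hsq
  have h27 : eW u ^ 2 + 27 ≠ 0 := by
    rw [hsq]; simpa using hP
  have e := sqrtm3_eq
  have h1 : (1 - ρ3 * psi3 u ^ 3) * (9 + eW u) ^ 3 =
      ρ3 ^ 2 * (3 * sqrtm3 * (eW u ^ 2 + 27) * (9 + eW (sqrtm3 * u))) := by
    rw [mul_add, hmul, psi3_eq_eW]
    field_simp
    rw [e]
    linear_combination (eW u ^ 3 - 54 * eW u ^ 2 * ρ3 + 27 * eW u ^ 2 + 243 * eW u -
      1458 * ρ3 + 729) * ρ3_sq_add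
  have h2 : (psi3 u ^ 3 - ρ3) * (9 + eW u) ^ 3 =
      ρ3 ^ 2 * (3 * sqrtm3 * (eW u ^ 2 + 27) * (9 - eW (sqrtm3 * u))) := by
    rw [mul_sub, hmul, psi3_eq_eW]
    field_simp
    rw [e]
    linear_combination (-eW u ^ 3 - 54 * eW u ^ 2 * ρ3 + 27 * eW u ^ 2 - 243 * eW u -
      1458 * ρ3 + 729) * ρ3_sq_add
  have hne : (1 - ρ3 * psi3 u ^ 3) * (9 + eW u) ^ 3 ≠ 0 := by
    rw [h1]
    exact mul_ne_zero (pow_ne_zero 2 ρ3_ne_zero)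
      (mul_ne_zero (mul_ne_zero (mul_ne_zero (by norm_num) hs) h27) hW')
  refine ⟨left_ne_zero_of_mul hne, ?_⟩
  apply mul_right_cancel₀ (pow_ne_zero 3 hW)
  rw [mul_assoc, h1, h2, psi3_eq_eW]
  field_simp

lemma psi3_add (u : ℂ) {a : ℂ} (ha : a ∈ O3) : psi3 (u + a) = psi3 u := by
  rw [psi3_eq_eW, psi3_eq_eW, eW_add u ha]

lemma phi3_add (u : ℂ) {a : ℂ} (ha : a ∈ O3) : phi3 (u + a) = phi3 u := by
  rw [phi3_eq_eP, phi3_eq_eP, eW_add u ha, eP_add u ha]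

lemma psi3_ρ3_mul (u : ℂ) : psi3 (ρ3 * u) = psi3 u := by
  rw [psi3_eq_eW, psi3_eq_eW, eW_ρ3_mul]

lemma phi3_ρ3_mul (u : ℂ) : phi3 (ρ3 * u) = ρ3 * phi3 u := by
  rw [phi3_eq_eP, phi3_eq_eP, eW_ρ3_mul, eP_ρ3_mul]
  ring

lemma psi3_neg (u : ℂ) : psi3 (-u) = (psi3 u)⁻¹ := by
  rw [psi3_eq_eW, psi3_eq_eW, eW_neg, inv_div]
  ring

lemma phi3_neg {u : ℂ} (h : 9 + eW u ≠ 0) : phi3 (-u) = phi3 u / psi3 u := by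
  rw [psi3_eq_eW, phi3_eq_eP, phi3_eq_eP, eW_neg, eP_neg]
  rw [div_div_div_cancel_right₀ h]
  ring
end

noncomputable section
open Polynomial

instance : Algebra.IsIntegral ℤ O3 := by
  refine ⟨fun x => ?_⟩
  have h : IsIntegral ℤ (x : ℂ) := by
    obtain ⟨a, b, hab⟩ := mem_O3.mp x.2
    rw [hab]
    have hρ : IsIntegral ℤ ρ3 := by
      refine ⟨X ^ 2 + X + 1, by monicity!, ?_⟩
      simpa using ρ3_sq_add
    exact (isIntegral_algebraMap (R := ℤ) (x := a)).add
      ((isIntegral_algebraMap (R := ℤ) (x := b)).mul hρ)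
  exact (isIntegral_algebraMap_iff (A := O3) (B := ℂ) Subtype.val_injective).mp h

/-- `ρ` as an element of `ℤ[ρ]`. -/
def ρO : O3 := ⟨ρ3, ρ3_mem⟩

lemma ρO_sq_add : ρO ^ 2 + ρO + 1 = 0 := Subtype.ext ρ3_sq_add

/-- Numerator and denominator of the iterates of `y ↦ (y³ - ρ) / (1 - ρy³)`. -/
def dynPoly : ℕ → O3[X] × O3[X]
  | 0 => (X, 1)
  | j + 1 => ((dynPoly j).1 ^ 3 - C ρO * (dynPoly j).2 ^ 3,
      (dynPoly j).2 ^ 3 - C ρO * (dynPoly j).1 ^ 3)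

lemma natDegree_cube_sub_le {P Q : O3[X]} {n : ℕ} (hP : P.natDegree ≤ n) (hQ : Q.natDegree ≤ n) :
    (P ^ 3 - C ρO * Q ^ 3).natDegree ≤ 3 * n := by
  refine (natDegree_sub_le_of_le (natDegree_pow_le_of_le 3 hP)
    ((natDegree_C_mul_le _ _).trans (natDegree_pow_le_of_le 3 hQ))).trans ?_
  exact max_le le_rfl le_rfl

lemma natDegree_dynPoly_le (j : ℕ) :
    (dynPoly j).1.natDegree ≤ 3 ^ j ∧ (dynPoly j).2.natDegree ≤ 3 ^ j := by
  induction j with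
  | zero => simp [dynPoly]
  | succ j ih =>
    rw [pow_succ']
    exact ⟨natDegree_cube_sub_le ih.1 ih.2, natDegree_cube_sub_le ih.2 ih.1⟩

lemma coeff_cube_sub {P Q : O3[X]} {n : ℕ} (hP : P.natDegree ≤ n) (hQ : Q.natDegree ≤ n) :
    (P ^ 3 - C ρO * Q ^ 3).coeff (3 * n) = P.coeff n ^ 3 - ρO * Q.coeff n ^ 3 := by
  rw [coeff_sub, coeff_C_mul, coeff_pow_of_natDegree_le hP, coeff_pow_of_natDegree_le hQ]

lemma coeff_dynPoly_succ (j : ℕ) :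
    (dynPoly (j + 1)).1.coeff (3 ^ (j + 1)) =
      (dynPoly j).1.coeff (3 ^ j) ^ 3 - ρO * (dynPoly j).2.coeff (3 ^ j) ^ 3 ∧
    (dynPoly (j + 1)).2.coeff (3 ^ (j + 1)) =
      (dynPoly j).2.coeff (3 ^ j) ^ 3 - ρO * (dynPoly j).1.coeff (3 ^ j) ^ 3 := by
  have hd := natDegree_dynPoly_le j
  rw [pow_succ' 3 j]
  exact ⟨coeff_cube_sub hd.1 hd.2, coeff_cube_sub hd.2 hd.1⟩

lemma coeff_dynPoly (j : ℕ) :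
    ((dynPoly (j + 1)).1.coeff (3 ^ (j + 1)) ^ 3 = 1 ∧
      (dynPoly (j + 1)).2.coeff (3 ^ (j + 1)) ^ 3 = -1) ∨
    ((dynPoly (j + 1)).1.coeff (3 ^ (j + 1)) ^ 3 = -1 ∧
      (dynPoly (j + 1)).2.coeff (3 ^ (j + 1)) ^ 3 = 1) := by
  have h1 : ρO ^ 3 = 1 := by linear_combination (ρO - 1) * ρO_sq_add
  have h2 : (1 + ρO) ^ 3 = -1 := by linear_combination (ρO + 2) * ρO_sq_add
  induction j with
  | zero =>
    left
    rw [(coeff_dynPoly_succ 0).1, (coeff_dynPoly_succ 0).2]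
    simp only [dynPoly, pow_zero, coeff_X_one, coeff_one]
    norm_num
    linear_combination -h1
  | succ j ih =>
    rw [(coeff_dynPoly_succ (j + 1)).1, (coeff_dynPoly_succ (j + 1)).2]
    rcases ih with ⟨h3, h4⟩ | ⟨h3, h4⟩ <;> rw [h3, h4]
    · right
      exact ⟨by linear_combination h2, by linear_combination -h2⟩
    · left
      exact ⟨by linear_combination -h2, by linear_combination h2⟩

section dynamics
variable {y : ℕ → ℂ}

lemma aeval_dynPoly (hne : ∀ j, 1 - ρ3 * y j ^ 3 ≠ 0)
    (hrec : ∀ j, y (j + 1) * (1 - ρ3 * y j ^ 3) = y j ^ 3 - ρ3) (j : ℕ) :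
    aeval (y 0) (dynPoly j).2 ≠ 0 ∧ aeval (y 0) (dynPoly j).1 = y j * aeval (y 0) (dynPoly j).2 := by
  induction j with
  | zero => simp [dynPoly]
  | succ j ih =>
    obtain ⟨h1, h2⟩ := ih
    have hρ : algebraMap O3 ℂ ρO = ρ3 := rfl
    simp only [dynPoly, map_sub, map_mul, map_pow, aeval_C, hρ, h2]
    constructor
    · rw [show aeval (y 0) (dynPoly j).2 ^ 3 - ρ3 * (y j * aeval (y 0) (dynPoly j).2) ^ 3 =
        aeval (y 0) (dynPoly j).2 ^ 3 * (1 - ρ3 * y j ^ 3) by ring]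
      exact mul_ne_zero (pow_ne_zero 3 h1) (hne j)
    · linear_combination -aeval (y 0) (dynPoly j).2 ^ 3 * hrec j

lemma isIntegral_of_cycle {n : ℕ} (hn : 1 ≤ n) (hcyc : y n = y 0)
    (hne : ∀ j, 1 - ρ3 * y j ^ 3 ≠ 0)
    (hrec : ∀ j, y (j + 1) * (1 - ρ3 * y j ^ 3) = y j ^ 3 - ρ3) : IsIntegral ℤ (y 0) := by
  obtain ⟨j, rfl⟩ : ∃ j, n = j + 1 := ⟨n - 1, by omega⟩
  obtain ⟨u, hu⟩ : ∃ u, u * (dynPoly (j + 1)).2.coeff (3 ^ (j + 1)) = -1 := by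
    rcases coeff_dynPoly j with ⟨-, h⟩ | ⟨-, h⟩
    · exact ⟨(dynPoly (j + 1)).2.coeff (3 ^ (j + 1)) ^ 2, by linear_combination h⟩
    · exact ⟨-(dynPoly (j + 1)).2.coeff (3 ^ (j + 1)) ^ 2, by linear_combination -h⟩
  have hd := natDegree_dynPoly_le (j + 1)
  apply isIntegral_trans (A := O3)
  refine ⟨C u * ((dynPoly (j + 1)).1 - X * (dynPoly (j + 1)).2), ?_, ?_⟩
  · apply monic_of_natDegree_le_of_coeff_eq_one (3 ^ (j + 1) + 1)
    · have h2 : (X * (dynPoly (j + 1)).2).natDegree ≤ 3 ^ (j + 1) + 1 := by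
        exact (natDegree_mul_le_of_le natDegree_X_le hd.2).trans (add_comm _ _).le
      exact (natDegree_C_mul_le _ _).trans ((natDegree_sub_le _ _).trans
        (max_le (hd.1.trans (Nat.le_succ _)) h2))
    · rw [coeff_C_mul, coeff_sub, coeff_X_mul, coeff_eq_zero_of_natDegree_lt (by omega)]
      linear_combination -hu
  · have := (aeval_dynPoly hne hrec (j + 1)).2
    rw [← aeval_def, map_mul, map_sub, map_mul, aeval_X, this, hcyc, sub_self, mul_zero]

end dynamics

/-- The ring of algebraic integers. -/
abbrev AlgInt : Subalgebra ℤ ℂ := integralClosure ℤ ℂ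

lemma O3_le {z : ℂ} (hz : z ∈ O3) : z ∈ AlgInt := by
  have := (Algebra.IsIntegral.isIntegral (R := ℤ) (⟨z, hz⟩ : O3)).algebraMap (B := ℂ)
  exact this

/-- `ρ` as an algebraic integer. -/
def ρA : AlgInt := ⟨ρ3, O3_le ρ3_mem⟩

/-- `√-3` as an algebraic integer. -/
def θA : AlgInt := ⟨sqrtm3, O3_le sqrtm3_mem⟩

section reduction
variable {k : Type*} [Field k] {f : AlgInt →+* k}

lemma three_eq_zero (hf : f θA = 0) : (3 : k) = 0 := by
  have h : θA ^ 2 = -3 := Subtype.ext sqrtm3_sq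
  have := congrArg f h
  rw [map_pow, hf, map_neg, map_ofNat] at this
  linear_combination this

lemma map_ρA (hf : f θA = 0) : f ρA = 1 := by
  have h : θA = 1 + 2 * ρA := Subtype.ext sqrtm3_eq
  have := congrArg f h
  rw [hf, map_add, map_mul, map_one, map_ofNat] at this
  linear_combination this + f ρA * three_eq_zero hf

lemma two_ne_zero_of_map_θA (hf : f θA = 0) : (2 : k) ≠ 0 := fun h => by
  have : (1 : k) = 0 := by linear_combination three_eq_zero hf - h
  exact one_ne_zero this

lemma map_eq_one_of_cycle (hf : f θA = 0) {y : ℕ → AlgInt} {n : ℕ} (hn : 1 ≤ n)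
    (hcyc : ∀ j, y (j + n) = y j) (hne : ∀ j, 1 + y j ≠ 0)
    (hrec : ∀ j, y (j + 1) * (1 - ρA * y j ^ 3) = y j ^ 3 - ρA) : f (y 0) = 1 := by
  have h3 := three_eq_zero hf
  have hρ := map_ρA hf
  have hcube : ∀ z : k, 1 - z ^ 3 = (1 - z) ^ 3 := fun z => by
    linear_combination (z - z ^ 2) * h3
  have hstep : ∀ j, f (y j) ≠ 1 → f (y (j + 1)) ≠ 1 := by
    intro j hj hj1
    have h1 := congrArg f (hrec j)
    simp only [map_mul, map_sub, map_pow, map_one, hρ, one_mul, hj1] at h1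
    have h2 : 2 * (1 - f (y j)) ^ 3 = 0 := by rw [← hcube]; linear_combination h1
    rcases mul_eq_zero.mp h2 with h | h
    · exact two_ne_zero_of_map_θA hf h
    · exact hj (by linear_combination -(pow_eq_zero_iff three_ne_zero).mp h)
  by_contra h0
  have hall : ∀ j, f (y j) ≠ 1 := fun j => by
    induction j with
    | zero => exact h0
    | succ j ih => exact hstep j ih
  have hprod : ∏ j ∈ Finset.range n, (1 - ρA * y j ^ 3) =
      ∏ j ∈ Finset.range n, ((1 - ρA) * (1 - y j + y j ^ 2)) := by
    have hs : ∏ j ∈ Finset.range n, (1 + y (j + 1)) = ∏ j ∈ Finset.range n, (1 + y j) := by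
      have h1 := Finset.prod_range_succ (fun j => 1 + y j) n
      rw [Finset.prod_range_succ', ← zero_add n, hcyc 0, zero_add] at h1
      exact mul_right_cancel₀ (hne 0) h1
    have hp : ∏ j ∈ Finset.range n, (1 + y j) ≠ 0 := Finset.prod_ne_zero_iff.mpr fun j _ => hne j
    apply mul_left_cancel₀ hp
    conv_lhs => rw [← hs]
    rw [← Finset.prod_mul_distrib, ← Finset.prod_mul_distrib]
    refine Finset.prod_congr rfl fun j _ => ?_
    linear_combination hrec j
  have h1 := congrArg f hprod
  rw [map_prod, map_prod] at h1
  have h2 : ∏ j ∈ Finset.range n, f ((1 - ρA) * (1 - y j + y j ^ 2)) = 0 := by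
    apply Finset.prod_eq_zero (Finset.mem_range.mpr hn)
    rw [map_mul, map_sub, map_one, hρ, sub_self, zero_mul]
  rw [h2, Finset.prod_eq_zero_iff] at h1
  obtain ⟨j, -, hj⟩ := h1
  simp only [map_mul, map_sub, map_pow, map_one, hρ, one_mul] at hj
  rw [hcube] at hj
  exact hall j (by linear_combination -(pow_eq_zero_iff three_ne_zero).mp hj)

end reduction

end

noncomputable section

/-- `π ∈ ℤ[ρ]` is a primary prime of norm the rational prime `p ≡ 1 (mod 3)`. -/
structure IsPrimaryPrime (p : ℕ) (π : ℂ) : Prop where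
  prime : p.Prime
  mod_three : p % 3 = 1
  mem : π ∈ O3
  primary : ECong π 1 3
  norm : (p : ℂ) = π * (starRingEnd ℂ) π

lemma conj_mem_O3 {z : ℂ} (hz : z ∈ O3) : (starRingEnd ℂ) z ∈ O3 := by
  obtain ⟨a, b, rfl⟩ := mem_O3.mp hz
  refine mem_O3.mpr ⟨a - b, -b, ?_⟩
  rw [map_add, map_mul, conj_ρ3, map_intCast, map_intCast]
  push_cast
  ring

lemma mul_conj_add_mul_ρ3 (a b : ℤ) :
    (a + b * ρ3) * (starRingEnd ℂ) (a + b * ρ3) = ((a ^ 2 - a * b + b ^ 2 : ℤ) : ℂ) := by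
  rw [map_add, map_mul, conj_ρ3, map_intCast, map_intCast]
  push_cast
  linear_combination (-b ^ 2 : ℂ) * ρ3_sq_add

lemma int_mem_O3 (n : ℤ) : (n : ℂ) ∈ O3 := intCast_mem O3 n

lemma mem_O3_of_cube_eq_one {z : ℂ} (h : z ^ 3 = 1) : z ∈ O3 := by
  have : (z - 1) * ((z - ρ3) * (z - ρ3 ^ 2)) = 0 := by
    linear_combination h + (-z ^ 2 + z * ρ3 - ρ3 + 1) * ρ3_sq_add
  rcases mul_eq_zero.mp this with h | h
  · rw [sub_eq_zero.mp h]; exact one_mem _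
  · rcases mul_eq_zero.mp h with h | h
    · rw [sub_eq_zero.mp h]; exact ρ3_mem
    · rw [sub_eq_zero.mp h]; exact pow_mem ρ3_mem 2

namespace IsPrimaryPrime
variable {p : ℕ} {π : ℂ} (h : IsPrimaryPrime p π)
include h

lemma ne_zero : π ≠ 0 := by
  rintro rfl
  have := h.norm
  rw [zero_mul] at this
  exact h.prime.ne_zero (by exact_mod_cast this)

lemma int_div_mem_iff {n : ℤ} : (n : ℂ) / π ∈ O3 ↔ (p : ℤ) ∣ n := by
  constructor
  · intro hn
    obtain ⟨a, b, hab⟩ := mem_O3.mp hn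
    have h1 : (n : ℂ) = (a + b * ρ3) * π := by rwa [div_eq_iff h.ne_zero] at hab
    have h2 : ((n ^ 2 : ℤ) : ℂ) = ((a ^ 2 - a * b + b ^ 2 : ℤ) : ℂ) * (p : ℤ) := by
      have h3 : (n : ℂ) = (starRingEnd ℂ) ((a + b * ρ3) * π) := by rw [← h1, map_intCast]
      rw [← mul_conj_add_mul_ρ3, Int.cast_natCast, h.norm]
      rw [map_mul] at h3
      push_cast
      linear_combination (n : ℂ) * h1 + (a + b * ρ3) * π * h3
    have h3 : (p : ℤ) ∣ n ^ 2 := ⟨a ^ 2 - a * b + b ^ 2, by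
      rw [mul_comm]; exact_mod_cast h2⟩
    exact (Nat.prime_iff_prime_int.mp h.prime).dvd_of_dvd_pow h3
  · rintro ⟨m, rfl⟩
    push_cast
    rw [h.norm, mul_assoc, mul_div_cancel_left₀ _ h.ne_zero]
    exact mul_mem (conj_mem_O3 h.mem) (int_mem_O3 m)

lemma exists_int_ρ3 : ∃ r : ℤ, (ρ3 - r) / π ∈ O3 := by
  obtain ⟨a, b, hab⟩ := mem_O3.mp h.mem
  have hP := Nat.prime_iff_prime_int.mp h.prime
  have hn : (p : ℤ) = a ^ 2 - a * b + b ^ 2 := by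
    have := h.norm
    rw [hab, mul_conj_add_mul_ρ3] at this
    exact_mod_cast this
  have hb : ¬ (p : ℤ) ∣ b := by
    intro hb
    have ha : (p : ℤ) ∣ a := by
      refine hP.dvd_of_dvd_pow (n := 2) ?_
      rw [show a ^ 2 = p + a * b - b * b by rw [hn]; ring]
      exact ((dvd_refl _).add (hb.mul_left _)).sub (hb.mul_left _)
    obtain ⟨c, rfl⟩ := ha
    obtain ⟨d, rfl⟩ := hb
    apply hP.not_isUnit
    refine isUnit_of_dvd_one ⟨c ^ 2 - c * d + d ^ 2, ?_⟩
    apply mul_left_cancel₀ hP.ne_zero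
    linear_combination hn
  obtain ⟨u, v, huv⟩ := (hP.coprime_iff_not_dvd.mpr hb)
  refine ⟨-a * v, ?_⟩
  have hc : (u : ℂ) * p + v * b = 1 := by exact_mod_cast huv
  have : (ρ3 - ((-a * v : ℤ) : ℂ)) = (u * (starRingEnd ℂ) π * ρ3 + v) * π := by
    push_cast
    linear_combination -ρ3 * hc + u * ρ3 * h.norm - v * hab
  rw [this, mul_div_cancel_right₀ _ h.ne_zero]
  exact add_mem (mul_mem (mul_mem (int_mem_O3 _) (conj_mem_O3 h.mem)) ρ3_mem) (int_mem_O3 _)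

lemma exists_int_rep {z : ℂ} (hz : z ∈ O3) : ∃ n : ℤ, (z - n) / π ∈ O3 := by
  obtain ⟨r, hr⟩ := h.exists_int_ρ3
  obtain ⟨a, b, rfl⟩ := mem_O3.mp hz
  refine ⟨a + b * r, ?_⟩
  have := mul_mem (int_mem_O3 b) hr
  convert this using 1
  push_cast
  ring

lemma ecoprime_iff {n : ℤ} : ECoprime n π ↔ ¬ (p : ℤ) ∣ n := by
  constructor
  · rintro ⟨u, hu, v, hv, huv⟩ hn
    have h1 : ((1 : ℤ) : ℂ) / π ∈ O3 := by
      have := add_mem (mul_mem hu (h.int_div_mem_iff.mpr hn)) hv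
      convert this using 1
      have := h.ne_zero
      field_simp
      push_cast
      linear_combination -huv
    exact (Nat.prime_iff_prime_int.mp h.prime).not_isUnit
      (isUnit_of_dvd_one (h.int_div_mem_iff.mp h1))
  · intro hn
    obtain ⟨u, v, huv⟩ := ((Nat.prime_iff_prime_int.mp h.prime).coprime_iff_not_dvd.mpr hn)
    refine ⟨v, int_mem_O3 v, u * (starRingEnd ℂ) π, mul_mem (int_mem_O3 u) (conj_mem_O3 h.mem), ?_⟩
    have hc : (u : ℂ) * p + v * n = 1 := by exact_mod_cast huv
    linear_combination hc - u * h.norm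

lemma not_dvd_three : ¬ (p : ℤ) ∣ 3 := by
  intro hd
  have h1 : p ∣ 3 := by exact_mod_cast hd
  have h2 := (Nat.prime_dvd_prime_iff_eq h.prime Nat.prime_three).mp h1
  have := h.mod_three
  omega

lemma sqrtm3_pow_mul_notMem {n : ℤ} (hn : ¬ (p : ℤ) ∣ n) (j : ℕ) :
    sqrtm3 ^ j * (n / π) ∉ O3 := by
  intro hm
  have h1 := mul_mem (pow_mem sqrtm3_mem j) hm
  rw [← mul_assoc, ← mul_pow, ← sq, sqrtm3_sq,
    show (-3 : ℂ) ^ j * (n / π) = (((-3) ^ j * n : ℤ) : ℂ) / π by push_cast; ring,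
    h.int_div_mem_iff] at h1
  have hP := Nat.prime_iff_prime_int.mp h.prime
  rcases hP.dvd_or_dvd h1 with h2 | h2
  · exact h.not_dvd_three ((dvd_neg.mp (hP.dvd_of_dvd_pow h2)))
  · exact hn h2

lemma notMem {n : ℤ} (hn : ¬ (p : ℤ) ∣ n) : (n : ℂ) / π ∉ O3 :=
  mt h.int_div_mem_iff.mp hn

lemma sqrtm3_mul_mul_notMem {n : ℤ} (hn : ¬ (p : ℤ) ∣ n) :
    sqrtm3 * (sqrtm3 * (n / π)) ∉ O3 := by
  have := h.sqrtm3_pow_mul_notMem hn 2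
  rwa [sq, mul_assoc] at this

lemma nine_add_eW_ne {n : ℤ} (hn : ¬ (p : ℤ) ∣ n) : 9 + eW (n / π) ≠ 0 :=
  _root_.nine_add_eW_ne (h.sqrtm3_mul_mul_notMem hn)

lemma sqrtm3_pow_period (n : ℤ) (j : ℕ) :
    ∃ a ∈ O3, sqrtm3 ^ (j + 2 * (p - 1)) * (n / π) = sqrtm3 ^ j * (n / π) + a := by
  have hfermat : (-3 : ℤ) ^ (p - 1) ≡ 1 [ZMOD p] := by
    apply Int.ModEq.pow_card_sub_one_eq_one h.prime
    rw [Int.isCoprime_iff_gcd_eq_one, Int.gcd_comm, ← Int.isCoprime_iff_gcd_eq_one,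
      (Nat.prime_iff_prime_int.mp h.prime).coprime_iff_not_dvd]
    exact fun hd => h.not_dvd_three (dvd_neg.mp hd)
  have h1 := h.int_div_mem_iff.mpr (hfermat.symm.dvd)
  refine ⟨sqrtm3 ^ j * (n * ((((-3) ^ (p - 1) - 1 : ℤ) : ℂ) / π)),
    mul_mem (pow_mem sqrtm3_mem j) (mul_mem (int_mem_O3 n) h1), ?_⟩
  rw [pow_add, pow_mul, sqrtm3_sq]
  push_cast
  ring

lemma psi3_cycle {n : ℤ} (hn : ¬ (p : ℤ) ∣ n) (j : ℕ) :
    1 - ρ3 * psi3 (sqrtm3 ^ j * (n / π)) ^ 3 ≠ 0 ∧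
      psi3 (sqrtm3 ^ (j + 1) * (n / π)) * (1 - ρ3 * psi3 (sqrtm3 ^ j * (n / π)) ^ 3) =
        psi3 (sqrtm3 ^ j * (n / π)) ^ 3 - ρ3 := by
  have := h.sqrtm3_pow_mul_notMem hn (j + 3)
  rw [show sqrtm3 ^ (j + 3) * (n / π) =
    sqrtm3 * (sqrtm3 * (sqrtm3 * (sqrtm3 ^ j * (n / π)))) by ring] at this
  rw [show sqrtm3 ^ (j + 1) * (n / π) = sqrtm3 * (sqrtm3 ^ j * (n / π)) by ring]
  exact psi3_sqrtm3_mul this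

lemma psi3_periodic (n : ℤ) (j : ℕ) :
    psi3 (sqrtm3 ^ (j + 2 * (p - 1)) * (n / π)) = psi3 (sqrtm3 ^ j * (n / π)) := by
  obtain ⟨a, ha, hj⟩ := h.sqrtm3_pow_period n j
  rw [hj, psi3_add _ ha]

lemma isIntegral_psi3_pow {n : ℤ} (hn : ¬ (p : ℤ) ∣ n) (i : ℕ) :
    IsIntegral ℤ (psi3 (sqrtm3 ^ i * (n / π))) := by
  have h2 := h.prime.two_le
  have hp := h.psi3_periodic n i
  rw [add_comm] at hp
  have := isIntegral_of_cycle (y := fun j => psi3 (sqrtm3 ^ (j + i) * (n / π)))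
    (n := 2 * (p - 1)) (by omega) (by simpa using hp)
    (fun j => (h.psi3_cycle hn (j + i)).1)
    (fun j => by
      have := (h.psi3_cycle hn (j + i)).2
      rwa [add_right_comm] at this)
  simpa using this

lemma isIntegral_psi3 {n : ℤ} (hn : ¬ (p : ℤ) ∣ n) : IsIntegral ℤ (psi3 (n / π)) := by
  simpa using h.isIntegral_psi3_pow hn 0

lemma phi3_cube {n : ℤ} (hn : ¬ (p : ℤ) ∣ n) :
    phi3 (n / π) ^ 3 = 1 + psi3 (n / π) ^ 3 :=
  _root_.phi3_cube (h.notMem hn) (h.nine_add_eW_ne hn)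

lemma isIntegral_phi3 {n : ℤ} (hn : ¬ (p : ℤ) ∣ n) : IsIntegral ℤ (phi3 (n / π)) := by
  apply IsIntegral.of_pow (n := 3) (by norm_num)
  rw [h.phi3_cube hn]
  exact isIntegral_one.add ((h.isIntegral_psi3 hn).pow 3)

section reduction
variable {k : Type*} [Field k] {f : AlgInt →+* k}

lemma map_psi3 (hf : f θA = 0) {n : ℤ} (hn : ¬ (p : ℤ) ∣ n) :
    f ⟨psi3 (n / π), h.isIntegral_psi3 hn⟩ = 1 := by
  have h2 := h.prime.two_le
  have := map_eq_one_of_cycle hf (n := 2 * (p - 1)) (by omega)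
    (y := fun j => ⟨psi3 (sqrtm3 ^ j * (n / π)), h.isIntegral_psi3_pow hn j⟩)
    (fun j => Subtype.ext (h.psi3_periodic n j))
    (fun j hj => by
      have hm := h.sqrtm3_pow_mul_notMem hn (j + 2)
      rw [show sqrtm3 ^ (j + 2) * (n / π) =
        sqrtm3 * (sqrtm3 * (sqrtm3 ^ j * (n / π))) by ring] at hm
      exact one_add_psi3_ne_zero hm (congrArg Subtype.val hj))
    (fun j => Subtype.ext (h.psi3_cycle hn j).2)
  simpa using this

lemma map_phi3 (hf : f θA = 0) {n : ℤ} (hn : ¬ (p : ℤ) ∣ n) :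
    f ⟨phi3 (n / π), h.isIntegral_phi3 hn⟩ ^ 3 = 2 := by
  have h1 : (⟨phi3 (n / π), h.isIntegral_phi3 hn⟩ : AlgInt) ^ 3 =
    1 + ⟨psi3 (n / π), h.isIntegral_psi3 hn⟩ ^ 3 := Subtype.ext (h.phi3_cube hn)
  rw [← map_pow, h1, map_add, map_pow, h.map_psi3 hf hn, map_one]
  norm_num

end reduction

end IsPrimaryPrime

end

noncomputable section
open IntermediateField

/-- The field of algebraic numbers in `ℂ`. -/
abbrev AlgNum : IntermediateField ℚ ℂ := algebraicClosure ℚ ℂ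

instance : Algebra.IsAlgebraic ℚ AlgNum := algebraicClosure.isAlgebraic ℚ ℂ

instance : Normal ℚ AlgNum :=
  have : IsAlgClosure ℚ AlgNum := algebraicClosure.isAlgClosure ℚ ℂ
  IsAlgClosure.normal ℚ AlgNum

lemma mem_algNum_of_isIntegral {z : ℂ} (hz : IsIntegral ℤ z) : z ∈ AlgNum :=
  mem_algebraicClosure_iff.mpr (hz.tower_top (A := ℚ)).isAlgebraic

/-- `ρ` as an algebraic number. -/
def ρQ : AlgNum := ⟨ρ3, mem_algNum_of_isIntegral (O3_le ρ3_mem)⟩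

lemma exists_rat_of_mem_adjoin {z : AlgNum} (hz : z ∈ ℚ⟮ρQ⟯) :
    ∃ a b : ℚ, (z : ℂ) = a + b * ρ3 := by
  rw [← mem_toSubalgebra, adjoin_simple_toSubalgebra_of_isAlgebraic
    (Algebra.IsAlgebraic.isAlgebraic ρQ)] at hz
  induction hz using Algebra.adjoin_induction with
  | mem x hx =>
    rw [Set.mem_singleton_iff.mp hx]
    exact ⟨0, 1, by simp [ρQ]⟩
  | algebraMap r => exact ⟨r, 0, by simp⟩
  | add x y _ _ hx hy =>
    obtain ⟨a, b, h1⟩ := hx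
    obtain ⟨c, d, h2⟩ := hy
    refine ⟨a + c, b + d, ?_⟩
    push_cast
    rw [h1, h2]
    ring
  | mul x y _ _ hx hy =>
    obtain ⟨a, b, h1⟩ := hx
    obtain ⟨c, d, h2⟩ := hy
    refine ⟨a * c - b * d, a * d + b * c - b * d, ?_⟩
    push_cast
    rw [h1, h2]
    linear_combination (b * d : ℂ) * ρ3_sq_add

lemma exists_rat_of_fixed {z : AlgNum}
    (hz : ∀ σ : AlgNum →ₐ[ℚ] ℂ, σ ρQ = ρ3 → σ z = z) : ∃ a b : ℚ, (z : ℂ) = a + b * ρ3 := by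
  have : IsGalois ℚ AlgNum := ⟨⟩
  have h1 := (InfiniteGalois.mem_range_algebraMap_iff_fixed (k := ℚ⟮ρQ⟯) z).mpr fun τ => by
    have := hz (AlgNum.val.comp (τ.toAlgHom.restrictScalars ℚ))
      (congrArg Subtype.val (τ.commutes ⟨ρQ, mem_adjoin_simple_self ℚ ρQ⟩))
    exact Subtype.ext this
  obtain ⟨w, rfl⟩ := h1
  exact exists_rat_of_mem_adjoin w.2

lemma exists_int_of_isIntegral {q : ℚ} (h : IsIntegral ℤ (q : ℂ)) : ∃ n : ℤ, q = n := by
  have h1 : IsIntegral ℤ q :=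
    (isIntegral_algebraMap_iff (A := ℚ) (B := ℂ) (algebraMap ℚ ℂ).injective).mp (by simpa using h)
  obtain ⟨n, hn⟩ := IsIntegrallyClosed.isIntegral_iff.mp h1
  exact ⟨n, hn.symm⟩

lemma mem_O3_of_isIntegral {a b : ℚ} (h : IsIntegral ℤ (a + b * ρ3 : ℂ)) :
    (a + b * ρ3 : ℂ) ∈ O3 := by
  have hc : IsIntegral ℤ ((starRingEnd ℂ) (a + b * ρ3 : ℂ)) :=
    h.map ((starRingEnd ℂ).toIntAlgHom)
  rw [map_add, map_mul, conj_ρ3, map_ratCast, map_ratCast] at hc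
  have h1 : IsIntegral ℤ (((-3 * b ^ 2 : ℚ)) : ℂ) := by
    have := (h.sub hc).pow 2
    rw [show (((-3 * b ^ 2 : ℚ)) : ℂ) = (a + b * ρ3 - (a + b * (-1 - ρ3))) ^ 2 by
      push_cast
      linear_combination (-4 * b ^ 2 : ℂ) * ρ3_sq_add]
    exact this
  obtain ⟨m, hm⟩ := exists_int_of_isIntegral h1
  have h2 : IsIntegral ℤ (((3 * b : ℚ)) : ℂ) := by
    apply IsIntegral.of_pow (n := 2) (by norm_num)
    rw [show (((3 * b : ℚ)) : ℂ) ^ 2 = ((-3 * m : ℤ) : ℂ) by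
      have := congrArg (fun q : ℚ => (q : ℂ)) hm
      push_cast at this ⊢
      linear_combination -3 * this]
    exact isIntegral_algebraMap (R := ℤ) (A := ℂ) (x := -3 * m)
  obtain ⟨c, hc'⟩ := exists_int_of_isIntegral h2
  have h3 : c ^ 2 = 3 * -m := by
    have : (c : ℚ) ^ 2 = 3 * -m := by rw [← hm, ← hc']; ring
    exact_mod_cast this
  obtain ⟨n, rfl⟩ : (3 : ℤ) ∣ c := Int.prime_three.dvd_of_dvd_pow ⟨_, h3⟩
  have hb : b = n := by
    push_cast at hc'
    linarith
  subst hb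
  have h4 : IsIntegral ℤ (a : ℂ) := by
    have := h.sub (O3_le (mul_mem (int_mem_O3 n) ρ3_mem))
    rwa [Rat.cast_intCast, add_sub_cancel_right] at this
  obtain ⟨l, rfl⟩ := exists_int_of_isIntegral h4
  exact mem_O3.mpr ⟨l, n, by push_cast; ring⟩

lemma point_eq_some {u : ℂ} (hu : u ∉ O3) :
    eisPair_isEisenstein.point (varpi1 * u) =
      .some (eP u) (eW u / 2) (eisCurveOver_nonsingular (eW_sq hu)) :=
  eisPair_isEisenstein.point_of_notMem (mt varpi1_mul_mem.mp hu)

lemma exists_point_eq_some {v x w : ℂ} {hn : (eisCurveOver ℂ).Nonsingular x (w / 2)}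
    (h : eisPair_isEisenstein.point v = .some x (w / 2) hn) :
    ∃ u ∉ O3, v = varpi1 * u ∧ eP u = x ∧ eW u = w := by
  have e : v = varpi1 * (v / varpi1) := by rw [mul_div_cancel₀ _ varpi1_ne_zero]
  have hu : v / varpi1 ∉ O3 := by
    rw [← varpi1_mul_mem, ← e, ← eisPair_isEisenstein.point_eq_zero_iff, h]
    exact WeierstrassCurve.Affine.Point.some_ne_zero _
  refine ⟨v / varpi1, hu, e, ?_⟩
  rw [e, point_eq_some hu] at h
  obtain ⟨h1, h2⟩ := WeierstrassCurve.Affine.Point.some.inj h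
  refine ⟨h1, ?_⟩
  linear_combination 2 * h2

/-- The point with coordinates `(℘, ℘'/2)`, where the algebraic numbers `x` and `w` are the values
of `℘` and `℘'`. -/
def algPoint (x w : AlgNum) (h : w ^ 2 = 4 * x ^ 3 - 27) : (eisCurveOver AlgNum).Point :=
  .some x (w / 2) (eisCurveOver_nonsingular h)

open WeierstrassCurve.Affine in
lemma exists_point_eq_map (σ : AlgNum →ₐ[ℚ] ℂ) {x w : AlgNum} (h : w ^ 2 = 4 * x ^ 3 - 27) :
    ∃ u ∉ O3, eP u = σ x ∧ eW u = σ w ∧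
      Point.map σ (algPoint x w h) = eisPair_isEisenstein.point (varpi1 * u) := by
  obtain ⟨v, hv⟩ := eisPair_isEisenstein.exists_point_eq (Point.map σ (algPoint x w h))
  have hn : (eisCurveOver ℂ).Nonsingular (σ x) (σ w / 2) := by
    apply eisCurveOver_nonsingular
    have := congrArg σ h
    rwa [map_sub, map_mul, map_pow, map_pow, map_ofNat σ 4, map_ofNat σ 27] at this
  have h1 : Point.map (W' := eisCurve) σ (algPoint x w h) = .some (σ x) (σ w / 2) hn := by
    rw [algPoint, Point.map_some]
    congr 1
    rw [map_div₀, map_ofNat σ 2]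
  rw [h1] at hv
  obtain ⟨u, hu, e, hx, hw⟩ := exists_point_eq_some hv
  exact ⟨u, hu, hx, hw, by rw [h1, ← hv, e]⟩

end

noncomputable section
open WeierstrassCurve.Affine

lemma map_algPoint (σ : AlgNum →ₐ[ℚ] ℂ) {x w : AlgNum} (h : w ^ 2 = 4 * x ^ 3 - 27) {u : ℂ}
    (hu : u ∉ O3) :
    Point.map σ (algPoint x w h) = eisPair_isEisenstein.point (varpi1 * u) ↔
      σ x = eP u ∧ σ w = eW u := by
  rw [point_eq_some hu, algPoint, Point.map_some, Point.some.injEq, map_div₀, map_ofNat σ 2]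
  refine and_congr Iff.rfl ⟨fun h => ?_, fun h => by rw [h]⟩
  linear_combination 2 * h

namespace IsPrimaryPrime
variable {p : ℕ} {π : ℂ} (h : IsPrimaryPrime p π)
include h

lemma eW_mem {n : ℤ} (hn : ¬ (p : ℤ) ∣ n) : eW (n / π) ∈ AlgNum := by
  have h1 := mem_algNum_of_isIntegral (h.isIntegral_psi3 hn)
  have h2 := one_add_psi3_ne_zero (h.sqrtm3_mul_mul_notMem hn)
  have h3 := h.nine_add_eW_ne hn
  have : eW (n / π) = 9 * (1 - psi3 (n / π)) / (1 + psi3 (n / π)) := by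
    rw [eq_div_iff h2, psi3_eq_eW]
    field_simp
    ring
  rw [this]
  exact div_mem (mul_mem (ofNat_mem _ 9) (sub_mem (one_mem _) h1)) (add_mem (one_mem _) h1)

lemma eP_mem {n : ℤ} (hn : ¬ (p : ℤ) ∣ n) : eP (n / π) ∈ AlgNum := by
  have h1 := mem_algNum_of_isIntegral (h.isIntegral_phi3 hn)
  have h3 := h.nine_add_eW_ne hn
  have : eP (n / π) = phi3 (n / π) * (9 + eW (n / π)) / 6 := by
    rw [phi3_eq_eP]
    field_simp
  rw [this]
  exact div_mem (mul_mem h1 (add_mem (ofNat_mem _ 9) (h.eW_mem hn))) (ofNat_mem _ 6)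

/-- Any embedding fixing `ρ` acts on the `π`-division points through multiplication by an
integer prime to `p`. -/
lemma exists_galois_action (σ : AlgNum →ₐ[ℚ] ℂ) (hσ : σ ρQ = ρ3) :
    ∃ s : ℤ, ¬ (p : ℤ) ∣ s ∧ ∀ (n : ℤ) (hn : ¬ (p : ℤ) ∣ n),
      σ ⟨eP (n / π), h.eP_mem hn⟩ = eP ((n * s : ℤ) / π) ∧
      σ ⟨eW (n / π), h.eW_mem hn⟩ = eW ((n * s : ℤ) / π) := by
  have hsq : ∀ (n : ℤ) (hn : ¬ (p : ℤ) ∣ n), (⟨eW (n / π), h.eW_mem hn⟩ : AlgNum) ^ 2 =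
      4 * ⟨eP (n / π), h.eP_mem hn⟩ ^ 3 - 27 := fun n hn => Subtype.ext (eW_sq (h.notMem hn))
  have hval : ∀ (n : ℤ) (hn : ¬ (p : ℤ) ∣ n), Point.map AlgNum.val (algPoint _ _ (hsq n hn)) =
      eisPair_isEisenstein.point (varpi1 * (n / π)) := fun n hn =>
    (map_algPoint AlgNum.val (hsq n hn) (h.notMem hn)).mpr ⟨rfl, rfl⟩
  have hP := Nat.prime_iff_prime_int.mp h.prime
  have h1 : ¬ (p : ℤ) ∣ 1 := fun hd => hP.not_isUnit (isUnit_of_dvd_one hd)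
  obtain ⟨u, hu, hxu, hwu, hmap⟩ := exists_point_eq_map σ (hsq 1 h1)
  have hρu : ρ3 * u ∉ O3 := fun hm => hu (by
    have := mul_mem (pow_mem ρ3_mem 2) hm
    rwa [show ρ3 ^ 2 * (ρ3 * u) = u by linear_combination u * ρ3_cube] at this)
  have hρ1 : ρ3 * (((1 : ℤ) : ℂ) / π) ∉ O3 := fun hm => h.notMem h1 (by
    have := mul_mem (pow_mem ρ3_mem 2) hm
    rwa [show ρ3 ^ 2 * (ρ3 * (((1 : ℤ) : ℂ) / π)) = ((1 : ℤ) : ℂ) / π by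
      linear_combination (((1 : ℤ) : ℂ) / π) * ρ3_cube] at this)
  have hsqρ : (⟨eW (((1 : ℤ) : ℂ) / π), h.eW_mem h1⟩ : AlgNum) ^ 2 =
      4 * (ρQ * ⟨eP (((1 : ℤ) : ℂ) / π), h.eP_mem h1⟩) ^ 3 - 27 := by
    rw [hsq 1 h1, mul_pow, show ρQ ^ 3 = 1 from Subtype.ext ρ3_cube, one_mul]
  have hvalρ : Point.map AlgNum.val (algPoint _ _ hsqρ) =
      eisPair_isEisenstein.point (varpi1 * (ρ3 * (((1 : ℤ) : ℂ) / π))) :=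
    (map_algPoint AlgNum.val hsqρ hρ1).mpr ⟨(eP_ρ3_mul _).symm, (eW_ρ3_mul _).symm⟩
  obtain ⟨a, b, hab⟩ := mem_O3.mp h.mem
  have hzero : a • algPoint _ _ (hsq 1 h1) + b • algPoint _ _ hsqρ = 0 := by
    apply Point.map_injective (W' := eisCurve) AlgNum.val
    rw [map_add, map_zsmul, map_zsmul, hval 1 h1, hvalρ, _root_.map_zero,
      ← PeriodPair.IsEisenstein.point_zsmul, ← PeriodPair.IsEisenstein.point_zsmul,
      ← PeriodPair.IsEisenstein.point_add, PeriodPair.IsEisenstein.point_eq_zero_iff,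
      show (a : ℂ) * (varpi1 * (((1 : ℤ) : ℂ) / π)) + b * (varpi1 * (ρ3 * (((1 : ℤ) : ℂ) / π))) =
        varpi1 * 1 by
        have := h.ne_zero
        field_simp
        push_cast
        rw [hab]
        ring,
      varpi1_mul_mem]
    exact one_mem _
  have hπu : π * u ∈ O3 := by
    have := congrArg (Point.map (W' := eisCurve) σ) hzero
    rw [map_add, map_zsmul, map_zsmul, hmap, _root_.map_zero,
      (map_algPoint σ hsqρ hρu).mpr
        ⟨by rw [map_mul, hσ, eP_ρ3_mul, hxu], by rw [eW_ρ3_mul, hwu]⟩,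
      ← PeriodPair.IsEisenstein.point_zsmul, ← PeriodPair.IsEisenstein.point_zsmul,
      ← PeriodPair.IsEisenstein.point_add, PeriodPair.IsEisenstein.point_eq_zero_iff,
      show (a : ℂ) * (varpi1 * u) + b * (varpi1 * (ρ3 * u)) = varpi1 * (π * u) by rw [hab]; ring,
      varpi1_mul_mem] at this
    exact this
  obtain ⟨s, hs⟩ := h.exists_int_rep hπu
  rw [sub_div, mul_div_cancel_left₀ _ h.ne_zero] at hs
  have hps : ¬ (p : ℤ) ∣ s := fun hd => hu (by
    have := add_mem hs (h.int_div_mem_iff.mpr hd)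
    rwa [sub_add_cancel] at this)
  refine ⟨s, hps, fun n hn => ?_⟩
  have hns : ¬ (p : ℤ) ∣ n * s := fun hd => (hP.dvd_or_dvd hd).elim hn hps
  rw [← map_algPoint σ (hsq n hn) (h.notMem hns)]
  have hmul : algPoint _ _ (hsq n hn) = n • algPoint _ _ (hsq 1 h1) := by
    apply Point.map_injective (W' := eisCurve) AlgNum.val
    rw [map_zsmul, hval n hn, hval 1 h1, ← PeriodPair.IsEisenstein.point_zsmul]
    congr 1
    push_cast
    ring
  rw [hmul, map_zsmul, hmap, ← PeriodPair.IsEisenstein.point_zsmul,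
    PeriodPair.IsEisenstein.point_eq_point_iff,
    show (n : ℂ) * (varpi1 * u) - varpi1 * (((n * s : ℤ) : ℂ) / π) =
      varpi1 * (n * (u - s / π)) by push_cast; ring, varpi1_mul_mem]
  exact mul_mem (int_mem_O3 n) hs

end IsPrimaryPrime

end

noncomputable section

namespace IsCubicChar
variable {p : ℕ} {π : ℂ} {χ : ℂ → ℂ} (hχ : IsCubicChar π p χ) (h : IsPrimaryPrime p π)
include hχ h

lemma apply_pow_three {n : ℤ} (hn : ¬ (p : ℤ) ∣ n) : χ n ^ 3 = 1 :=
  hχ.cube n (int_mem_O3 n) (h.ecoprime_iff.mpr hn)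

lemma apply_ρ3 : χ ρ3 = ρ3 ^ ((p - 1) / 3) := by
  have hco : ECoprime ρ3 π := ⟨ρ3 ^ 2, pow_mem ρ3_mem 2, 0, zero_mem _, by
    linear_combination ρ3_cube⟩
  have h1 := hχ.cube ρ3 ρ3_mem hco
  obtain ⟨d, hd, hdiff⟩ := hχ.euler ρ3 ρ3_mem hco
  set a := χ ρ3
  set b := ρ3 ^ ((p - 1) / 3) with hb
  have h2 : b ^ 3 = 1 := by rw [hb, ← pow_mul, mul_comm, pow_mul, ρ3_cube, one_pow]
  by_contra hne
  have h3 : a ^ 2 + a * b + b ^ 2 = 0 := by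
    apply mul_left_cancel₀ (sub_ne_zero.mpr hne)
    linear_combination h1 - h2
  apply h.not_dvd_three
  rw [← h.int_div_mem_iff]
  have ha := mem_O3_of_cube_eq_one h1
  have hb' := mem_O3_of_cube_eq_one h2
  have : ((3 : ℤ) : ℂ) / π = -(d * (a - b) * (a ^ 2 * b ^ 2)) := by
    rw [div_eq_iff h.ne_zero]
    push_cast
    linear_combination (a ^ 2 * b ^ 2) * h3 + (a ^ 2 * b ^ 2) * (a - b) * -hdiff - 3 * h1 * b ^ 3 - 3 * h2
  rw [this]
  exact neg_mem (mul_mem (mul_mem hd (sub_mem ha hb')) (mul_mem (pow_mem ha 2) (pow_mem hb' 2)))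

lemma apply_eq_of_mem {m n : ℂ} (hm : m ∈ O3) (hn : n ∈ O3) (hmn : (m - n) / π ∈ O3) :
    χ m = χ n :=
  hχ.resChar.periodic m hm n hn ⟨_, hmn, by rw [mul_div_cancel₀ _ h.ne_zero]⟩

end IsCubicChar

/-- The least non-negative residue of a unit modulo `p`. -/
def unitRep {p : ℕ} (x : (ZMod p)ˣ) : ℤ := ((x : ZMod p).val : ℤ)

namespace IsPrimaryPrime
variable {p : ℕ} {π : ℂ} (h : IsPrimaryPrime p π)
include h

lemma unitRep_cast (x : (ZMod p)ˣ) : ((unitRep x : ℤ) : ZMod p) = x := by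
  have : NeZero p := ⟨h.prime.ne_zero⟩
  simp [unitRep]

lemma unitRep_not_dvd (x : (ZMod p)ˣ) : ¬ (p : ℤ) ∣ unitRep x := by
  have : Fact p.Prime := ⟨h.prime⟩
  rw [← ZMod.intCast_zmod_eq_zero_iff_dvd, h.unitRep_cast]
  exact x.ne_zero

lemma sub_div_mem_of_cast_eq {m n : ℤ} (hmn : (m : ZMod p) = n) : ((m : ℂ) - n) / π ∈ O3 := by
  rw [← Int.cast_sub, h.int_div_mem_iff]
  exact (ZMod.intCast_eq_intCast_iff_dvd_sub n m p).mp hmn.symm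

lemma unitRep_mul_sub (x y : (ZMod p)ˣ) :
    ((unitRep (x * y) : ℂ) - unitRep x * unitRep y) / π ∈ O3 := by
  rw [← Int.cast_mul]
  apply h.sub_div_mem_of_cast_eq
  rw [Int.cast_mul, h.unitRep_cast, h.unitRep_cast, h.unitRep_cast, Units.val_mul]

lemma exists_unit_ρ3 : ∃ w : (ZMod p)ˣ, orderOf w = 3 ∧ (ρ3 - unitRep w) / π ∈ O3 := by
  have : Fact p.Prime := ⟨h.prime⟩
  obtain ⟨r, hr⟩ := h.exists_int_ρ3
  have hcube : (r : ZMod p) ^ 3 = 1 := by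
    have h1 : (((r ^ 3 - 1 : ℤ)) : ℂ) / π ∈ O3 := by
      have := mul_mem hr (neg_mem (add_mem (add_mem (pow_mem ρ3_mem 2)
        (mul_mem ρ3_mem (int_mem_O3 r))) (pow_mem (int_mem_O3 r) 2)))
      convert this using 1
      push_cast
      rw [div_mul_eq_mul_div]
      congr 1
      linear_combination ρ3_cube
    rw [h.int_div_mem_iff, ← ZMod.intCast_zmod_eq_zero_iff_dvd] at h1
    push_cast at h1
    exact sub_eq_zero.mp h1
  have hne : (r : ZMod p) ≠ 1 := by
    intro h1
    have h2 := h.sub_div_mem_of_cast_eq (m := r) (n := 1) (by simpa using h1)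
    apply h.not_dvd_three
    rw [← h.int_div_mem_iff]
    have := mul_mem (add_mem hr h2) (mul_mem (neg_mem (pow_mem ρ3_mem 2)) (sub_mem ρ3_mem (one_mem _)))
    convert this using 1
    rw [← add_div, div_mul_eq_mul_div]
    congr 1
    push_cast
    linear_combination (ρ3 ^ 2 - 3 * ρ3 + 3) * ρ3_sq_add
  obtain ⟨w, hw⟩ : ∃ w : (ZMod p)ˣ, (w : ZMod p) = r :=
    ⟨⟨r, r ^ 2, by rw [← hcube]; ring, by rw [← hcube]; ring⟩, rfl⟩
  refine ⟨w, ?_, ?_⟩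
  · apply orderOf_eq_prime
    · exact Units.ext (by rw [Units.val_pow_eq_pow_val, hw, hcube, Units.val_one])
    · exact fun h1 => hne (by rw [← hw, h1, Units.val_one])
  · have h1 := h.sub_div_mem_of_cast_eq (m := r) (n := unitRep w) (by rw [h.unitRep_cast, hw])
    have := add_mem hr h1
    convert this using 1
    ring

lemma unitRep_mul_div (f : ℂ → ℂ) (hper : ∀ u, ∀ a ∈ O3, f (u + a) = f u) {w : (ZMod p)ˣ} {ε : ℂ}
    (hw : (ε - unitRep w) / π ∈ O3) (x : (ZMod p)ˣ) :
    f (unitRep (x * w) / π) = f (ε * (unitRep x / π)) := by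
  have h1 := sub_mem (h.unitRep_mul_sub x w) (mul_mem (int_mem_O3 (unitRep x)) hw)
  rw [← hper (ε * (unitRep x / π)) _ h1]
  congr 1
  ring

lemma sum_Icc_eq (F : ℤ → ℂ) :
    ∑ r ∈ Finset.Icc 1 (p - 1), F r =
      letI : Fact p.Prime := ⟨h.prime⟩; ∑ x : (ZMod p)ˣ, F (unitRep x) := by
  have : Fact p.Prime := ⟨h.prime⟩
  symm
  refine Finset.sum_bij (fun x _ => (x : ZMod p).val) (fun x _ => ?_) (fun x _ y _ hxy => ?_)
    (fun r hr => ?_) (fun x _ => rfl)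
  · have h1 := ZMod.val_lt (x : ZMod p)
    have h2 : (x : ZMod p).val ≠ 0 := by
      rw [Ne, ZMod.val_eq_zero]; exact x.ne_zero
    rw [Finset.mem_Icc]
    omega
  · exact Units.ext (ZMod.val_injective p hxy)
  · rw [Finset.mem_Icc] at hr
    have hlt : r < p := by omega
    have h0 : (r : ZMod p) ≠ 0 := by
      rw [Ne, ZMod.natCast_eq_zero_iff]
      exact Nat.not_dvd_of_pos_of_lt (by omega) hlt
    exact ⟨Units.mk0 _ h0, Finset.mem_univ _, by simp [ZMod.val_cast_of_lt hlt]⟩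

end IsPrimaryPrime

end

noncomputable section

lemma algHom_apply_of_mem_O3 {σ : AlgNum →ₐ[ℚ] ℂ} (hσ : σ ρQ = ρ3) {z : ℂ} (hz : z ∈ O3) :
    σ ⟨z, mem_algNum_of_isIntegral (O3_le hz)⟩ = z := by
  obtain ⟨a, b, rfl⟩ := mem_O3.mp hz
  have : (⟨a + b * ρ3, mem_algNum_of_isIntegral (O3_le hz)⟩ : AlgNum) = a + b * ρQ :=
    Subtype.ext (by simp [ρQ])
  rw [this, map_add, map_mul, map_intCast, map_intCast, hσ]

/-- A function on division points is rational if its values are compatible with the embeddings of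
the algebraic numbers. -/
def IsGaloisCompatible (f : ℂ → ℂ) : Prop :=
  ∀ (σ : AlgNum →ₐ[ℚ] ℂ) (u v : ℂ) (hx : eP u ∈ AlgNum) (hw : eW u ∈ AlgNum),
    σ ⟨eP u, hx⟩ = eP v → σ ⟨eW u, hw⟩ = eW v → ∃ hm : f u ∈ AlgNum, σ ⟨f u, hm⟩ = f v

lemma isGaloisCompatible_phi3 : IsGaloisCompatible phi3 := by
  intro σ u v hx hw h1 h2
  have e : phi3 u = ((6 * ⟨eP u, hx⟩ / (9 + ⟨eW u, hw⟩) : AlgNum) : ℂ) := by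
    rw [phi3_eq_eP]; rfl
  refine ⟨e ▸ Subtype.mem _, ?_⟩
  rw [show (⟨phi3 u, e ▸ Subtype.mem _⟩ : AlgNum) = 6 * ⟨eP u, hx⟩ / (9 + ⟨eW u, hw⟩) from
    Subtype.ext e, map_div₀, map_mul, map_add, h1, h2, map_ofNat σ 6, map_ofNat σ 9, phi3_eq_eP]

lemma isGaloisCompatible_psi3 : IsGaloisCompatible psi3 := by
  intro σ u v hx hw h1 h2
  have e : psi3 u = (((9 - ⟨eW u, hw⟩) / (9 + ⟨eW u, hw⟩) : AlgNum) : ℂ) := by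
    rw [psi3_eq_eW]; rfl
  refine ⟨e ▸ Subtype.mem _, ?_⟩
  rw [show (⟨psi3 u, e ▸ Subtype.mem _⟩ : AlgNum) = (9 - ⟨eW u, hw⟩) / (9 + ⟨eW u, hw⟩) from
    Subtype.ext e, map_div₀, map_sub, map_add, h2, map_ofNat σ 9, psi3_eq_eW]

lemma IsGaloisCompatible.inv {f : ℂ → ℂ} (hf : IsGaloisCompatible f) :
    IsGaloisCompatible fun u => (f u)⁻¹ := by
  intro σ u v hx hw h1 h2
  obtain ⟨hm, h3⟩ := hf σ u v hx hw h1 h2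
  refine ⟨inv_mem hm, ?_⟩
  change σ (⟨f u, hm⟩⁻¹) = (f v)⁻¹
  rw [← h3, map_inv₀]

lemma sum_eq_card_mul_sum_quotient {U : Type*} [Group U] [Fintype U] (H : Subgroup U)
    [Fintype H] [Fintype (U ⧸ H)] (g : U → ℂ) (hg : ∀ x, ∀ y ∈ H, g (x * y) = g x) :
    ∑ x, g x = Fintype.card H * ∑ q : U ⧸ H, g q.out := by
  have hbij : Function.Bijective fun z : (U ⧸ H) × H => z.1.out * (z.2 : U) := by
    constructor
    · rintro ⟨q, y⟩ ⟨q', y'⟩ hz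
      have h1 := congrArg (QuotientGroup.mk (s := H)) hz
      simp only [QuotientGroup.mk_mul_of_mem _ y.2, QuotientGroup.mk_mul_of_mem _ y'.2,
        QuotientGroup.out_eq'] at h1
      subst h1
      exact Prod.ext rfl (Subtype.ext (mul_left_cancel hz))
    · intro x
      refine ⟨(QuotientGroup.mk x, ⟨(QuotientGroup.mk x : U ⧸ H).out⁻¹ * x, ?_⟩), ?_⟩
      · rw [← QuotientGroup.eq, QuotientGroup.out_eq']
      · simp
  rw [← hbij.sum_comp, Fintype.sum_prod_type, Finset.mul_sum]
  refine Finset.sum_congr rfl fun q _ => ?_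
  rw [Finset.sum_congr rfl fun (y : H) _ => hg q.out y y.2, Finset.sum_const, Finset.card_univ,
    nsmul_eq_mul]

namespace IsPrimaryPrime
variable {p : ℕ} {π : ℂ} (h : IsPrimaryPrime p π) {χ : ℂ → ℂ} (hχ : IsCubicChar π p χ)
include h hχ

lemma chi_unitRep_mul (x y : (ZMod p)ˣ) :
    χ (unitRep (x * y)) = χ (unitRep x) * χ (unitRep y) := by
  rw [← hχ.resChar.map_mul _ (int_mem_O3 _) _ (int_mem_O3 _)]
  exact hχ.apply_eq_of_mem h (int_mem_O3 _) (mul_mem (int_mem_O3 _) (int_mem_O3 _))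
    (h.unitRep_mul_sub x y)

lemma exists_EGS3_eq_sum {f : ℂ → ℂ} (hper : ∀ u, ∀ a ∈ O3, f (u + a) = f u)
    (hf : ∀ u, χ ρ3 * f (ρ3 * u) = f u) :
    ∃ T : Finset ℤ, (∀ n ∈ T, ¬ (p : ℤ) ∣ n) ∧ 3 * T.card = p - 1 ∧
      EGS3 p χ f π = ∑ n ∈ T, χ n * f (n / π) := by
  classical
  have : Fact p.Prime := ⟨h.prime⟩
  obtain ⟨w, hw3, hw⟩ := h.exists_unit_ρ3
  set g : (ZMod p)ˣ → ℂ := fun x => χ (unitRep x) * f (unitRep x / π) with hg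
  have hgw : ∀ x, g (x * w) = g x := fun x => by
    simp only [hg]
    rw [h.chi_unitRep_mul hχ, h.unitRep_mul_div f hper hw,
      ← hχ.apply_eq_of_mem h ρ3_mem (int_mem_O3 _) hw, mul_assoc, hf]
  have hgz : ∀ x, ∀ y ∈ Subgroup.zpowers w, g (x * y) = g x := by
    intro x y hy
    obtain ⟨i, rfl⟩ := (mem_powers_iff_mem_zpowers (x := w)).mpr hy
    induction i with
    | zero => simp
    | succ i ih =>
      have := ih ((Subgroup.zpowers w).pow_mem (Subgroup.mem_zpowers w) i)
      simp only [pow_succ] at this ⊢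
      rw [← mul_assoc, hgw, this]
  set H := Subgroup.zpowers w
  have hH : Fintype.card H = 3 := by rw [Fintype.card_zpowers, hw3]
  have hsum : ∑ x, g x = 3 * ∑ q : (ZMod p)ˣ ⧸ H, g q.out := by
    rw [sum_eq_card_mul_sum_quotient H g hgz, hH, Nat.cast_ofNat]
  have hinj : Function.Injective fun q : (ZMod p)ˣ ⧸ H => unitRep q.out := fun q q' hqq => by
    have := congrArg (Int.cast : ℤ → ZMod p) hqq
    simp only [h.unitRep_cast] at this
    exact Quotient.out_injective (Units.ext this)
  refine ⟨Finset.univ.image fun q : (ZMod p)ˣ ⧸ H => unitRep q.out, ?_, ?_, ?_⟩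
  · intro n hn
    obtain ⟨q, -, rfl⟩ := Finset.mem_image.mp hn
    exact h.unitRep_not_dvd _
  · rw [Finset.card_image_of_injective _ hinj, Finset.card_univ, ← ZMod.card_units p,
      ← Nat.card_eq_fintype_card, ← Nat.card_eq_fintype_card,
      Subgroup.card_eq_card_quotient_mul_card_subgroup H, Nat.card_eq_fintype_card (α := H), hH,
      mul_comm]
  · rw [Finset.sum_image hinj.injOn, EGS3]
    have h1 := h.sum_Icc_eq fun n => χ n * f (n / π)
    simp only [Int.cast_natCast] at h1
    rw [h1]
    change 1 / 3 * ∑ x, g x = ∑ q : (ZMod p)ˣ ⧸ H, g q.out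
    rw [hsum]
    ring

lemma exists_rat_EGS3_cube {f : ℂ → ℂ} (hper : ∀ u, ∀ a ∈ O3, f (u + a) = f u)
    (hgal : IsGaloisCompatible f) : ∃ a b : ℚ, EGS3 p χ f π ^ 3 = a + b * ρ3 := by
  have : Fact p.Prime := ⟨h.prime⟩
  set g : (ZMod p)ˣ → ℂ := fun x => χ (unitRep x) * f (unitRep x / π) with hg
  have hG : EGS3 p χ f π = 1 / 3 * ∑ x, g x := by
    rw [EGS3]
    have h1 := h.sum_Icc_eq fun n => χ n * f (n / π)
    simp only [Int.cast_natCast] at h1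
    rw [h1]
  have hχO : ∀ x : (ZMod p)ˣ, χ (unitRep x) ∈ O3 := fun x =>
    mem_O3_of_cube_eq_one (hχ.apply_pow_three h (h.unitRep_not_dvd x))
  have hfA : ∀ x : (ZMod p)ˣ, f (unitRep x / π) ∈ AlgNum := fun x =>
    (hgal AlgNum.val _ _ (h.eP_mem (h.unitRep_not_dvd x)) (h.eW_mem (h.unitRep_not_dvd x))
      rfl rfl).1
  let c : (ZMod p)ˣ → AlgNum := fun x => ⟨_, mem_algNum_of_isIntegral (O3_le (hχO x))⟩
  let e : (ZMod p)ˣ → AlgNum := fun x => ⟨_, hfA x⟩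
  let GA : AlgNum := 1 / 3 * ∑ x, c x * e x
  have hGA : (GA : ℂ) = EGS3 p χ f π := by
    rw [hG]
    change AlgNum.val (1 / 3 * ∑ x, c x * e x) = _
    rw [map_mul, map_sum]
    rfl
  obtain ⟨a, b, hab⟩ := exists_rat_of_fixed (z := GA ^ 3) fun σ hσ => by
    obtain ⟨s, hs, hact⟩ := h.exists_galois_action σ hσ
    have hs0 : (s : ZMod p) ≠ 0 := by rwa [Ne, ZMod.intCast_zmod_eq_zero_iff_dvd]
    let y : (ZMod p)ˣ := Units.mk0 _ hs0
    have hy : ((s : ℂ) - unitRep y) / π ∈ O3 :=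
      h.sub_div_mem_of_cast_eq (by rw [h.unitRep_cast]; rfl)
    have he : ∀ x, σ (e x) = f (unitRep (x * y) / π) := fun x => by
      obtain ⟨h1, h2⟩ := hact _ (h.unitRep_not_dvd x)
      obtain ⟨h3, h4⟩ := hgal σ _ _ (h.eP_mem (h.unitRep_not_dvd x))
        (h.eW_mem (h.unitRep_not_dvd x)) h1 h2
      rw [h.unitRep_mul_div f hper hy x]
      refine h4.trans ?_
      congr 1
      push_cast
      ring
    have hσG : χ (unitRep y) * σ GA = GA := by
      rw [hGA, hG, ← Equiv.sum_comp (Equiv.mulRight y)]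
      change χ (unitRep y) * σ (1 / 3 * ∑ x, c x * e x) = _
      rw [map_mul, map_sum, map_div₀, map_one, map_ofNat σ 3, mul_left_comm, Finset.mul_sum]
      congr 1
      refine Finset.sum_congr rfl fun x _ => ?_
      rw [map_mul, he, algHom_apply_of_mem_O3 hσ (hχO x)]
      simp only [hg, Equiv.coe_mulRight]
      rw [h.chi_unitRep_mul hχ]
      ring
    rw [map_pow]
    calc σ GA ^ 3 = (χ (unitRep y) * σ GA) ^ 3 := by
          rw [mul_pow, hχ.apply_pow_three h (h.unitRep_not_dvd y), one_mul]
      _ = _ := by rw [hσG]; rfl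
  refine ⟨a, b, ?_⟩
  rw [← hab, ← hGA]
  rfl

end IsPrimaryPrime

end

noncomputable section

lemma exists_reduction : ∃ (k : Type) (_ : Field k) (f : AlgInt →+* k), f θA = 0 := by
  have hne : Ideal.span {θA} ≠ ⊤ := by
    rw [Ne, Ideal.span_singleton_eq_top]
    rintro ⟨⟨a, b, hab, -⟩, rfl⟩
    have h1 : sqrtm3 * (b : ℂ) = 1 := congrArg Subtype.val hab
    have h2 : IsIntegral ℤ ((((-1 / 3 : ℚ))) : ℂ) := by
      have := b.2.pow 2
      rw [show (((-1 / 3 : ℚ)) : ℂ) = (b : ℂ) ^ 2 by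
        push_cast
        linear_combination (1 / 3 : ℂ) * ((sqrtm3 * b + 1) * h1 - (b : ℂ) ^ 2 * sqrtm3_sq)]
      exact this
    obtain ⟨n, hn⟩ := exists_int_of_isIntegral h2
    have h3 : (-1 : ℚ) = ((3 * n : ℤ) : ℚ) := by push_cast; linarith
    have h4 : (-1 : ℤ) = 3 * n := by exact_mod_cast h3
    omega
  obtain ⟨M, hM, hle⟩ := Ideal.exists_le_maximal _ hne
  exact ⟨AlgInt ⧸ M, Ideal.Quotient.field M, Ideal.Quotient.mk M,
    Ideal.Quotient.eq_zero_iff_mem.mpr (hle (Ideal.mem_span_singleton_self _))⟩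

lemma cube_sum_of_three_eq_zero {k ι : Type*} [Field k] (h3 : (3 : k) = 0) (T : Finset ι)
    (g : ι → k) : (∑ i ∈ T, g i) ^ 3 = ∑ i ∈ T, g i ^ 3 := by
  classical
  induction T using Finset.induction_on with
  | empty => simp
  | insert i s hi ih =>
    rw [Finset.sum_insert hi, Finset.sum_insert hi, ← ih]
    linear_combination (g i ^ 2 * (∑ i ∈ s, g i) + g i * (∑ i ∈ s, g i) ^ 2) * h3

section
variable {k : Type*} [Field k] {f : AlgInt →+* k}

lemma eCong_of_map_eq (hf : f θA = 0) {z : ℂ} (hz : z ∈ O3) (c : ℤ)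
    (h : f ⟨z, O3_le hz⟩ = c) : ECong z c sqrtm3 := by
  obtain ⟨a, b, hab⟩ := mem_O3.mp hz
  have h1 : (⟨z, O3_le hz⟩ : AlgInt) = a + b * ρA := Subtype.ext (by simp [hab, ρA])
  rw [h1, map_add, map_mul, map_ρA hf, map_intCast, map_intCast, mul_one] at h
  have h2 : (3 : ℤ) ∣ a + b - c := by
    by_contra hnd
    obtain ⟨u, v, huv⟩ := Int.prime_three.coprime_iff_not_dvd.mpr hnd
    have h3 : ((u * 3 + v * (a + b - c) : ℤ) : k) = 1 := by rw [huv, Int.cast_one]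
    push_cast at h3
    apply one_ne_zero (α := k)
    linear_combination -h3 + (u : k) * three_eq_zero hf + (v : k) * h
  obtain ⟨m, hm⟩ := h2
  refine ⟨-sqrtm3 * m - b * ρ3 ^ 2, sub_mem (mul_mem (neg_mem sqrtm3_mem) (int_mem_O3 m))
    (mul_mem (int_mem_O3 b) (pow_mem ρ3_mem 2)), ?_⟩
  have hm' : (a : ℂ) + b - c = 3 * m := by exact_mod_cast hm
  rw [hab]
  have e := ρ3_sub_sq
  linear_combination hm' + (m : ℂ) * sqrtm3_sq - b * ρ3 ^ 2 * e + b * (1 - ρ3) * ρ3_cube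

lemma map_eq_one_of_cube {z : AlgInt} (hz : z ^ 3 = 1) : f z ^ 3 = 1 := by
  rw [← map_pow, hz, map_one]

end

namespace IsPrimaryPrime
variable {p : ℕ} {π : ℂ} (h : IsPrimaryPrime p π) {χ : ℂ → ℂ} (hχ : IsCubicChar π p χ)
include h hχ

lemma isIntegral_chi {n : ℤ} (hn : ¬ (p : ℤ) ∣ n) : IsIntegral ℤ (χ n) :=
  O3_le (mem_O3_of_cube_eq_one (hχ.apply_pow_three h hn))

lemma chi_ρ3_eq {m : ℕ} (hm : (p - 1) / 3 % 3 = m) : χ ρ3 = ρ3 ^ m := by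
  rw [hχ.apply_ρ3 h, ← Nat.div_add_mod ((p - 1) / 3) 3, hm, pow_add, pow_mul, ρ3_cube, one_pow,
    one_mul]

/-- The cube of an elliptic Gauss sum with integral terms whose cubes have constant reduction. -/
lemma eCong_EGS3_cube {F : ℂ → ℂ} (hper : ∀ u, ∀ a ∈ O3, F (u + a) = F u)
    (hF : ∀ u, χ ρ3 * F (ρ3 * u) = F u) (hgal : IsGaloisCompatible F)
    (hint : ∀ n : ℤ, ¬ (p : ℤ) ∣ n → IsIntegral ℤ (F (n / π))) (c d : ℤ)
    (hred : ∀ (k : Type) (_ : Field k) (f : AlgInt →+* k), f θA = 0 →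
      ∀ (n : ℤ) (hn : ¬ (p : ℤ) ∣ n), f ⟨F (n / π), hint n hn⟩ ^ 3 = c)
    (hd : ((p - 1) / 3 : ℕ) * c ≡ d [ZMOD 3]) : ECong (EGS3 p χ F π ^ 3) d sqrtm3 := by
  classical
  obtain ⟨k, _, f, hf⟩ := exists_reduction
  obtain ⟨T, hT, hcard, hG⟩ := h.exists_EGS3_eq_sum hχ hper hF
  let t : T → AlgInt := fun n =>
    ⟨χ (n : ℤ), h.isIntegral_chi hχ (hT n n.2)⟩ * ⟨F ((n : ℤ) / π), hint n (hT n n.2)⟩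
  have hGt : EGS3 p χ F π ^ 3 = (((∑ n, t n) ^ 3 : AlgInt) : ℂ) := by
    rw [hG, ← Finset.sum_coe_sort]
    simp [t]
  have hmap : f ((∑ n, t n) ^ 3) = d := by
    have ht : ∀ n, f (t n) ^ 3 = c := fun n => by
      rw [map_mul, mul_pow, hred k _ f hf n (hT n n.2), map_eq_one_of_cube, one_mul]
      exact Subtype.ext (hχ.apply_pow_three h (hT n n.2))
    rw [map_pow, map_sum, cube_sum_of_three_eq_zero (three_eq_zero hf),
      Finset.sum_congr rfl fun n _ => ht n, Finset.sum_const, Finset.card_univ, Fintype.card_coe,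
      nsmul_eq_mul, show T.card = (p - 1) / 3 by omega]
    obtain ⟨m, hm⟩ := hd.dvd
    have hm' := congrArg (Int.cast : ℤ → k) hm
    simp only [Int.cast_sub, Int.cast_mul, Int.cast_natCast, Int.cast_ofNat] at hm'
    linear_combination -hm' - (m : k) * three_eq_zero hf
  obtain ⟨a, b, hab⟩ := h.exists_rat_EGS3_cube hχ hper hgal
  have hmem : EGS3 p χ F π ^ 3 ∈ O3 := by
    rw [hab]
    apply mem_O3_of_isIntegral
    rw [← hab, hGt]
    exact ((∑ n, t n) ^ 3 : AlgInt).2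
  apply eCong_of_map_eq hf hmem
  rw [← hmap]
  exact congrArg f (Subtype.ext hGt)

lemma eCong_EGS3_phi3_cube (hp : p % 18 = 7) : ECong (EGS3 p χ phi3 π ^ 3) 1 sqrtm3 := by
  have := h.eCong_EGS3_cube hχ (F := phi3) (fun u a ha => phi3_add u ha) (fun u => by
      rw [h.chi_ρ3_eq hχ (m := 2) (by omega), phi3_ρ3_mul]
      linear_combination phi3 u * ρ3_cube) isGaloisCompatible_phi3 (fun n hn => h.isIntegral_phi3 hn)
    2 1 (fun k _ f hf n hn => by rw [h.map_phi3 hf hn, Int.cast_ofNat]) (by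
      rw [Int.ModEq]; omega)
  rwa [Int.cast_one] at this

lemma eCong_EGS3_psi3_cube (hp : p % 18 = 1) : ECong (EGS3 p χ psi3 π ^ 3) 0 sqrtm3 := by
  have := h.eCong_EGS3_cube hχ (F := psi3) (fun u a ha => psi3_add u ha) (fun u => by
      rw [h.chi_ρ3_eq hχ (m := 0) (by omega), psi3_ρ3_mul, pow_zero, one_mul])
    isGaloisCompatible_psi3 (fun n hn => h.isIntegral_psi3 hn)
    1 0 (fun k _ f hf n hn => by rw [h.map_psi3 hf hn, one_pow, Int.cast_one]) (by
      rw [Int.ModEq]; omega)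
  rwa [Int.cast_zero] at this

end IsPrimaryPrime

end

noncomputable section
open Filter Topology

lemma eventually_mul_notMem_O3 {c : ℂ} (hc : c ≠ 0) (x : ℂ) : ∀ᶠ u in 𝓝[≠] x, c * u ∉ O3 := by
  have hc' := mul_ne_zero varpi1_ne_zero hc
  have h1 : Tendsto (fun u => varpi1 * c * u) (𝓝[≠] x) (𝓝[≠] (varpi1 * c * x)) := by
    refine tendsto_nhdsWithin_iff.mpr ⟨(by fun_prop : Continuous fun u : ℂ => varpi1 * c * u).tendsto x
      |>.mono_left nhdsWithin_le_nhds, ?_⟩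
    filter_upwards [self_mem_nhdsWithin] with u hu h
    exact hu (mul_left_cancel₀ hc' h)
  filter_upwards [h1.eventually (eisPair.eventually_notMem_lattice _)] with u hu
  rwa [mul_assoc, varpi1_mul_mem] at hu

lemma analyticAt_eP {u : ℂ} (hu : u ∉ O3) : AnalyticAt ℂ eP u :=
  (PeriodPair.analyticAt_weierstrassP (mt varpi1_mul_mem.mp hu)).comp
    (f := fun u : ℂ => (varpi1 : ℂ) * u) (by fun_prop)

lemma analyticAt_eW {u : ℂ} (hu : u ∉ O3) : AnalyticAt ℂ eW u :=
  (PeriodPair.analyticAt_derivWeierstrassP (mt varpi1_mul_mem.mp hu)).comp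
    (f := fun u : ℂ => (varpi1 : ℂ) * u) (by fun_prop)

lemma notMem_of_sqrtm3_mul_mul {u : ℂ} (hu : sqrtm3 * (sqrtm3 * u) ∉ O3) : u ∉ O3 :=
  notMem_of_sqrtm3_mul (notMem_of_sqrtm3_mul hu)

lemma analyticAt_phi3 {u : ℂ} (hu : sqrtm3 * (sqrtm3 * u) ∉ O3) : AnalyticAt ℂ phi3 u := by
  have h0 := notMem_of_sqrtm3_mul_mul hu
  rw [show phi3 = fun u => 6 * eP u / (9 + eW u) from funext phi3_eq_eP]
  exact (analyticAt_const.mul (analyticAt_eP h0)).div (analyticAt_const.add (analyticAt_eW h0))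
    (nine_add_eW_ne hu)

lemma meromorphicAt_phi3 (x : ℂ) : MeromorphicAt phi3 x := by
  have h1 : MeromorphicAt eP x :=
    (eisPair.meromorphic_weierstrassP (varpi1 * x)).comp_analyticAt
      (g := fun u : ℂ => (varpi1 : ℂ) * u) (by fun_prop)
  have h2 : MeromorphicAt eW x :=
    (eisPair.meromorphic_derivWeierstrassP (varpi1 * x)).comp_analyticAt
      (g := fun u : ℂ => (varpi1 : ℂ) * u) (by fun_prop)
  rw [show phi3 = fun u => 6 * eP u / (9 + eW u) from funext phi3_eq_eP]
  fun_prop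

lemma meromorphicOrderAt_phi3_ne_top (x : ℂ) : meromorphicOrderAt phi3 x ≠ ⊤ := by
  rw [meromorphicOrderAt_ne_top_iff_eventually_ne_zero (meromorphicAt_phi3 x)]
  filter_upwards [eventually_mul_notMem_O3 (mul_ne_zero sqrtm3_ne_zero sqrtm3_ne_zero) x] with u hu
  rw [mul_assoc] at hu
  exact phi3_ne_zero hu

lemma meromorphicOrderAt_phi3_eq_zero {x : ℂ} (hx : sqrtm3 * (sqrtm3 * x) ∉ O3) :
    meromorphicOrderAt phi3 x = 0 := by
  rw [(analyticAt_phi3 hx).meromorphicOrderAt_eq,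
    (analyticAt_phi3 hx).analyticOrderAt_eq_zero.mpr (phi3_ne_zero hx)]
  rfl

lemma meromorphicOrderAt_phi3_add (x : ℂ) {a : ℂ} (ha : a ∈ O3) :
    meromorphicOrderAt phi3 (x + a) = meromorphicOrderAt phi3 x := by
  rw [← meromorphicOrderAt_comp_add_const_eq_meromorphicOrderAt,
    show phi3 ∘ (· + a) = phi3 from funext fun u => phi3_add u ha]

lemma tendsto_phi3_div : Tendsto (fun u => phi3 u / u) (𝓝[≠] 0) (𝓝 (-3 * varpi1)) := by
  have hv := varpi1_ne_zero
  have ht : Tendsto (fun u : ℂ => varpi1 * u) (𝓝[≠] 0) (𝓝[≠] 0) := by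
    refine tendsto_nhdsWithin_iff.mpr ⟨?_, ?_⟩
    · have := (by fun_prop : Continuous fun u : ℂ => varpi1 * u).tendsto 0
      rw [mul_zero] at this
      exact this.mono_left nhdsWithin_le_nhds
    · filter_upwards [self_mem_nhdsWithin] with u hu
      exact mul_ne_zero hv hu
  have h1 := eisPair.tendsto_sq_mul_weierstrassP.comp ht
  have h2 := eisPair.tendsto_cube_mul_derivWeierstrassP.comp ht
  have h3 : Tendsto (fun u : ℂ => 9 * (varpi1 * u) ^ 3) (𝓝[≠] 0) (𝓝 0) := by
    have := (by fun_prop : Continuous fun u : ℂ => 9 * (varpi1 * u) ^ 3).tendsto 0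
    simp only [mul_zero, ne_eq, OfNat.ofNat_ne_zero, not_false_eq_true, zero_pow] at this
    exact this.mono_left nhdsWithin_le_nhds
  have h4 := (h1.const_mul (6 * (varpi1 : ℂ))).div (h3.add h2) (by norm_num)
  rw [show (6 * (varpi1 : ℂ) * 1 / (0 + -2)) = -3 * varpi1 by ring] at h4
  refine h4.congr' ?_
  filter_upwards [self_mem_nhdsWithin] with u hu
  have hu' : u ≠ 0 := hu
  rw [phi3_eq_eP, eP, eW]
  simp only [Function.comp_apply, Pi.div_apply]
  rw [mul_comm 9, ← mul_add, div_div,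
    show 6 * (varpi1 : ℂ) * ((varpi1 * u) ^ 2 * eisPair.weierstrassP (varpi1 * u)) =
      varpi1 ^ 3 * u ^ 2 * (6 * eisPair.weierstrassP (varpi1 * u)) by ring,
    show (varpi1 * u) ^ 3 * (9 + eisPair.derivWeierstrassP (varpi1 * u)) =
      varpi1 ^ 3 * u ^ 2 * ((9 + eisPair.derivWeierstrassP (varpi1 * u)) * u) by ring]
  exact mul_div_mul_left _ _ (by positivity)

/-- Translation of `φ` by the zero of `ψ`. -/
lemma exists_phi3_add_eq : ∃ v : ℂ, sqrtm3 * (sqrtm3 * v) ∈ O3 ∧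
    ∀ u, sqrtm3 * (sqrtm3 * u) ∉ O3 → phi3 (u + v) = -(psi3 u)⁻¹ := by
  obtain ⟨z, hz⟩ := eisPair_isEisenstein.exists_point_eq
    (.some 3 (9 / 2) (eisCurveOver_nonsingular (x := 3) (w := 9) (by norm_num)))
  obtain ⟨v, rfl⟩ : ∃ v, z = varpi1 * v := ⟨z / varpi1, (mul_div_cancel₀ z varpi1_ne_zero).symm⟩
  have hv0 : v ∉ O3 := by
    rw [← varpi1_mul_mem, ← eisPair_isEisenstein.point_eq_zero_iff, hz]
    simp
  rw [eisPair_isEisenstein.point_of_notMem (mt varpi1_mul_mem.mp hv0)] at hz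
  simp only [WeierstrassCurve.Affine.Point.some.injEq] at hz
  have hP : eP v = 3 := hz.1
  have hW : eW v = 9 := by
    have := hz.2
    rw [eW]
    linear_combination 2 * this
  have hv : sqrtm3 * (sqrtm3 * v) ∈ O3 := by
    by_contra h
    exact eW_sq_ne h (by rw [hW]; norm_num)
  refine ⟨v, hv, fun u hu => ?_⟩
  have huv : sqrtm3 * (sqrtm3 * (u + v)) ∉ O3 := fun h => hu (by
    have := sub_mem h hv
    convert this using 1
    ring)
  have hu0 := notMem_of_sqrtm3_mul_mul hu
  have huv0 := notMem_of_sqrtm3_mul_mul huv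
  have hsq := eW_sq hu0
  have hx : eP u ≠ eP v := by
    rw [hP]
    intro h
    rw [h] at hsq
    exact eW_sq_ne hu (by rw [hsq]; norm_num)
  have hmem := mt (varpi1_mul_mem (u := u + v)).mp huv0
  rw [mul_add] at hmem
  have h1 := eisPair_isEisenstein.weierstrassP_add (mt varpi1_mul_mem.mp hu0)
    (mt varpi1_mul_mem.mp hv0) hmem hx
  have h2 := eisPair_isEisenstein.derivWeierstrassP_add (mt varpi1_mul_mem.mp hu0)
    (mt varpi1_mul_mem.mp hv0) hmem hx
  rw [← mul_add] at h1 h2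
  change eP (u + v) = ((eW u - eW v) / 2 / (eP u - eP v)) ^ 2 - eP u - eP v at h1
  change eW (u + v) = -2 * ((eW u - eW v) / 2 / (eP u - eP v)) * (eP (u + v) - eP u) - eW u at h2
  have h9 := nine_add_eW_ne huv
  have h3 := nine_sub_eW_ne hu
  have h4 := nine_add_eW_ne hu
  rw [hP] at hx h1 h2
  rw [hW] at h1 h2
  set m := (eW u - 9) / 2 / (eP u - 3) with hm
  have hd := sub_ne_zero.mpr hx
  have hw : eW u = 9 + 2 * m * (eP u - 3) := by
    rw [hm]
    field_simp
    ring
  have hquad : m ^ 2 * (eP u - 3) + 9 * m - (eP u ^ 2 + 3 * eP u + 9) = 0 := by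
    apply mul_left_cancel₀ hd
    rw [hw] at hsq
    linear_combination hsq / 4
  rw [psi3_eq_eW, phi3_eq_eP, inv_div, ← neg_div, div_eq_div_iff h9 h3, h2, h1, hw]
  linear_combination -4 * m * (m + 3) * hquad

end

noncomputable section
open Filter Topology

/-- The `π`-division point with numerator the least residue of `x`. -/
def divPt {p : ℕ} (π : ℂ) (x : ZMod p) : ℂ := ((x.val : ℤ) : ℂ) / π

namespace IsPrimaryPrime
variable {p : ℕ} {π : ℂ} (h : IsPrimaryPrime p π)
include h

lemma mul_sub_mem {s : ℂ} (hs : sqrtm3 * (sqrtm3 * s) ∈ O3) : π * s - s ∈ O3 := by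
  obtain ⟨d, hd, hπ⟩ := h.primary
  have := mul_mem (neg_mem hd) hs
  convert this using 1
  linear_combination s * hπ + d * s * sqrtm3_sq

lemma mul_divPt (x : ZMod p) : π * divPt π x = (x.val : ℤ) := mul_div_cancel₀ _ h.ne_zero

lemma notMem_add_divPt {u : ℂ} (hu : sqrtm3 * (sqrtm3 * (π * u)) ∉ O3) (x : ZMod p) :
    sqrtm3 * (sqrtm3 * (u + divPt π x)) ∉ O3 := fun hx => hu (by
  have := add_mem (mul_mem h.mem hx) (int_mem_O3 (3 * x.val))
  convert this using 1
  have e := h.mul_divPt x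
  push_cast at e ⊢
  linear_combination (sqrtm3 ^ 2) * -e - (x.val : ℂ) * sqrtm3_sq)

variable [Fact p.Prime]

lemma divPt_neg_add (x : ZMod p) : divPt π (-x) + divPt π x ∈ O3 := by
  rw [divPt, divPt, ← add_div, ← Int.cast_add, h.int_div_mem_iff,
    ← ZMod.intCast_zmod_eq_zero_iff_dvd]
  simp

lemma eq_of_sqrtm3_mul_mem {u : ℂ} {x y : ZMod p} (hx : sqrtm3 * (sqrtm3 * (u + divPt π x)) ∈ O3)
    (hy : sqrtm3 * (sqrtm3 * (u + divPt π y)) ∈ O3) : x = y := by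
  by_contra hne
  have hn : ¬ (p : ℤ) ∣ (x.val : ℤ) - y.val := by
    rw [← ZMod.intCast_zmod_eq_zero_iff_dvd]
    simpa [sub_eq_zero] using hne
  apply h.sqrtm3_mul_mul_notMem hn
  have := sub_mem hx hy
  convert this using 1
  rw [divPt, divPt]
  push_cast
  ring

lemma exists_mem_add_divPt {u : ℂ} (hu : sqrtm3 * (sqrtm3 * (π * u)) ∈ O3) :
    ∃ x : ZMod p, sqrtm3 * (sqrtm3 * (u + divPt π x)) ∈ O3 := by
  obtain ⟨n, hn⟩ := h.exists_int_rep hu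
  have h3 : (3 : ZMod p) ≠ 0 := fun h0 => h.not_dvd_three (by
    rw [← ZMod.intCast_zmod_eq_zero_iff_dvd]; exact_mod_cast h0)
  refine ⟨(n : ZMod p) / 3, ?_⟩
  have h1 := h.sub_div_mem_of_cast_eq (m := n) (n := 3 * ((n : ZMod p) / 3).val) (by
    push_cast
    rw [ZMod.natCast_zmod_val, mul_div_cancel₀ _ h3])
  have := add_mem hn h1
  convert this using 1
  have h0 := h.ne_zero
  rw [divPt]
  push_cast
  field_simp
  linear_combination (((n : ZMod p) / 3).val : ℂ) * sqrtm3_sq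

lemma sum_meromorphicOrderAt_phi3 (u : ℂ) :
    ∑ x : ZMod p, meromorphicOrderAt phi3 (u + divPt π x) = meromorphicOrderAt phi3 (π * u) := by
  by_cases hu : sqrtm3 * (sqrtm3 * (π * u)) ∈ O3
  · obtain ⟨x, hx⟩ := h.exists_mem_add_divPt hu
    rw [Finset.sum_eq_single x (fun y _ hyx => meromorphicOrderAt_phi3_eq_zero fun hy =>
      hyx (h.eq_of_sqrtm3_mul_mem hy hx)) (fun hx' => absurd (Finset.mem_univ x) hx'),
      ← meromorphicOrderAt_phi3_add _ (sub_mem (h.mul_sub_mem hx) (int_mem_O3 x.val))]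
    congr 1
    linear_combination h.mul_divPt x
  · rw [meromorphicOrderAt_phi3_eq_zero hu]
    exact Finset.sum_eq_zero fun x _ => meromorphicOrderAt_phi3_eq_zero (h.notMem_add_divPt hu x)

lemma exists_prod_phi3_add_divPt_eq_const_mul : ∃ C : ℂ, ∀ u,
    sqrtm3 * (sqrtm3 * (π * u)) ∉ O3 → ∏ x : ZMod p, phi3 (u + divPt π x) = C * phi3 (π * u) := by
  have hv := varpi1_ne_zero
  set F : ℂ → ℂ := fun u => ∏ x : ZMod p, phi3 (u + divPt π x) with hF
  set f : ℂ → ℂ := fun u => F u / phi3 (π * u) with hf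
  have hFper : ∀ u, ∀ a ∈ O3, f (u + a) = f u := fun u a ha => by
    simp only [hf, hF, add_right_comm u a, phi3_add _ ha, mul_add, phi3_add _ (mul_mem h.mem ha)]
  have hm1 : ∀ u (x : ZMod p), MeromorphicAt (fun u => phi3 (u + divPt π x)) u := fun u x =>
    (meromorphicAt_phi3 (u + divPt π x)).comp_analyticAt (g := (· + divPt π x)) (by fun_prop)
  have hmF : ∀ u, MeromorphicAt F u := fun u => MeromorphicAt.fun_prod fun x _ => hm1 u x
  have hmπ : ∀ u, MeromorphicAt (fun u => phi3 (π * u)) u := fun u =>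
    (meromorphicAt_phi3 (π * u)).comp_analyticAt (g := (π * ·)) (by fun_prop)
  have hmf : ∀ u, MeromorphicAt f u := fun u => (hmF u).div (hmπ u)
  have hπo : ∀ u, meromorphicOrderAt (fun u => phi3 (π * u)) u = meromorphicOrderAt phi3 (π * u) :=
    fun u => meromorphicOrderAt_comp_of_deriv_ne_zero (f := phi3) (g := (π * ·)) (by fun_prop)
      (by simpa using h.ne_zero)
  have hord : ∀ u, meromorphicOrderAt f u = 0 := fun u => by
    rw [show f = F / fun u => phi3 (π * u) from rfl, meromorphicOrderAt_div (hmF u) (hmπ u), hπo, hF, meromorphicOrderAt_fun_prod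
      fun x _ => hm1 u x, ← h.sum_meromorphicOrderAt_phi3 u]
    have he : ∀ x : ZMod p, meromorphicOrderAt (fun u => phi3 (u + divPt π x)) u =
        meromorphicOrderAt phi3 (u + divPt π x) := fun x =>
      meromorphicOrderAt_comp_add_const_eq_meromorphicOrderAt (f := phi3)
    rw [Finset.sum_congr rfl fun x _ => he x, h.sum_meromorphicOrderAt_phi3 u]
    obtain ⟨n, hn⟩ := WithTop.ne_top_iff_exists.mp (meromorphicOrderAt_phi3_ne_top (π * u))
    rw [← hn, ← WithTop.LinearOrderedAddCommGroup.coe_sub, sub_self, WithTop.coe_zero]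
  obtain ⟨C, hC⟩ := eisPair.exists_eventually_eq_const (f := fun z => f (z / varpi1))
    (fun z l hl => by
      have hl' : l / varpi1 ∈ O3 := by rwa [← varpi1_mul_mem, mul_div_cancel₀ _ hv]
      simp only [add_div, hFper _ _ hl'])
    (fun z => by
      have h1 : MeromorphicAt (fun z => f (z / varpi1)) z :=
        (hmf (z / varpi1)).comp_analyticAt (g := (· / (varpi1 : ℂ))) (by fun_prop (disch := exact hv))
      have h2 : meromorphicOrderAt (fun z => f (z / varpi1)) z = (0 : ℤ) := by
        refine (meromorphicOrderAt_comp_of_deriv_ne_zero (f := f) (g := (· / (varpi1 : ℂ)))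
          (by fun_prop (disch := exact hv)) (by simpa using hv)).trans ?_
        exact hord _
      obtain ⟨g, hg, -, hfg⟩ := (meromorphicOrderAt_eq_int_iff h1).mp h2
      exact ⟨g, hg, hfg.mono fun w hw => by simpa using hw⟩)
  refine ⟨C, fun u hu => ?_⟩
  have hcont : ContinuousAt (fun z => f (z / varpi1)) (varpi1 * u) := by
    have h1 : ContinuousAt f u := by
      refine ContinuousAt.div ?_ ?_ (phi3_ne_zero hu)
      · exact tendsto_finsetProd _ fun x _ => ContinuousAt.comp
          (analyticAt_phi3 (h.notMem_add_divPt hu x)).continuousAt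
          (f := (· + divPt π x)) (by fun_prop)
      · exact ContinuousAt.comp (analyticAt_phi3 hu).continuousAt (f := (π * ·)) (by fun_prop)
    refine ContinuousAt.comp (g := f) (f := (· / (varpi1 : ℂ))) ?_ (by fun_prop (disch := exact hv))
    rwa [mul_div_cancel_left₀ _ hv]
  have h1 := tendsto_nhds_unique (hcont.tendsto.mono_left nhdsWithin_le_nhds)
    (tendsto_const_nhds.congr' ((hC (varpi1 * u)).mono fun z hz => hz.symm))
  rw [mul_div_cancel_left₀ _ hv] at h1
  rw [← h1]
  exact (div_mul_cancel₀ _ (phi3_ne_zero hu)).symm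

/-- The multiplication formula for `φ`. -/
lemma prod_phi3_add_divPt {u : ℂ} (hu : sqrtm3 * (sqrtm3 * (π * u)) ∉ O3) :
    ∏ x : ZMod p, phi3 (u + divPt π x) = phi3 (π * u) := by
  obtain ⟨C, hC⟩ := h.exists_prod_phi3_add_divPt_eq_const_mul
  suffices C = 1 by rw [hC u hu, this, one_mul]
  have hneg : sqrtm3 * (sqrtm3 * (π * -u)) ∉ O3 := by
    simpa only [mul_neg, neg_mem_iff] using hu
  have hψ : ∏ x : ZMod p, psi3 (u + divPt π x) = psi3 (π * u) := by
    have h1 : ∏ x : ZMod p, phi3 (-u + divPt π x) =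
        (∏ x : ZMod p, phi3 (u + divPt π x)) / ∏ x : ZMod p, psi3 (u + divPt π x) := by
      rw [← Equiv.prod_comp (Equiv.neg (ZMod p)), ← Finset.prod_div_distrib]
      refine Finset.prod_congr rfl fun x _ => ?_
      rw [Equiv.neg_apply, ← phi3_neg (_root_.nine_add_eW_ne (h.notMem_add_divPt hu x)),
        ← phi3_add (-(u + divPt π x)) (h.divPt_neg_add x)]
      congr 1
      ring
    have hne : ∏ x : ZMod p, phi3 (u + divPt π x) ≠ 0 := Finset.prod_ne_zero_iff.mpr fun x _ =>
      phi3_ne_zero (h.notMem_add_divPt hu x)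
    have hψne : ∏ x : ZMod p, psi3 (u + divPt π x) ≠ 0 := Finset.prod_ne_zero_iff.mpr fun x _ =>
      psi3_ne_zero (h.notMem_add_divPt hu x)
    rw [hC _ hneg, mul_neg, phi3_neg (_root_.nine_add_eW_ne hu), ← mul_div_assoc, ← hC u hu,
      div_eq_div_iff (psi3_ne_zero hu) hψne] at h1
    exact mul_left_cancel₀ hne h1
  obtain ⟨v, hv, hφv⟩ := exists_phi3_add_eq
  have huv : sqrtm3 * (sqrtm3 * (π * (u + v))) ∉ O3 := fun h1 => hu (by
    have := sub_mem h1 (mul_mem h.mem hv)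
    convert this using 1
    ring)
  have h1 : ∏ x : ZMod p, phi3 (u + v + divPt π x) = -(psi3 (π * u))⁻¹ := by
    rw [Finset.prod_congr rfl fun x _ => by
      rw [add_right_comm, hφv _ (h.notMem_add_divPt hu x)], Finset.prod_neg, Finset.prod_inv_distrib,
      hψ, Finset.card_univ, ZMod.card, Odd.neg_one_pow, neg_one_mul]
    refine h.prime.odd_of_ne_two ?_
    rintro rfl
    have := h.mod_three
    omega
  have h2 : phi3 (π * (u + v)) = -(psi3 (π * u))⁻¹ := by
    rw [← hφv _ hu, ← phi3_add (π * u + v) (h.mul_sub_mem hv)]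
    congr 1
    ring
  rw [hC _ huv, h2] at h1
  exact mul_right_cancel₀ (neg_ne_zero.mpr (inv_ne_zero (psi3_ne_zero hu))) (h1.trans (one_mul _).symm)

lemma prod_phi3_unitRep : ∏ x : (ZMod p)ˣ, phi3 (unitRep x / π) = π := by
  have hπ := h.ne_zero
  have hθ := sqrtm3_ne_zero
  have hF : ∀ᶠ u in 𝓝[≠] (0 : ℂ),
      ∏ x : (ZMod p)ˣ, phi3 (u + unitRep x / π) = phi3 (π * u) / phi3 u := by
    filter_upwards [eventually_mul_notMem_O3 (mul_ne_zero hθ (mul_ne_zero hθ hπ)) 0] with u hu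
    rw [show sqrtm3 * (sqrtm3 * π) * u = sqrtm3 * (sqrtm3 * (π * u)) by ring] at hu
    have h0 := h.notMem_add_divPt hu 0
    have h1 := h.prod_phi3_add_divPt hu
    rw [Fintype.prod_eq_mul_prod_subtype_ne _ (0 : ZMod p),
      ← Equiv.prod_comp (unitsEquivNeZero (G₀ := ZMod p))] at h1
    simp only [divPt, ZMod.val_zero, Nat.cast_zero, Int.cast_zero, zero_div, add_zero] at h0 h1
    rw [← h1, mul_div_cancel_left₀ _ (phi3_ne_zero h0)]
    rfl
  have hlim1 : Tendsto (fun u => ∏ x : (ZMod p)ˣ, phi3 (u + unitRep x / π)) (𝓝[≠] 0)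
      (𝓝 (∏ x : (ZMod p)ˣ, phi3 (unitRep x / π))) := by
    have : ContinuousAt (fun u => ∏ x : (ZMod p)ˣ, phi3 (u + unitRep x / π)) 0 :=
      tendsto_finsetProd _ fun x _ => ContinuousAt.comp (g := phi3)
        (f := (· + (unitRep x : ℂ) / π)) (by
          rw [zero_add]
          exact (analyticAt_phi3 (h.sqrtm3_mul_mul_notMem (h.unitRep_not_dvd x))).continuousAt)
        (by fun_prop)
    simpa using this.tendsto.mono_left nhdsWithin_le_nhds
  have hc : (-3 * varpi1 : ℂ) ≠ 0 := mul_ne_zero (by norm_num) varpi1_ne_zero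
  have hπt : Tendsto (fun u : ℂ => π * u) (𝓝[≠] 0) (𝓝[≠] 0) := by
    refine tendsto_nhdsWithin_iff.mpr ⟨?_, ?_⟩
    · have := (by fun_prop : Continuous fun u : ℂ => π * u).tendsto 0
      rw [mul_zero] at this
      exact this.mono_left nhdsWithin_le_nhds
    · filter_upwards [self_mem_nhdsWithin] with u hu
      exact mul_ne_zero hπ hu
  have hlim2 := ((tendsto_phi3_div.comp hπt).const_mul π).div tendsto_phi3_div hc
  rw [mul_div_cancel_right₀ _ hc] at hlim2
  refine tendsto_nhds_unique (hlim1.congr' hF) (hlim2.congr' ?_)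
  filter_upwards [self_mem_nhdsWithin] with u hu
  have hu' : u ≠ 0 := hu
  simp only [Function.comp_apply, Pi.div_apply]
  field_simp

end IsPrimaryPrime

end

noncomputable section

lemma exists_rat_mul {z w : ℂ} (hz : ∃ a b : ℚ, z = a + b * ρ3) (hw : ∃ a b : ℚ, w = a + b * ρ3) :
    ∃ a b : ℚ, z * w = a + b * ρ3 := by
  obtain ⟨a, b, rfl⟩ := hz
  obtain ⟨c, d, rfl⟩ := hw
  refine ⟨a * c - b * d, a * d + b * c - b * d, ?_⟩
  push_cast
  linear_combination (b * d : ℂ) * ρ3_sq_add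

namespace IsPrimaryPrime
variable {p : ℕ} {π : ℂ} (h : IsPrimaryPrime p π)
include h

lemma exists_unit_neg_ρ3 : ∃ w : (ZMod p)ˣ, orderOf w = 6 ∧ (-ρ3 - unitRep w) / π ∈ O3 := by
  have : Fact p.Prime := ⟨h.prime⟩
  obtain ⟨w, hw, hρ⟩ := h.exists_unit_ρ3
  refine ⟨-1 * w, ?_, ?_⟩
  · have h2 : orderOf (-1 : (ZMod p)ˣ) = 2 := by
      apply orderOf_eq_prime (by simp)
      intro h1
      have h1' : ((-1 : ℤ) : ZMod p) = (1 : ℤ) := by simpa using congrArg Units.val h1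
      rw [ZMod.intCast_eq_intCast_iff_dvd_sub] at h1'
      have := Int.le_of_dvd (by norm_num) h1'
      have := h.mod_three
      have := h.prime.two_le
      have hp2 : p = 2 := by omega
      omega
    rw [(Commute.all _ w).orderOf_mul_eq_mul_orderOf_of_coprime (by rw [h2, hw]; decide), h2, hw]
  · have h1 := h.sub_div_mem_of_cast_eq (m := -unitRep w) (n := unitRep (-1 * w)) (by
      rw [Int.cast_neg, h.unitRep_cast, h.unitRep_cast]
      simp)
    have := sub_mem h1 hρ
    convert this using 1
    push_cast
    ring

lemma exists_unitRep {n : ℤ} (hn : ¬ (p : ℤ) ∣ n) :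
    ∃ x : (ZMod p)ˣ, ((n : ℂ) - unitRep x) / π ∈ O3 := by
  have : Fact p.Prime := ⟨h.prime⟩
  have hn0 : (n : ZMod p) ≠ 0 := by rwa [Ne, ZMod.intCast_zmod_eq_zero_iff_dvd]
  exact ⟨Units.mk0 _ hn0, h.sub_div_mem_of_cast_eq (by rw [h.unitRep_cast]; rfl)⟩

lemma isIntegral_inv_psi3 {n : ℤ} (hn : ¬ (p : ℤ) ∣ n) : IsIntegral ℤ (psi3 (n / π))⁻¹ := by
  have := h.isIntegral_psi3 (n := -n) (by rwa [dvd_neg])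
  rwa [Int.cast_neg, neg_div, psi3_neg] at this

lemma isIntegral_div_phi3_pow_six {n : ℤ} (hn : ¬ (p : ℤ) ∣ n) :
    IsIntegral ℤ (π / phi3 (n / π) ^ 6) := by
  classical
  have : Fact p.Prime := ⟨h.prime⟩
  obtain ⟨w, hw6, hw⟩ := h.exists_unit_neg_ρ3
  obtain ⟨y, hy⟩ := h.exists_unitRep hn
  have hny : (n : ℂ) / π = unitRep y / π + ((n : ℂ) - unitRep y) / π := by ring
  rw [hny, phi3_add _ hy]
  set a : (ZMod p)ˣ → ℂ := fun x => phi3 (unitRep x / π) with ha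
  set b : (ZMod p)ˣ → ℂ := fun x => psi3 (unitRep x / π) with hb
  have ha0 : ∀ x, a x ≠ 0 := fun x => phi3_ne_zero (h.sqrtm3_mul_mul_notMem (h.unitRep_not_dvd x))
  have hb0 : ∀ x, b x ≠ 0 := fun x => psi3_ne_zero (h.sqrtm3_mul_mul_notMem (h.unitRep_not_dvd x))
  have haw : ∀ x, a (x * w) = ρ3 * a x / b x := fun x => by
    simp only [ha, hb]
    rw [h.unitRep_mul_div phi3 (fun u _ h => phi3_add u h) hw, neg_mul, phi3_neg, phi3_ρ3_mul,
      psi3_ρ3_mul]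
    rw [eW_ρ3_mul]
    exact h.nine_add_eW_ne (h.unitRep_not_dvd x)
  have hbw : ∀ x, b (x * w) = (b x)⁻¹ := fun x => by
    simp only [hb]
    rw [h.unitRep_mul_div psi3 (fun u _ h => psi3_add u h) hw, neg_mul, psi3_neg, psi3_ρ3_mul]
  have hinj : Set.InjOn (fun i => y * w ^ i) (Finset.range 6) := fun i hi j hj hij => by
    refine pow_injOn_Iio_orderOf (x := w) ?_ ?_ (mul_left_cancel hij)
    · rw [hw6]; simpa using hi
    · rw [hw6]; simpa using hj
  have hprod : ∏ i ∈ Finset.range 6, a (y * w ^ i) = a y ^ 6 / b y ^ 3 := by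
    simp only [Finset.prod_range_succ, Finset.prod_range_zero, pow_succ, pow_zero, one_mul,
      mul_one, ← mul_assoc, haw, hbw]
    field_simp [hb0 y]
    linear_combination (a y ^ 6) * (ρ3 ^ 12 + ρ3 ^ 9 + ρ3 ^ 6 + ρ3 ^ 3 + 1) * ρ3_cube
  have hπ := h.prod_phi3_unitRep
  rw [← Finset.prod_sdiff (Finset.subset_univ ((Finset.range 6).image fun i => y * w ^ i)),
    Finset.prod_image hinj] at hπ
  change (∏ x ∈ _, a x) * ∏ i ∈ Finset.range 6, a (y * w ^ i) = π at hπ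
  rw [hprod] at hπ
  have hval : π / a y ^ 6 =
      (∏ x ∈ Finset.univ \ (Finset.range 6).image fun i => y * w ^ i, a x) * (b y)⁻¹ ^ 3 := by
    conv_lhs => rw [← hπ]
    have := ha0 y
    have := hb0 y
    field_simp
  change IsIntegral ℤ (π / a y ^ 6)
  rw [hval]
  exact (IsIntegral.prod _ fun x _ => h.isIntegral_phi3 (h.unitRep_not_dvd x)).mul
    ((h.isIntegral_inv_psi3 (h.unitRep_not_dvd y)).pow 3)

lemma isIntegral_mul_inv_phi3 {n : ℤ} (hn : ¬ (p : ℤ) ∣ n) :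
    IsIntegral ℤ (π * (phi3 (n / π))⁻¹) := by
  refine IsIntegral.of_pow (n := 6) (by norm_num) ?_
  rw [show (π * (phi3 (n / π))⁻¹) ^ 6 = π ^ 5 * (π / phi3 (n / π) ^ 6) by ring]
  exact ((O3_le h.mem : IsIntegral ℤ π).pow 5).mul (h.isIntegral_div_phi3_pow_six hn)

/-- If `π z` and `π z²` are integral for `z` in the fraction field, so is `z`. -/
lemma mem_O3_of_isIntegral_mul {z : ℂ} (hz : ∃ a b : ℚ, z = a + b * ρ3)
    (h1 : IsIntegral ℤ (π * z)) (h2 : IsIntegral ℤ (π * z ^ 2)) : z ∈ O3 := by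
  have hπ := h.ne_zero
  have hrat : ∀ w, (∃ a b : ℚ, w = a + b * ρ3) → IsIntegral ℤ w → w ∈ O3 := by
    rintro _ ⟨a, b, rfl⟩ hw
    exact mem_O3_of_isIntegral hw
  have hπr : ∃ a b : ℚ, π = a + b * ρ3 := by
    obtain ⟨a, b, hab⟩ := mem_O3.mp h.mem
    exact ⟨a, b, by simpa using hab⟩
  have hβ := hrat _ (exists_rat_mul hπr hz) h1
  have hβ2 := hrat _ (exists_rat_mul hπr (by rw [sq]; exact exists_rat_mul hz hz)) h2
  obtain ⟨m, hd⟩ := h.exists_int_rep hβ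
  set d := (π * z - m) / π with hd'
  have hm : (m : ℂ) = π * z - π * d := by rw [hd']; field_simp; ring
  have hm2 : (((m ^ 2 : ℤ)) : ℂ) / π ∈ O3 := by
    have := add_mem (sub_mem hβ2 (mul_mem (mul_mem (int_mem_O3 2) hβ) hd))
      (mul_mem h.mem (pow_mem hd 2))
    convert this using 1
    push_cast
    rw [hm]
    field_simp
    ring
  rw [h.int_div_mem_iff] at hm2
  have hm1 := h.int_div_mem_iff.mpr ((Nat.prime_iff_prime_int.mp h.prime).dvd_of_dvd_pow hm2)
  have := add_mem hm1 hd
  convert this using 1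
  rw [hm]
  field_simp
  ring

variable {χ : ℂ → ℂ} (hχ : IsCubicChar π p χ)
include hχ

lemma eCong_EGS3_inv_phi3_cube (hp : p % 18 = 13) :
    ECong (EGS3 p χ (fun u => (phi3 u)⁻¹) π ^ 3) (-1) sqrtm3 := by
  classical
  have hper : ∀ u, ∀ a ∈ O3, (phi3 (u + a))⁻¹ = (phi3 u)⁻¹ := fun u a ha => by rw [phi3_add u ha]
  obtain ⟨T, hT, hcard, hG⟩ := h.exists_EGS3_eq_sum hχ (f := fun u => (phi3 u)⁻¹) hper fun u => by
    rw [h.chi_ρ3_eq hχ (m := 1) (by omega), phi3_ρ3_mul, mul_inv, pow_one,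
      mul_inv_cancel_left₀ ρ3_ne_zero]
  have hrat := h.exists_rat_EGS3_cube hχ hper isGaloisCompatible_phi3.inv
  generalize EGS3 p χ (fun u => (phi3 u)⁻¹) π = G at hG hrat ⊢
  have hmem : G ^ 3 ∈ O3 := by
    obtain ⟨t, ht⟩ := IsAlgClosed.exists_pow_nat_eq π (n := 6) (by norm_num)
    have hti : IsIntegral ℤ t := IsIntegral.of_pow (n := 6) (by norm_num) (by
      rw [ht]; exact O3_le h.mem)
    have htG : IsIntegral ℤ (t * G) := by
      rw [hG, Finset.mul_sum]
      refine IsIntegral.sum _ fun n hn => ?_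
      rw [mul_left_comm]
      refine (h.isIntegral_chi hχ (hT n hn)).mul (IsIntegral.of_pow (n := 6) (by norm_num) ?_)
      rw [mul_pow, ht, inv_pow, ← div_eq_mul_inv]
      exact h.isIntegral_div_phi3_pow_six (hT n hn)
    refine h.mem_O3_of_isIntegral_mul hrat ?_ ?_
    · rw [← ht, show t ^ 6 * G ^ 3 = t ^ 3 * (t * G) ^ 3 by ring]
      exact (hti.pow 3).mul (htG.pow 3)
    · rw [← ht, show t ^ 6 * (G ^ 3) ^ 2 = (t * G) ^ 6 by ring]
      exact htG.pow 6
  obtain ⟨k, _, f, hf⟩ := exists_reduction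
  have h3 := three_eq_zero hf
  have hfπ : f ⟨π, O3_le h.mem⟩ = 1 := by
    obtain ⟨d, hd, hπd⟩ := h.primary
    rw [show (⟨π, O3_le h.mem⟩ : AlgInt) = 1 + 3 * ⟨d, O3_le hd⟩ from
      Subtype.ext (by
        change π = 1 + 3 * d
        linear_combination hπd), map_add, map_mul, map_one, map_ofNat f 3, h3, zero_mul, add_zero]
  let t : T → AlgInt := fun n => ⟨χ (n : ℤ), h.isIntegral_chi hχ (hT n n.2)⟩ *
    ⟨π * (phi3 ((n : ℤ) / π))⁻¹, h.isIntegral_mul_inv_phi3 (hT n n.2)⟩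
  have ht : ∀ n, f (t n) ^ 3 = -1 := fun n => by
    have h1 := h.map_phi3 hf (hT n n.2)
    have h2 : (⟨π * (phi3 ((n : ℤ) / π))⁻¹, h.isIntegral_mul_inv_phi3 (hT n n.2)⟩ : AlgInt) *
        ⟨phi3 ((n : ℤ) / π), h.isIntegral_phi3 (hT n n.2)⟩ = ⟨π, O3_le h.mem⟩ :=
      Subtype.ext (inv_mul_cancel_right₀
        (phi3_ne_zero (h.sqrtm3_mul_mul_notMem (hT n n.2))) π)
    replace h2 := congrArg f h2
    rw [map_mul, hfπ] at h2
    have h4 : (⟨χ (n : ℤ), h.isIntegral_chi hχ (hT n n.2)⟩ : AlgInt) ^ 3 = 1 :=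
      Subtype.ext (hχ.apply_pow_three h (hT n n.2))
    rw [map_mul, mul_pow, map_eq_one_of_cube h4, one_mul]
    set x := f ⟨π * (phi3 ((n : ℤ) / π))⁻¹, h.isIntegral_mul_inv_phi3 (hT n n.2)⟩
    set z := f ⟨phi3 ((n : ℤ) / π), h.isIntegral_phi3 (hT n n.2)⟩
    linear_combination x ^ 3 * h3 + x ^ 3 * h1 - ((x * z) ^ 2 + x * z + 1) * h2
  have htn : ∀ n, (t n : ℂ) = π * (χ (n : ℤ) * (phi3 ((n : ℤ) / π))⁻¹) := fun n =>
    mul_left_comm _ _ _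
  clear_value t
  have hsum : (∑ n, t n) ^ 3 = (⟨π, O3_le h.mem⟩ : AlgInt) ^ 3 * ⟨G ^ 3, O3_le hmem⟩ := by
    apply Subtype.ext
    have : ((∑ n, t n : AlgInt) : ℂ) = π * G := by
      rw [hG, Finset.mul_sum, ← Finset.sum_coe_sort T, AddSubmonoidClass.coe_finsetSum]
      exact Finset.sum_congr rfl fun n _ => htn n
    simp only [SubmonoidClass.coe_pow, MulMemClass.coe_mul, this, mul_pow]
  have hfG : f ⟨G ^ 3, O3_le hmem⟩ = (-1 : ℤ) := by
    have h1 : f ((∑ n, t n) ^ 3) = f ⟨G ^ 3, O3_le hmem⟩ := by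
      rw [hsum, map_mul, map_pow, hfπ, one_pow, one_mul]
    rw [← h1, map_pow, map_sum, cube_sum_of_three_eq_zero h3,
      Finset.sum_congr rfl fun n _ => ht n, Finset.sum_const, Finset.card_univ, Fintype.card_coe,
      nsmul_eq_mul]
    obtain ⟨m, hm⟩ : ∃ m, T.card = 3 * m + 1 := ⟨(p - 4) / 9, by omega⟩
    rw [hm]
    push_cast
    linear_combination -(m : k) * h3
  simpa only [Int.cast_neg, Int.cast_one] using eCong_of_map_eq hf hmem (-1) hfG

end IsPrimaryPrime

end

/-- **Lemma I.5.** Let `π ∈ ℤ[ρ]` be a primary prime with `p = π·π̄`. Then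
`G_π(χ_π, φ)³ ≡ 1 (mod √−3)` if `p ≡ 7 (mod 18)`;
`G_π(χ_π, φ⁻¹)³ ≡ −1 (mod √−3)` if `p ≡ 13 (mod 18)`; and
`G_π(χ_π, ψ)³ ≡ 0 (mod √−3)` if `p ≡ 1 (mod 18)`. -/
theorem stmt_9
    (p : ℕ) (hp : p.Prime) (hp3 : p % 3 = 1)
    (π : ℂ) (hπ : π ∈ O3) (hprimary : ECong π 1 3)
    (hnorm : (p : ℂ) = π * (starRingEnd ℂ) π)
    (χ : ℂ → ℂ) (hχ : IsCubicChar π p χ) :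
    (p % 18 = 7 → ECong ((EGS3 p χ phi3 π) ^ 3) 1 sqrtm3) ∧
    (p % 18 = 13 → ECong ((EGS3 p χ (fun u => (phi3 u)⁻¹) π) ^ 3) (-1) sqrtm3) ∧
    (p % 18 = 1 → ECong ((EGS3 p χ psi3 π) ^ 3) 0 sqrtm3) := by
  have h : IsPrimaryPrime p π := ⟨hp, hp3, hπ, hprimary, hnorm⟩
  exact ⟨h.eCong_EGS3_phi3_cube hχ, h.eCong_EGS3_inv_phi3_cube hχ, h.eCong_EGS3_psi3_cube hχ⟩

end
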